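/- Let β ∈ ℂ with |Re β| < 1/2, let κ ∈ ℂ satisfy κ² = 1 − e^{−2πiβ}, and fix t ∈ ℝ. Then there exist an Ablowitz–Segur Painlevé II function u for κ, a constant C > 0 and N ∈ ℕ such that for every n ≥ N: H_{n−1}(λ0(n), β), H_n(λ0(n), β), H_{n+1}(λ0(n), β) are nonzero, the monic orthogonal polynomials p_{n−1}, p_n, p_{n+1} with respect to w(·; λ0(n), β) exist, there are unique scalars Q_n, R_n ∈ ℂ with x·p_n(x) = p_{n+1}(x) + Q_n·p_n(x) + R_n·p_{n−1}(x), and |Q_n + 2^{−1/2}·u(t)²·n^{−1/6}| ≤ C·n^{−1/2}. -/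

import Mathlib

open MeasureTheory Filter Polynomial

noncomputable section

/-- `A` is the Airy function `Ai` and `A'` its derivative: the unique solution of
`A'' = x·A` with `A 0 = 3^(-2/3)/Γ(2/3)` and `A' 0 = -3^(-1/3)/Γ(1/3)`. -/
def IsAiry (A A' : ℝ → ℝ) : Prop :=
  (∀ x : ℝ, HasDerivAt A (A' x) x) ∧ (∀ x : ℝ, HasDerivAt A' (x * A x) x) ∧
  A 0 = (3 : ℝ) ^ (-(2 : ℝ) / 3) / Real.Gamma (2 / 3) ∧
  A' 0 = -((3 : ℝ) ^ (-(1 : ℝ) / 3)) / Real.Gamma (1 / 3)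

/-- An Ablowitz–Segur Painlevé II function for `κ`: a twice differentiable `u : ℝ → ℂ`
with `u'' τ = τ·u τ + 2·(u τ)^3` for all `τ` and `u τ / Ai τ → κ` as `τ → +∞`. -/
def IsAblowitzSegur (A : ℝ → ℝ) (κ : ℂ) (u : ℝ → ℂ) : Prop :=
  Differentiable ℝ u ∧ Differentiable ℝ (deriv u) ∧
  (∀ τ : ℝ, deriv (deriv u) τ = (τ : ℂ) * u τ + 2 * u τ ^ 3) ∧
  Tendsto (fun τ : ℝ => u τ / (A τ : ℂ)) atTop (nhds κ)

/-- The discontinuous Gaussian weight `w(x; λ0, β)`. -/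
def w (l : ℝ) (β : ℂ) (x : ℝ) : ℂ :=
  (Real.exp (-x ^ 2) : ℝ) *
    (if x < l then Complex.exp (Real.pi * Complex.I * β)
     else Complex.exp (-(Real.pi * Complex.I * β)))

/-- The Hankel determinant `H_n(λ0, β)` of the moments of `w(·; λ0, β)` (with `H_0 = 1`). -/
def H (n : ℕ) (l : ℝ) (β : ℂ) : ℂ :=
  Matrix.det (Matrix.of fun j k : Fin n =>
    ∫ x : ℝ, (x : ℂ) ^ ((j : ℕ) + (k : ℕ)) * w l β x)

/-- The scaled jump location `λ0(n) = √(2n)·(1 + (t/2)·n^(-2/3))`. -/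
def lam0 (t : ℝ) (n : ℕ) : ℝ :=
  Real.sqrt (2 * n) * (1 + t / 2 * (n : ℝ) ^ (-(2 : ℝ) / 3))

/-- `p` is the monic orthogonal polynomial of degree `n` for the weight `w(·; l, β)`. -/
def MonicOrthPoly (n : ℕ) (l : ℝ) (β : ℂ) (p : Polynomial ℂ) : Prop :=
  p.Monic ∧ p.natDegree = n ∧
  ∀ m : ℕ, m < n → ∫ x : ℝ, p.eval (x : ℂ) * (x : ℂ) ^ m * w l β x = 0

namespace DiscontinuousGaussian
open Set Topology

/-! ### Gaussian integrals of polynomials -/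

lemma integrable_pow_mul_gauss (k : ℕ) :
    Integrable (fun x : ℝ => x ^ k * Real.exp (-x ^ 2)) := by
  have h := integrable_rpow_mul_exp_neg_mul_sq (b := 1) one_pos (s := (k : ℝ))
    (by have := k.cast_nonneg (α := ℝ); linarith)
  simpa [Real.rpow_natCast] using h

lemma integrable_eval_mul_gauss (p : ℂ[X]) :
    Integrable (fun x : ℝ => p.eval (x : ℂ) * (Real.exp (-x ^ 2) : ℂ)) := by
  induction p using Polynomial.induction_on' with
  | add p q hp hq =>
    exact (hp.add hq).congr (Eventually.of_forall fun x => by simp [add_mul])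
  | monomial k c =>
    have h := ((integrable_pow_mul_gauss k).ofReal (𝕜 := ℂ)).const_mul c
    refine h.congr (Eventually.of_forall fun x => ?_)
    simp [mul_assoc]

/-- The value `e^{iπβ}` of the jump factor to the left of the discontinuity. -/
def jumpL (β : ℂ) : ℂ := Complex.exp (Real.pi * Complex.I * β)

/-- The value `e^{-iπβ}` of the jump factor to the right of the discontinuity. -/
def jumpR (β : ℂ) : ℂ := Complex.exp (-(Real.pi * Complex.I * β))

lemma w_eq (l : ℝ) (β : ℂ) (x : ℝ) :
    w l β x = (Real.exp (-x ^ 2) : ℂ) * (if x < l then jumpL β else jumpR β) := rfl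

lemma w_eq_indicator (l : ℝ) (β : ℂ) (c : ℂ) (x : ℝ) :
    c * w l β x = jumpR β * (c * (Real.exp (-x ^ 2) : ℂ)) +
      (jumpL β - jumpR β) * (Iio l).indicator (fun x : ℝ => c * (Real.exp (-x ^ 2) : ℂ)) x := by
  rw [w_eq]
  by_cases h : x < l
  · simp [h]; ring
  · simp [h]; ring

lemma jumpL_ne_zero (β : ℂ) : jumpL β ≠ 0 := Complex.exp_ne_zero _

lemma jump_re_pos {β : ℂ} (hβ : |β.re| < 1 / 2) : 0 < (jumpL β).re ∧ 0 < (jumpR β).re := by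
  have h := abs_lt.1 hβ
  have hc : 0 < Real.cos (Real.pi * β.re) :=
    Real.cos_pos_of_mem_Ioo ⟨by nlinarith [Real.pi_pos], by nlinarith [Real.pi_pos]⟩
  constructor
  · rw [jumpL, Complex.exp_re]
    refine mul_pos (Real.exp_pos _) ?_
    simpa using hc
  · rw [jumpR, Complex.exp_re]
    refine mul_pos (Real.exp_pos _) ?_
    simpa using hc

/-- Integration of a polynomial against the discontinuous Gaussian weight. -/
def wInt (β : ℂ) (l : ℝ) (p : ℂ[X]) : ℂ := ∫ x : ℝ, p.eval (x : ℂ) * w l β x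

/-- The integral of a polynomial against the Gaussian over the left half-line. -/
def leftInt (l : ℝ) (p : ℂ[X]) : ℂ :=
  ∫ x in Iic l, p.eval (x : ℂ) * (Real.exp (-x ^ 2) : ℂ)

/-- The integral of a polynomial against the Gaussian. -/
def gaussInt (p : ℂ[X]) : ℂ := ∫ x : ℝ, p.eval (x : ℂ) * (Real.exp (-x ^ 2) : ℂ)

lemma integrable_eval_mul_w (β : ℂ) (l : ℝ) (p : ℂ[X]) :
    Integrable (fun x : ℝ => p.eval (x : ℂ) * w l β x) := by
  have h := integrable_eval_mul_gauss p
  have h2 := (h.const_mul (jumpR β)).add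
    ((h.indicator (measurableSet_Iio (a := l))).const_mul (jumpL β - jumpR β))
  refine h2.congr (Eventually.of_forall fun x => ?_)
  simp only [Pi.add_apply]
  rw [w_eq_indicator]
  by_cases hx : x < l <;> simp [hx]

lemma wInt_eq (β : ℂ) (l : ℝ) (p : ℂ[X]) :
    wInt β l p = jumpR β * gaussInt p + (jumpL β - jumpR β) * leftInt l p := by
  have h := integrable_eval_mul_gauss p
  rw [wInt, gaussInt, leftInt, integral_Iic_eq_integral_Iio, ← integral_indicator measurableSet_Iio,
    ← integral_const_mul, ← integral_const_mul,
    ← integral_add (h.const_mul _) ((h.indicator measurableSet_Iio).const_mul _)]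
  refine integral_congr_ae (Eventually.of_forall fun x => ?_)
  simp only
  rw [w_eq_indicator]
  by_cases hx : x < l <;> simp [hx]

lemma wInt_add (β : ℂ) (l : ℝ) (p q : ℂ[X]) : wInt β l (p + q) = wInt β l p + wInt β l q := by
  rw [wInt, wInt, wInt, ← integral_add (integrable_eval_mul_w β l p) (integrable_eval_mul_w β l q)]
  simp [add_mul]

lemma wInt_C_mul (β : ℂ) (l : ℝ) (c : ℂ) (p : ℂ[X]) : wInt β l (C c * p) = c * wInt β l p := by
  rw [wInt, wInt, ← integral_const_mul]
  simp [mul_assoc]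

/-- `wInt` as a linear map. -/
def wLin (β : ℂ) (l : ℝ) : ℂ[X] →ₗ[ℂ] ℂ where
  toFun := wInt β l
  map_add' := wInt_add β l
  map_smul' c p := by rw [smul_eq_C_mul, wInt_C_mul]; rfl

lemma hasDerivAt_eval_mul_gauss (p : ℂ[X]) (x : ℝ) :
    HasDerivAt (fun x : ℝ => p.eval (x : ℂ) * (Real.exp (-x ^ 2) : ℂ))
      ((derivative p - 2 * X * p).eval (x : ℂ) * (Real.exp (-x ^ 2) : ℂ)) x := by
  have h1 : HasDerivAt (fun x : ℝ => p.eval (x : ℂ)) ((derivative p).eval (x : ℂ)) x :=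
    (p.hasDerivAt (x : ℂ)).comp_ofReal
  have h2 : HasDerivAt (fun x : ℝ => Real.exp (-x ^ 2)) (Real.exp (-x ^ 2) * (-(2 * x))) x := by
    simpa using ((hasDerivAt_pow 2 x).neg).exp
  refine (h1.mul h2.ofReal_comp).congr_deriv ?_
  simp
  ring

lemma leftInt_derivative_sub (l : ℝ) (p : ℂ[X]) :
    leftInt l (derivative p - 2 * X * p) = p.eval (l : ℂ) * (Real.exp (-l ^ 2) : ℂ) := by
  have hi := (integrable_eval_mul_gauss (derivative p - 2 * X * p))
  have ht := tendsto_zero_of_hasDerivAt_of_integrableOn_Iic (a := l)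
    (fun x _ => hasDerivAt_eval_mul_gauss p x) hi.integrableOn
    (integrable_eval_mul_gauss p).integrableOn
  rw [leftInt, integral_Iic_of_hasDerivAt_of_tendsto'
    (fun x _ => hasDerivAt_eval_mul_gauss p x) hi.integrableOn ht, sub_zero]

lemma gaussInt_derivative_sub (p : ℂ[X]) : gaussInt (derivative p - 2 * X * p) = 0 :=
  integral_eq_zero_of_hasDerivAt_of_integrable (fun x => hasDerivAt_eval_mul_gauss p x)
    (integrable_eval_mul_gauss _) (integrable_eval_mul_gauss _)

lemma wInt_derivative_sub (β : ℂ) (l : ℝ) (p : ℂ[X]) :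
    wInt β l (derivative p - 2 * X * p) =
      (jumpL β - jumpR β) * (Real.exp (-l ^ 2) : ℂ) * p.eval (l : ℂ) := by
  rw [wInt_eq, gaussInt_derivative_sub, leftInt_derivative_sub]
  ring

lemma hasDerivAt_wInt (β : ℂ) (l : ℝ) (p : ℂ[X]) :
    HasDerivAt (fun l => wInt β l p)
      ((jumpL β - jumpR β) * (Real.exp (-l ^ 2) : ℂ) * p.eval (l : ℂ)) l := by
  have hi := integrable_eval_mul_gauss p
  have hc : Continuous (fun x : ℝ => p.eval (x : ℂ) * (Real.exp (-x ^ 2) : ℂ)) :=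
    continuous_iff_continuousAt.2 fun x => (hasDerivAt_eval_mul_gauss p x).continuousAt
  have h1 : ∀ y, leftInt y p = leftInt 0 p +
      ∫ x in (0 : ℝ)..y, p.eval (x : ℂ) * (Real.exp (-x ^ 2) : ℂ) := fun y => by
    rw [leftInt, leftInt, ← intervalIntegral.integral_Iic_sub_Iic hi.integrableOn hi.integrableOn]
    ring
  have h2 := intervalIntegral.integral_hasDerivAt_right (hc.intervalIntegrable 0 l)
    (hc.stronglyMeasurableAtFilter _ _) hc.continuousAt
  have h3 := ((h2.const_add (leftInt 0 p)).const_mul (jumpL β - jumpR β)).const_add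
    (jumpR β * gaussInt p)
  refine (h3.congr_deriv (by ring)).congr_of_eventuallyEq (Eventually.of_forall fun y => ?_)
  simp only
  rw [wInt_eq, h1]

/-- Coefficientwise complex conjugation of a polynomial. -/
def conjPoly (p : ℂ[X]) : ℂ[X] := p.map (starRingEnd ℂ)

lemma eval_conjPoly (p : ℂ[X]) (x : ℝ) :
    (conjPoly p).eval (x : ℂ) = starRingEnd ℂ (p.eval (x : ℂ)) := by
  have := Polynomial.eval_map_apply (p := p) (starRingEnd ℂ) (x : ℂ)
  rw [conjPoly]
  simpa using this

lemma wInt_mul_conj_ne_zero {β : ℂ} (hβ : |β.re| < 1 / 2) (l : ℝ) {p : ℂ[X]} (hp : p ≠ 0) :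
    wInt β l (p * conjPoly p) ≠ 0 := by
  obtain ⟨ha, hb⟩ := jump_re_pos hβ
  have hinteg := integrable_eval_mul_w β l (p * conjPoly p)
  have hre : (wInt β l (p * conjPoly p)).re =
      ∫ x : ℝ, ((p * conjPoly p).eval (x : ℂ) * w l β x).re := by
    rw [wInt]; exact (integral_re hinteg).symm
  have hval : ∀ x : ℝ, ((p * conjPoly p).eval (x : ℂ) * w l β x).re =
      ‖p.eval (x : ℂ)‖ ^ 2 * Real.exp (-x ^ 2) *
        (if x < l then (jumpL β).re else (jumpR β).re) := fun x => by
    rw [eval_mul, eval_conjPoly, Complex.mul_conj, w_eq, Complex.normSq_eq_norm_sq, ← mul_assoc,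
      ← Complex.ofReal_mul]
    split_ifs <;> rw [Complex.re_ofReal_mul]
  have hpos : 0 < ∫ x : ℝ, ((p * conjPoly p).eval (x : ℂ) * w l β x).re := by
    rw [integral_pos_iff_support_of_nonneg]
    · have hfin : {x : ℝ | p.eval (x : ℂ) = 0}.Finite := by
        have := (p.roots.toFinset.finite_toSet).preimage
          (f := fun x : ℝ => (x : ℂ)) Complex.ofReal_injective.injOn
        refine this.subset fun x hx => ?_
        simpa [hp] using hx
      have hsub : {x : ℝ | p.eval (x : ℂ) = 0}ᶜ ⊆
          Function.support fun x : ℝ => ((p * conjPoly p).eval (x : ℂ) * w l β x).re := by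
        intro x hx
        rw [Function.mem_support, hval]
        have h1 : 0 < ‖p.eval (x : ℂ)‖ := norm_pos_iff.2 hx
        have h2 : 0 < (if x < l then (jumpL β).re else (jumpR β).re) := by split_ifs <;> assumption
        positivity
      refine lt_of_lt_of_le ?_ (measure_mono hsub)
      rw [measure_compl hfin.measurableSet (by simp [hfin.measure_zero]), hfin.measure_zero]
      simp
    · intro x
      simp only [Pi.zero_apply]
      rw [hval]
      have h2 : 0 < (if x < l then (jumpL β).re else (jumpR β).re) := by split_ifs <;> assumption
      positivity
    · exact hinteg.re
  intro h0
  rw [← hre, h0] at hpos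
  simp at hpos

/-! ### Orthogonal polynomials for the discontinuous weight -/

lemma wInt_sub (β : ℂ) (l : ℝ) (p q : ℂ[X]) : wInt β l (p - q) = wInt β l p - wInt β l q :=
  (wLin β l).map_sub p q

lemma wInt_zero (β : ℂ) (l : ℝ) : wInt β l 0 = 0 := (wLin β l).map_zero

lemma wInt_sum (β : ℂ) (l : ℝ) {ι : Type*} (s : Finset ι) (f : ι → ℂ[X]) :
    wInt β l (∑ i ∈ s, f i) = ∑ i ∈ s, wInt β l (f i) :=
  map_sum (wLin β l) f s

/-- The Hankel matrix of moments. -/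
def hankel (β : ℂ) (n : ℕ) (l : ℝ) : Matrix (Fin n) (Fin n) ℂ :=
  Matrix.of fun j k : Fin n => wInt β l (X ^ ((j : ℕ) + (k : ℕ)))

lemma H_eq_det (β : ℂ) (n : ℕ) (l : ℝ) : H n l β = (hankel β n l).det := by
  simp [H, hankel, wInt]

lemma wInt_mul_eq_zero_of_degree_lt {β : ℂ} {l : ℝ} {n : ℕ} {p q : ℂ[X]}
    (h : ∀ m < n, wInt β l (p * X ^ m) = 0) (hq : q.degree < n) : wInt β l (p * q) = 0 := by
  rcases eq_or_ne q 0 with rfl | hq0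
  · rw [mul_zero, wInt_zero]
  rw [q.as_sum_range_C_mul_X_pow' ((natDegree_lt_iff_degree_lt hq0).2 hq), Finset.mul_sum, wInt_sum]
  refine Finset.sum_eq_zero fun m hm => ?_
  rw [mul_left_comm, wInt_C_mul, h m (Finset.mem_range.1 hm), mul_zero]

lemma degree_conjPoly (p : ℂ[X]) : (conjPoly p).degree = p.degree :=
  degree_map_eq_of_injective (RingHom.injective _) p

lemma eq_zero_of_wInt_mul_X_pow {β : ℂ} (hβ : |β.re| < 1 / 2) {l : ℝ} {n : ℕ} {p : ℂ[X]}
    (hp : p.degree < n) (h : ∀ m < n, wInt β l (p * X ^ m) = 0) : p = 0 := by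
  by_contra h0
  exact wInt_mul_conj_ne_zero hβ l h0
    (wInt_mul_eq_zero_of_degree_lt h ((degree_conjPoly p).trans_lt hp))

lemma hankel_mulVec (β : ℂ) (n : ℕ) (l : ℝ) (v : Fin n → ℂ) (j : Fin n) :
    (hankel β n l).mulVec v j =
      wInt β l ((∑ k : Fin n, C (v k) * X ^ (k : ℕ)) * X ^ (j : ℕ)) := by
  rw [Finset.sum_mul, wInt_sum]
  simp only [Matrix.mulVec, dotProduct, hankel, Matrix.of_apply]
  refine Finset.sum_congr rfl fun k _ => ?_
  rw [mul_assoc, wInt_C_mul, ← pow_add, add_comm (k : ℕ), mul_comm]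

lemma coeff_sum_fin {n : ℕ} (v : Fin n → ℂ) (j : Fin n) :
    (∑ k : Fin n, C (v k) * X ^ (k : ℕ)).coeff j = v j := by
  rw [finsetSum_coeff, Finset.sum_eq_single j]
  · simp
  · intro k _ hk
    rw [coeff_C_mul_X_pow, if_neg]
    exact fun h => hk (Fin.ext h.symm)
  · simp

lemma det_hankel_ne_zero {β : ℂ} (hβ : |β.re| < 1 / 2) (n : ℕ) (l : ℝ) :
    (hankel β n l).det ≠ 0 := by
  intro h0
  obtain ⟨v, hv0, hv⟩ := Matrix.exists_mulVec_eq_zero_iff.2 h0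
  have hp := eq_zero_of_wInt_mul_X_pow hβ (l := l) (degree_sum_fin_lt v)
    (fun m hm => by
      have := congrFun hv ⟨m, hm⟩
      rwa [hankel_mulVec] at this)
  refine hv0 (funext fun j => ?_)
  rw [← coeff_sum_fin v j, hp]
  simp

/-- The non-leading coefficients of the monic orthogonal polynomial of degree `n`. -/
def opCoeff (β : ℂ) (n : ℕ) (l : ℝ) : Fin n → ℂ :=
  -(((hankel β n l).det)⁻¹ •
    Matrix.cramer (hankel β n l) (fun j : Fin n => wInt β l (X ^ ((j : ℕ) + n))))

/-- The part of degree less than `n` of the monic orthogonal polynomial of degree `n`. -/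
def opTail (β : ℂ) (n : ℕ) (l : ℝ) : ℂ[X] := ∑ k : Fin n, C (opCoeff β n l k) * X ^ (k : ℕ)

/-- The monic orthogonal polynomial of degree `n`. -/
def op (β : ℂ) (n : ℕ) (l : ℝ) : ℂ[X] := X ^ n + opTail β n l

lemma degree_opTail_lt (β : ℂ) (n : ℕ) (l : ℝ) : (opTail β n l).degree < n :=
  degree_sum_fin_lt _

lemma monic_op (β : ℂ) (n : ℕ) (l : ℝ) : (op β n l).Monic :=
  monic_X_pow_add (degree_opTail_lt β n l)

lemma degree_op (β : ℂ) (n : ℕ) (l : ℝ) : (op β n l).degree = n := by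
  rw [op, degree_add_eq_left_of_degree_lt] <;> rw [degree_X_pow]
  exact degree_opTail_lt β n l

lemma natDegree_op (β : ℂ) (n : ℕ) (l : ℝ) : (op β n l).natDegree = n :=
  natDegree_eq_of_degree_eq_some (degree_op β n l)

section

variable {β : ℂ}

lemma wInt_op_mul_X_pow (hβ : |β.re| < 1 / 2) {n m : ℕ} (hm : m < n) (l : ℝ) :
    wInt β l (op β n l * X ^ m) = 0 := by
  have h1 := hankel_mulVec β n l (opCoeff β n l) ⟨m, hm⟩
  rw [opCoeff, Matrix.mulVec_neg, Matrix.mulVec_smul, Matrix.mulVec_cramer, smul_smul,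
    inv_mul_cancel₀ (det_hankel_ne_zero hβ n l), one_smul] at h1
  rw [op, add_mul, wInt_add, opTail, opCoeff, ← h1, ← pow_add, add_comm n]
  simp

lemma wInt_op_mul (hβ : |β.re| < 1 / 2) {n : ℕ} (l : ℝ) {q : ℂ[X]} (hq : q.degree < n) :
    wInt β l (op β n l * q) = 0 :=
  wInt_mul_eq_zero_of_degree_lt (fun _ hm => wInt_op_mul_X_pow hβ hm l) hq

/-- The squared norm `∫ p_n² w` of the monic orthogonal polynomial. -/
def opNorm (β : ℂ) (n : ℕ) (l : ℝ) : ℂ := wInt β l (op β n l * op β n l)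

lemma degree_sub_op_lt {n : ℕ} {q : ℂ[X]} (hq : q.Monic) (hn : q.natDegree = n) (l : ℝ) :
    (q - op β n l).degree < n := by
  have hd : q.degree = n := by rw [degree_eq_natDegree hq.ne_zero, hn]
  have := degree_sub_lt_left (hd.trans (degree_op β n l).symm) hq.ne_zero
    (by rw [hq.leadingCoeff, (monic_op β n l).leadingCoeff])
  rwa [hd] at this

lemma wInt_op_mul_monic (hβ : |β.re| < 1 / 2) {n : ℕ} (l : ℝ) {q : ℂ[X]} (hq : q.Monic)
    (hn : q.natDegree = n) : wInt β l (op β n l * q) = opNorm β n l := by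
  have h := wInt_op_mul hβ l (degree_sub_op_lt (β := β) hq hn l)
  rw [mul_sub, wInt_sub] at h
  exact sub_eq_zero.1 h

lemma opNorm_ne_zero (hβ : |β.re| < 1 / 2) (n : ℕ) (l : ℝ) : opNorm β n l ≠ 0 := by
  rw [← wInt_op_mul_monic hβ l (q := conjPoly (op β n l)) ((monic_op β n l).map _)
    (by rw [conjPoly, natDegree_map_eq_of_injective (RingHom.injective _), natDegree_op])]
  exact wInt_mul_conj_ne_zero hβ l (monic_op β n l).ne_zero

/-- `J e^{-λ²}`, where `J` is the jump of the weight at the discontinuity. -/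
def jumpGauss (β : ℂ) (l : ℝ) : ℂ := (jumpL β - jumpR β) * (Real.exp (-l ^ 2) : ℂ)

/-- The diagonal recurrence coefficient with its sign changed. -/
def recX (β : ℂ) (n : ℕ) (l : ℝ) : ℂ :=
  jumpGauss β l * (op β n l).eval (l : ℂ) ^ 2 / (2 * opNorm β n l)

/-- The off-diagonal recurrence coefficient `R_{m+1}`. -/
def recR (β : ℂ) (m : ℕ) (l : ℝ) : ℂ := opNorm β (m + 1) l / opNorm β m l

lemma wInt_derivative (β : ℂ) (l : ℝ) (p : ℂ[X]) :
    wInt β l (derivative p) = 2 * wInt β l (X * p) + jumpGauss β l * p.eval (l : ℂ) := by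
  have h := wInt_derivative_sub β l p
  rw [wInt_sub, show (2 * X * p : ℂ[X]) = C 2 * (X * p) by rw [mul_assoc]; rfl, wInt_C_mul] at h
  rw [jumpGauss, ← h]
  ring

lemma degree_derivative_op_lt (n : ℕ) (l : ℝ) : (derivative (op β n l)).degree < n := by
  have := degree_derivative_lt (monic_op β n l).ne_zero
  rwa [degree_op] at this

lemma wInt_X_op_op (hβ : |β.re| < 1 / 2) (n : ℕ) (l : ℝ) :
    wInt β l (X * (op β n l * op β n l)) = -(recX β n l) * opNorm β n l := by
  have h := wInt_derivative β l (op β n l * op β n l)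
  have h0 := wInt_op_mul hβ l (degree_derivative_op_lt (β := β) n l)
  rw [derivative_mul, mul_comm (derivative _), wInt_add, h0, eval_mul] at h
  rw [recX]
  field_simp [opNorm_ne_zero hβ n l]
  linear_combination (-1 : ℂ) * h

lemma recR_eq (hβ : |β.re| < 1 / 2) (m : ℕ) (l : ℝ) :
    2 * recR β m l * opNorm β m l = (m + 1) * opNorm β m l -
      jumpGauss β l * (op β (m + 1) l).eval (l : ℂ) * (op β m l).eval (l : ℂ) := by
  have h := wInt_derivative β l (op β (m + 1) l * op β m l)
  have h1 : wInt β l (op β (m + 1) l * derivative (op β m l)) = 0 :=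
    wInt_op_mul hβ l ((degree_derivative_op_lt m l).trans (by norm_cast; omega))
  have h2 : wInt β l (X * (op β (m + 1) l * op β m l)) = opNorm β (m + 1) l := by
    rw [mul_left_comm]
    exact wInt_op_mul_monic hβ l (monic_X.mul (monic_op β m l))
      (by rw [monic_X.natDegree_mul (monic_op β m l), natDegree_X, natDegree_op, add_comm])
  have h3 : wInt β l (derivative (op β (m + 1) l) * op β m l) = (m + 1) * opNorm β m l := by
    set q := derivative (op β (m + 1) l) - C (m + 1 : ℂ) * op β m l with hq
    have hdeg : q.degree < m := by
      rw [degree_lt_iff_coeff_zero]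
      intro k hk
      rw [hq, coeff_sub, coeff_derivative, coeff_C_mul]
      rcases hk.eq_or_lt with rfl | hk
      · have e1 : (op β (m + 1) l).coeff (m + 1) = 1 := by
          have := (monic_op β (m + 1) l).coeff_natDegree
          rwa [natDegree_op] at this
        have e2 : (op β m l).coeff m = 1 := by
          have := (monic_op β m l).coeff_natDegree
          rwa [natDegree_op] at this
        rw [e1, e2]; ring
      · rw [coeff_eq_zero_of_natDegree_lt (by rw [natDegree_op]; omega),
          coeff_eq_zero_of_natDegree_lt (by rw [natDegree_op]; omega)]
        ring
    have h0 := wInt_op_mul hβ l hdeg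
    rw [hq, mul_sub, wInt_sub, mul_left_comm, wInt_C_mul] at h0
    rw [mul_comm, sub_eq_zero.1 h0, opNorm]
  rw [derivative_mul, wInt_add, h1, h2, h3, eval_mul] at h
  rw [recR, mul_assoc, div_mul_cancel₀ _ (opNorm_ne_zero hβ m l)]
  linear_combination (-1 : ℂ) * h

lemma three_term (hβ : |β.re| < 1 / 2) (m : ℕ) (l : ℝ) :
    X * op β (m + 1) l = op β (m + 2) l + C (-(recX β (m + 1) l)) * op β (m + 1) l +
      C (recR β m l) * op β m l := by
  have hX : (X * op β (m + 1) l).Monic := monic_X.mul (monic_op β _ l)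
  have hXd : (X * op β (m + 1) l).natDegree = m + 2 := by
    rw [monic_X.natDegree_mul (monic_op β _ l), natDegree_X, natDegree_op]; ring
  set r := X * op β (m + 1) l - op β (m + 2) l - C (-(recX β (m + 1) l)) * op β (m + 1) l -
    C (recR β m l) * op β m l with hr
  have hlt : ∀ (c : ℂ) (k : ℕ), k < m + 2 → (C c * op β k l).degree < ((m + 2 : ℕ) : WithBot ℕ) :=
    fun c k hk => by
      rw [← smul_eq_C_mul]
      refine (degree_smul_le c _).trans_lt ?_
      rw [degree_op]; exact_mod_cast hk
  have hdeg : r.degree < ((m + 2 : ℕ) : WithBot ℕ) := by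
    refine (degree_sub_le _ _).trans_lt (max_lt ((degree_sub_le _ _).trans_lt (max_lt ?_ ?_)) ?_)
    · exact degree_sub_op_lt hX hXd l
    · exact hlt _ _ (by omega)
    · exact hlt _ _ (by omega)
  have hw : ∀ q : ℂ[X], wInt β l (r * q) = wInt β l (op β (m + 1) l * (X * q)) -
      wInt β l (op β (m + 2) l * q) + recX β (m + 1) l * wInt β l (op β (m + 1) l * q) -
      recR β m l * wInt β l (op β m l * q) := fun q => by
    rw [hr, sub_mul, sub_mul, sub_mul, wInt_sub, wInt_sub, wInt_sub, mul_assoc (C _),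
      mul_assoc (C _), wInt_C_mul, wInt_C_mul, mul_comm X, mul_assoc]
    ring
  have hr0 : r = 0 := by
    have key : ∀ k < m + 1, wInt β l (r * X ^ k) = 0 := fun k hk => by
      rw [hw, wInt_op_mul_X_pow hβ (by omega), wInt_op_mul_X_pow hβ hk, ← pow_succ']
      rcases Nat.lt_succ_iff_lt_or_eq.1 hk with hk' | rfl
      · rw [wInt_op_mul_X_pow hβ (by omega), wInt_op_mul_X_pow hβ hk']; ring
      · rw [wInt_op_mul_monic hβ l (monic_X_pow _) (natDegree_X_pow _),
          wInt_op_mul_monic hβ l (monic_X_pow _) (natDegree_X_pow _), recR,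
          div_mul_cancel₀ _ (opNorm_ne_zero hβ _ l)]
        ring
    refine eq_zero_of_wInt_mul_X_pow hβ (l := l) hdeg fun k hk => ?_
    rcases Nat.lt_succ_iff_lt_or_eq.1 hk with hk' | rfl
    · exact key k hk'
    · have hA : wInt β l (op β (m + 2) l * op β (m + 1) l) = 0 :=
        wInt_op_mul hβ l (by rw [degree_op]; exact_mod_cast Nat.lt_succ_self (m + 1))
      have hB : wInt β l (op β (m + 1) l * op β m l) = 0 :=
        wInt_op_mul hβ l (by rw [degree_op]; exact_mod_cast Nat.lt_succ_self m)
      have h1 : wInt β l (r * op β (m + 1) l) = 0 := by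
        rw [hw, mul_left_comm, wInt_X_op_op hβ, hA, mul_comm (op β m l), hB, opNorm]
        ring
      have h2 := wInt_mul_eq_zero_of_degree_lt key
        (degree_sub_op_lt (β := β) (monic_X_pow (m + 1)) (natDegree_X_pow _) l)
      rw [mul_sub, wInt_sub, h1, sub_zero] at h2
      exact h2
  linear_combination hr0

end

/-! ### Dependence of the orthogonal polynomials on the location of the discontinuity -/

section

variable {β : ℂ}

lemma differentiableAt_det {n : ℕ} {M : ℝ → Matrix (Fin n) (Fin n) ℂ} {l : ℝ}
    (h : ∀ i j, DifferentiableAt ℝ (fun s => M s i j) l) :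
    DifferentiableAt ℝ (fun s => (M s).det) l := by
  simp only [Matrix.det_apply]
  refine DifferentiableAt.fun_sum fun σ _ => DifferentiableAt.const_smul ?_ _
  exact DifferentiableAt.fun_finsetProd fun i _ => h _ _

lemma differentiableAt_wInt (p : ℂ[X]) (l : ℝ) : DifferentiableAt ℝ (fun s => wInt β s p) l :=
  (hasDerivAt_wInt β l p).differentiableAt

lemma differentiableAt_opCoeff (hβ : |β.re| < 1 / 2) (n : ℕ) (l : ℝ) (k : Fin n) :
    DifferentiableAt ℝ (fun s => opCoeff β n s k) l := by
  simp only [opCoeff, Pi.neg_apply, Pi.smul_apply, Matrix.cramer_apply, smul_eq_mul]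
  have h1 : DifferentiableAt ℝ (fun s => (hankel β n s).det) l :=
    differentiableAt_det fun i j => differentiableAt_wInt _ l
  refine ((h1.inv (det_hankel_ne_zero hβ n l)).mul (differentiableAt_det fun i j => ?_)).neg
  simp only [Matrix.updateCol_apply]
  split_ifs
  · exact differentiableAt_wInt _ l
  · exact differentiableAt_wInt _ l

/-- The derivative of the monic orthogonal polynomial in the location of the discontinuity. -/
def opDot (β : ℂ) (n : ℕ) (l : ℝ) : ℂ[X] :=
  ∑ k : Fin n, C (deriv (fun s => opCoeff β n s k) l) * X ^ (k : ℕ)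

lemma degree_opDot_lt (n : ℕ) (l : ℝ) : (opDot β n l).degree < n := degree_sum_fin_lt _

lemma hasDerivAt_wInt_op_mul (hβ : |β.re| < 1 / 2) (n : ℕ) (l : ℝ) (q : ℂ[X]) :
    HasDerivAt (fun s => wInt β s (op β n s * q))
      (wInt β l (opDot β n l * q) + jumpGauss β l * (op β n l * q).eval (l : ℂ)) l := by
  have h1 : ∀ s, wInt β s (op β n s * q) = wInt β s (X ^ n * q) +
      ∑ k : Fin n, opCoeff β n s k * wInt β s (X ^ (k : ℕ) * q) := fun s => by
    rw [op, add_mul, wInt_add, opTail, Finset.sum_mul, wInt_sum]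
    simp only [mul_assoc, wInt_C_mul]
  have h2 := (hasDerivAt_wInt β l (X ^ n * q)).add
    (HasDerivAt.fun_sum (u := Finset.univ) fun (k : Fin n) _ =>
      (differentiableAt_opCoeff hβ n l k).hasDerivAt.mul
        (hasDerivAt_wInt β l (X ^ (k : ℕ) * q)))
  refine (h2.congr_deriv ?_).congr_of_eventuallyEq (Eventually.of_forall h1)
  rw [opDot, op, opTail, Finset.sum_mul, wInt_sum, add_mul, eval_add, Finset.sum_mul,
    eval_finsetSum, jumpGauss, Finset.sum_add_distrib]
  simp only [mul_assoc, wInt_C_mul, eval_mul, eval_C]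
  have h3 : ∑ x : Fin n, opCoeff β n l x * ((jumpL β - jumpR β) * ((Real.exp (-l ^ 2) : ℂ) *
      (eval (l : ℂ) (X ^ (x : ℕ)) * eval (l : ℂ) q))) =
      (jumpL β - jumpR β) * ((Real.exp (-l ^ 2) : ℂ) *
        ∑ x : Fin n, opCoeff β n l x * (eval (l : ℂ) (X ^ (x : ℕ)) * eval (l : ℂ) q)) := by
    rw [Finset.mul_sum, Finset.mul_sum]
    exact Finset.sum_congr rfl fun k _ => by ring
  rw [h3]
  ring

lemma wInt_opDot_mul (hβ : |β.re| < 1 / 2) (n : ℕ) (l : ℝ) {q : ℂ[X]} (hq : q.degree < n) :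
    wInt β l (opDot β n l * q) = -(jumpGauss β l * (op β n l * q).eval (l : ℂ)) := by
  have h := hasDerivAt_wInt_op_mul hβ n l q
  have h0 : (fun s => wInt β s (op β n s * q)) = fun _ => 0 :=
    funext fun s => wInt_op_mul hβ s hq
  rw [h0] at h
  linear_combination h.unique (hasDerivAt_const l (0 : ℂ))

lemma hasDerivAt_opNorm (hβ : |β.re| < 1 / 2) (n : ℕ) (l : ℝ) :
    HasDerivAt (opNorm β n) (2 * recX β n l * opNorm β n l) l := by
  have h := hasDerivAt_wInt_op_mul hβ n l (X ^ n)
  have h0 : (fun s => wInt β s (op β n s * X ^ n)) = opNorm β n :=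
    funext fun s => wInt_op_mul_monic hβ s (monic_X_pow n) (natDegree_X_pow n)
  rw [h0] at h
  refine h.congr_deriv ?_
  have h1 := wInt_opDot_mul hβ n l
    (degree_sub_op_lt (β := β) (monic_X_pow n) (natDegree_X_pow n) l)
  have h2 : wInt β l (opDot β n l * op β n l) = 0 := by
    rw [mul_comm]; exact wInt_op_mul hβ l (degree_opDot_lt n l)
  rw [mul_sub, wInt_sub, h2, sub_zero] at h1
  rw [h1, recX, mul_sub, eval_sub, eval_mul, eval_mul]
  field_simp [opNorm_ne_zero hβ n l]
  ring

lemma opDot_add_derivative (hβ : |β.re| < 1 / 2) (m : ℕ) (l : ℝ) :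
    opDot β (m + 1) l + derivative (op β (m + 1) l) = C (2 * recR β m l) * op β m l := by
  have key : opDot β (m + 1) l + derivative (op β (m + 1) l) - C (2 * recR β m l) * op β m l =
      0 := by
    refine eq_zero_of_wInt_mul_X_pow hβ (l := l) (n := m + 1) ?_ fun k hk => ?_
    · refine (degree_sub_le _ _).trans_lt (max_lt ((degree_add_le _ _).trans_lt
        (max_lt (degree_opDot_lt _ l) (degree_derivative_op_lt _ l))) ?_)
      rw [← smul_eq_C_mul]
      refine (degree_smul_le _ _).trans_lt ?_
      rw [degree_op]; exact_mod_cast Nat.lt_succ_self m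
    · have hd : ((X : ℂ[X]) ^ k).degree < ((m + 1 : ℕ) : WithBot ℕ) := by
        rw [degree_X_pow]; exact_mod_cast hk
      have h1 := wInt_opDot_mul hβ (m + 1) l hd
      have h2 := wInt_derivative β l (op β (m + 1) l * X ^ k)
      have h3 : wInt β l (op β (m + 1) l * derivative (X ^ k)) = 0 :=
        wInt_op_mul hβ l ((degree_derivative_le).trans_lt hd)
      rw [derivative_mul, wInt_add, h3, add_zero] at h2
      rw [sub_mul, add_mul, wInt_sub, wInt_add, h1, h2, mul_assoc, wInt_C_mul, mul_left_comm,
        ← pow_succ']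
      rcases Nat.lt_succ_iff_lt_or_eq.1 hk with hk' | rfl
      · rw [wInt_op_mul_X_pow hβ (by omega), wInt_op_mul_X_pow hβ hk']; ring
      · rw [wInt_op_mul_monic hβ l (monic_X_pow _) (natDegree_X_pow _),
          wInt_op_mul_monic hβ l (monic_X_pow _) (natDegree_X_pow _), recR, mul_assoc,
          div_mul_cancel₀ _ (opNorm_ne_zero hβ _ l)]
        ring
  exact sub_eq_zero.1 key

/-- The monic orthogonal polynomial evaluated at the discontinuity. -/
def opDiag (β : ℂ) (n : ℕ) (l : ℝ) : ℂ := (op β n l).eval (l : ℂ)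

lemma hasDerivAt_opDiag (hβ : |β.re| < 1 / 2) (m : ℕ) (l : ℝ) :
    HasDerivAt (opDiag β (m + 1)) (2 * recR β m l * opDiag β m l) l := by
  have h1 : ∀ s : ℝ, opDiag β (m + 1) s = (s : ℂ) ^ (m + 1) +
      ∑ k : Fin (m + 1), opCoeff β (m + 1) s k * (s : ℂ) ^ (k : ℕ) := fun s => by
    simp [opDiag, op, opTail, eval_finsetSum]
  have hp : ∀ k : ℕ, HasDerivAt (fun s : ℝ => (s : ℂ) ^ k) ((k : ℂ) * (l : ℂ) ^ (k - 1)) l :=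
    fun k => (hasDerivAt_pow k (l : ℂ)).comp_ofReal
  have h2 := (hp (m + 1)).add
    (HasDerivAt.fun_sum (u := Finset.univ) fun (k : Fin (m + 1)) _ =>
      (differentiableAt_opCoeff hβ (m + 1) l k).hasDerivAt.mul (hp k))
  refine (h2.congr_deriv ?_).congr_of_eventuallyEq (Eventually.of_forall h1)
  have h3 := congrArg (eval (l : ℂ)) (opDot_add_derivative hβ m l)
  rw [eval_mul, eval_C] at h3
  rw [opDiag, ← h3, opDot, op, opTail]
  simp only [eval_add, eval_finsetSum, eval_mul, eval_C, eval_pow, eval_X, derivative_add,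
    derivative_X_pow, derivative_sum, derivative_C_mul_X_pow, Finset.sum_add_distrib]
  simp only [mul_assoc]
  push_cast
  ring

lemma hasDerivAt_recR (hβ : |β.re| < 1 / 2) (m : ℕ) (l : ℝ) :
    HasDerivAt (recR β m) (recR β m l * (2 * recX β (m + 1) l - 2 * recX β m l)) l := by
  have h := (hasDerivAt_opNorm hβ (m + 1) l).div (hasDerivAt_opNorm hβ m l) (opNorm_ne_zero hβ m l)
  refine h.congr_deriv ?_
  have := opNorm_ne_zero hβ m l
  rw [recR]
  field_simp
  

/-- `p_n(λ; λ) e^{-λ²/2}`. -/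
def zFun (β : ℂ) (n : ℕ) (l : ℝ) : ℂ := opDiag β n l * (Real.exp (-l ^ 2 / 2) : ℂ)

/-- The derivative of `zFun β (m + 1)`. -/
def zDeriv (β : ℂ) (m : ℕ) (l : ℝ) : ℂ :=
  (2 * recR β m l * opDiag β m l - l * opDiag β (m + 1) l) * (Real.exp (-l ^ 2 / 2) : ℂ)

lemma hasDerivAt_exp_half (l : ℝ) :
    HasDerivAt (fun l : ℝ => (Real.exp (-l ^ 2 / 2) : ℂ)) (-(l : ℂ) * (Real.exp (-l ^ 2 / 2) : ℂ))
      l := by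
  have h : HasDerivAt (fun l : ℝ => Real.exp (-l ^ 2 / 2)) (Real.exp (-l ^ 2 / 2) * (-(2 * l) / 2))
      l := by
    simpa using (((hasDerivAt_pow 2 l).neg).div_const 2).exp
  refine h.ofReal_comp.congr_deriv ?_
  push_cast
  ring

lemma hasDerivAt_zFun (hβ : |β.re| < 1 / 2) (m : ℕ) (l : ℝ) :
    HasDerivAt (zFun β (m + 1)) (zDeriv β m l) l := by
  refine ((hasDerivAt_opDiag hβ m l).mul (hasDerivAt_exp_half l)).congr_deriv ?_
  rw [zDeriv]; ring

lemma hasDerivAt_zDeriv (hβ : |β.re| < 1 / 2) (m : ℕ) (l : ℝ) :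
    HasDerivAt (zDeriv β (m + 1))
      (((l : ℂ) ^ 2 - 2 * (m + 2 : ℂ) - 1 + 4 * l * recX β (m + 2) l) * zFun β (m + 2) l +
        4 * recX β (m + 2) l * zDeriv β (m + 1) l) l := by
  have h1 := (((hasDerivAt_recR hβ (m + 1) l).const_mul 2).mul (hasDerivAt_opDiag hβ m l)).sub
    ((hasDerivAt_id l).ofReal_comp.mul (hasDerivAt_opDiag hβ (m + 1) l))
  refine (h1.mul (hasDerivAt_exp_half l)).congr_deriv ?_
  have h3 := congrArg (eval (l : ℂ)) (three_term hβ m l)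
  simp only [eval_add, eval_mul, eval_C, eval_X] at h3
  have h4 := recR_eq hβ (m + 1) l
  have hn := opNorm_ne_zero hβ (m + 1) l
  have hn2 := opNorm_ne_zero hβ (m + 2) l
  -- `4 R y = (2 n - 4 Y) y` with `Y y = X R y₁`
  have h5 : 2 * recR β (m + 1) l * opDiag β (m + 2) l = (m + 2) * opDiag β (m + 2) l -
      2 * recX β (m + 2) l * (recR β (m + 1) l * opDiag β (m + 1) l) := by
    have hx : recX β (m + 2) l * (2 * opNorm β (m + 2) l) =
        jumpGauss β l * opDiag β (m + 2) l ^ 2 := by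
      rw [recX, div_mul_cancel₀ _ (by simpa using hn2)]; rfl
    have hr : recR β (m + 1) l * opNorm β (m + 1) l = opNorm β (m + 2) l := by
      rw [recR, div_mul_cancel₀ _ hn]
    have hy1 : (op β (m + 1) l).eval (l : ℂ) = opDiag β (m + 1) l := rfl
    have hy2 : (op β (m + 1 + 1) l).eval (l : ℂ) = opDiag β (m + 2) l := rfl
    rw [hy1, hy2] at h4
    push_cast at h4
    refine mul_right_cancel₀ hn ?_
    linear_combination opDiag β (m + 2) l * h4 + opDiag β (m + 1) l * hx +
      2 * recX β (m + 2) l * opDiag β (m + 1) l * hr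
  change (l : ℂ) * opDiag β (m + 1) l = opDiag β (m + 2) l +
    -recX β (m + 1) l * opDiag β (m + 1) l + recR β m l * opDiag β m l at h3
  simp only [zDeriv, zFun, Pi.mul_apply, Pi.sub_apply, id,
    Complex.ofReal_one]
  linear_combination (Real.exp (-l ^ 2 / 2) : ℂ) * (-4 * recR β (m + 1) l * h3 - 2 * h5)

/-- The second-order equation satisfied by `zFun`, in divergence form. -/
lemma hasDerivAt_zDeriv_div (hβ : |β.re| < 1 / 2) (m : ℕ) (l : ℝ) :
    HasDerivAt (fun s => zDeriv β (m + 1) s / opNorm β (m + 2) s ^ 2)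
      (((l : ℂ) ^ 2 - 2 * (m + 2 : ℂ) - 1 + 4 * l * recX β (m + 2) l) * zFun β (m + 2) l /
        opNorm β (m + 2) l ^ 2) l := by
  have hn := opNorm_ne_zero hβ (m + 2) l
  refine ((hasDerivAt_zDeriv hβ m l).div ((hasDerivAt_opNorm hβ (m + 2) l).pow 2)
    (pow_ne_zero 2 hn)).congr_deriv ?_
  simp only [Pi.pow_apply]
  field_simp
  push_cast
  ring

end

/-! ### Hermite functions -/

lemma zero_re_abs_lt : |(0 : ℂ).re| < 1 / 2 := by norm_num

lemma jumpL_zero : jumpL 0 = 1 := by simp [jumpL]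

lemma jumpR_zero : jumpR 0 = 1 := by simp [jumpR]

lemma jumpGauss_zero (l : ℝ) : jumpGauss 0 l = 0 := by simp [jumpGauss, jumpL_zero, jumpR_zero]

lemma wInt_zero_eq (l : ℝ) (p : ℂ[X]) : wInt 0 l p = gaussInt p := by
  simp [wInt_eq, jumpL_zero, jumpR_zero]

lemma recX_zero (n : ℕ) (l : ℝ) : recX 0 n l = 0 := by simp [recX, jumpGauss_zero]

lemma recR_zero (m : ℕ) (l : ℝ) : recR 0 m l = (m + 1) / 2 := by
  have h := recR_eq zero_re_abs_lt m l
  rw [jumpGauss_zero, zero_mul, zero_mul, sub_zero] at h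
  have := mul_right_cancel₀ (opNorm_ne_zero zero_re_abs_lt m l) h
  linear_combination this / 2

/-- The monic Hermite polynomials for the weight `e^{-x²}`. -/
def he : ℕ → ℝ[X]
  | 0 => 1
  | 1 => X
  | n + 2 => X * he (n + 1) - C ((n + 1 : ℝ) / 2) * he n

lemma op_zero_zero (β : ℂ) (l : ℝ) : op β 0 l = 1 := by simp [op, opTail]

lemma gaussInt_X : gaussInt X = 0 := by
  have h := gaussInt_derivative_sub 1
  have h2 : (derivative (1 : ℂ[X]) - 2 * X * 1) = C (-2) * X := by
    rw [derivative_one, C_neg]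
    change _ = -(2 : ℂ[X]) * X
    ring
  rw [h2, ← wInt_zero_eq 0, wInt_C_mul, wInt_zero_eq] at h
  simpa using h

lemma op_zero_one (l : ℝ) : op 0 1 l = X := by
  have h : op 0 1 l - X = 0 := by
    refine eq_zero_of_wInt_mul_X_pow zero_re_abs_lt (l := l) (n := 1) ?_ fun k hk => ?_
    · have := degree_sub_op_lt (β := 0) (n := 1) monic_X natDegree_X l
      rwa [← neg_sub, degree_neg]
    · rw [sub_mul, wInt_sub, wInt_op_mul_X_pow zero_re_abs_lt hk, Nat.lt_one_iff.1 hk, pow_zero,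
        mul_one, wInt_zero_eq, gaussInt_X, sub_zero]
  exact sub_eq_zero.1 h

lemma map_he : ∀ (n : ℕ) (l : ℝ), (he n).map Complex.ofRealHom = op 0 n l
  | 0, l => by rw [he, op_zero_zero, Polynomial.map_one]
  | 1, l => by rw [he, op_zero_one, map_X]
  | n + 2, l => by
    have h := three_term zero_re_abs_lt n l
    rw [recX_zero, recR_zero, neg_zero, C_0, zero_mul, add_zero] at h
    rw [he, Polynomial.map_sub, Polynomial.map_mul, Polynomial.map_mul, map_he (n + 1) l,
      map_he n l, map_X, h, map_C]
    simp

lemma eval_op_zero (n : ℕ) (l x : ℝ) : (op 0 n l).eval (x : ℂ) = (((he n).eval x : ℝ) : ℂ) := by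
  rw [← map_he n l]
  exact Polynomial.eval_map_apply Complex.ofRealHom x

lemma derivative_he (n : ℕ) : derivative (he (n + 1)) = C (n + 1 : ℝ) * he n := by
  have h := opDot_add_derivative zero_re_abs_lt n 0
  have h0 : opDot 0 (n + 1) 0 = 0 := by
    have : ∀ (s : ℝ), opCoeff 0 (n + 1) s = opCoeff 0 (n + 1) 0 := fun s => by
      simp only [opCoeff, hankel, wInt_zero_eq]
    simp only [opDot, this]
    simp
  rw [h0, zero_add, ← map_he, ← map_he, derivative_map, recR_zero] at h
  refine Polynomial.map_injective _ Complex.ofRealHom.injective ?_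
  rw [h, Polynomial.map_mul, map_C]
  congr 2
  simp
  ring

/-- The squared norm of the Hermite polynomial. -/
def heNorm (n : ℕ) : ℝ := √Real.pi * n.factorial / 2 ^ n

lemma heNorm_pos (n : ℕ) : 0 < heNorm n := by
  have := n.factorial_pos
  have := Real.pi_pos
  rw [heNorm]; positivity

lemma heNorm_succ (n : ℕ) : heNorm (n + 1) = (n + 1) / 2 * heNorm n := by
  rw [heNorm, heNorm, Nat.factorial_succ, pow_succ]
  push_cast
  field_simp

lemma opNorm_zero (n : ℕ) (l : ℝ) : opNorm 0 n l = heNorm n := by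
  induction n with
  | zero =>
    rw [opNorm, op_zero_zero, wInt_zero_eq, gaussInt]
    have h := integral_gaussian 1
    simp only [mul_one, eval_one, one_mul, integral_complex_ofReal]
    simp at h
    simp [h, heNorm]
  | succ n ih =>
    have h : recR 0 n l * opNorm 0 n l = opNorm 0 (n + 1) l := by
      rw [recR, div_mul_cancel₀ _ (opNorm_ne_zero zero_re_abs_lt n l)]
    rw [← h, ih, recR_zero, heNorm_succ]
    push_cast
    rfl

/-- The orthonormal Hermite functions. -/
def hermFun (n : ℕ) (x : ℝ) : ℝ := (he n).eval x * Real.exp (-x ^ 2 / 2) / √(heNorm n)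

lemma exp_half_sq (x : ℝ) : Real.exp (-x ^ 2 / 2) * Real.exp (-x ^ 2 / 2) = Real.exp (-x ^ 2) := by
  rw [← Real.exp_add]; ring_nf

lemma hasDerivAt_exp_half_real (x : ℝ) :
    HasDerivAt (fun x : ℝ => Real.exp (-x ^ 2 / 2)) (-x * Real.exp (-x ^ 2 / 2)) x := by
  have h : HasDerivAt (fun x : ℝ => Real.exp (-x ^ 2 / 2)) (Real.exp (-x ^ 2 / 2) * (-(2 * x) / 2))
      x := by
    simpa using (((hasDerivAt_pow 2 x).neg).div_const 2).exp
  exact h.congr_deriv (by ring)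

lemma hasDerivAt_hermFun (k : ℕ) (x : ℝ) :
    HasDerivAt (hermFun k) (√((k : ℝ) / 2) * hermFun (k - 1) x -
      √(((k + 1 : ℕ) : ℝ) / 2) * hermFun (k + 1) x) x := by
  have h := ((((he k).hasDerivAt x).mul (hasDerivAt_exp_half_real x)).div_const √(heNorm k))
  refine h.congr_deriv ?_
  have hs : ∀ j : ℕ, √(((j + 1 : ℕ) : ℝ) / 2) * √(heNorm j) = √(heNorm (j + 1)) := fun j => by
    rw [heNorm_succ, Real.sqrt_mul (by positivity)]; push_cast; rfl
  have hp : ∀ j : ℕ, 0 < √(heNorm j) := fun j => Real.sqrt_pos.2 (heNorm_pos j)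
  have hq : ∀ j : ℕ, √(((j + 1 : ℕ) : ℝ) / 2) ^ 2 = ((j : ℝ) + 1) / 2 := fun j => by
    rw [Real.sq_sqrt (by positivity)]; push_cast; rfl
  rcases k with _ | j
  · have h0 := (hp 0).ne'
    have h1 : √(((0 + 1 : ℕ) : ℝ) / 2) ≠ 0 := by positivity
    simp only [hermFun, ← hs 0, he, CharP.cast_eq_zero, zero_div, Real.sqrt_zero, eval_one,
      derivative_one, eval_X, eval_zero]
    field_simp
    ring
  · have h0 := (hp j).ne'
    have h1 : √(((j + 1 : ℕ) : ℝ) / 2) ≠ 0 := by positivity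
    have h2 : √(((j + 1 + 1 : ℕ) : ℝ) / 2) ≠ 0 := by positivity
    have h3 := hq j
    simp only [hermFun, Nat.add_sub_cancel, derivative_he, eval_mul, eval_C,
      ← hs (j + 1), ← hs j, he, eval_sub, eval_X]
    generalize √(((j + 1 : ℕ) : ℝ) / 2) = a at *
    generalize √(((j + 1 + 1 : ℕ) : ℝ) / 2) = b at *
    generalize √(heNorm j) = c at *
    have h4 : (j : ℝ) = 2 * a ^ 2 - 1 := by linarith
    field_simp
    rw [h4]
    ring

/-- The Christoffel–Darboux kernel of the Hermite functions. -/
def hermKer (n : ℕ) (x y : ℝ) : ℝ := ∑ k ∈ Finset.range n, hermFun k x * hermFun k y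

lemma hasDerivAt_hermKer (n : ℕ) (x y z : ℝ) :
    HasDerivAt (fun z => hermKer n (x + z) (y + z))
      (-√((n : ℝ) / 2) * (hermFun n (x + z) * hermFun (n - 1) (y + z) +
        hermFun (n - 1) (x + z) * hermFun n (y + z))) z := by
  induction n with
  | zero => simpa [hermKer] using hasDerivAt_const z (0 : ℝ)
  | succ n ih =>
    have h1 := (hasDerivAt_hermFun n (x + z)).comp_const_add x z
    have h2 := (hasDerivAt_hermFun n (y + z)).comp_const_add y z
    have h := ih.add (h1.mul h2)
    simp only [hermKer, Finset.sum_range_succ] at h ⊢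
    refine h.congr_deriv ?_
    rw [Nat.add_sub_cancel]
    ring

lemma continuous_hermFun (n : ℕ) : Continuous (hermFun n) :=
  continuous_iff_continuousAt.2 fun x => (hasDerivAt_hermFun n x).continuousAt

lemma ofReal_hermFun_mul (j k : ℕ) (x : ℝ) : ((hermFun j x * hermFun k x : ℝ) : ℂ) =
    ((√(heNorm j) : ℂ))⁻¹ * ((√(heNorm k) : ℂ))⁻¹ *
      ((op 0 j 0 * op 0 k 0).eval (x : ℂ) * (Real.exp (-x ^ 2) : ℂ)) := by
  rw [eval_mul, eval_op_zero, eval_op_zero, hermFun, hermFun, ← exp_half_sq]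
  push_cast
  ring

lemma integrable_hermFun_mul (j k : ℕ) : Integrable (fun x => hermFun j x * hermFun k x) := by
  have h := ((integrable_eval_mul_gauss (op 0 j 0 * op 0 k 0)).const_mul
    (((√(heNorm j) : ℂ))⁻¹ * ((√(heNorm k) : ℂ))⁻¹)).re
  refine h.congr (Eventually.of_forall fun x => ?_)
  simp only [← ofReal_hermFun_mul]
  exact Complex.ofReal_re _

lemma integral_hermFun_mul (j k : ℕ) :
    ∫ x, hermFun j x * hermFun k x = if j = k then 1 else 0 := by
  have h : ((∫ x, hermFun j x * hermFun k x : ℝ) : ℂ) =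
      ((√(heNorm j) : ℂ))⁻¹ * ((√(heNorm k) : ℂ))⁻¹ * wInt 0 0 (op 0 j 0 * op 0 k 0) := by
    rw [← integral_complex_ofReal, wInt_zero_eq, gaussInt, ← integral_const_mul]
    simp only [← ofReal_hermFun_mul]
  rcases lt_trichotomy j k with hjk | rfl | hjk
  · rw [mul_comm (op 0 j 0), wInt_op_mul zero_re_abs_lt 0
      (by rw [degree_op]; exact_mod_cast hjk), mul_zero] at h
    rw [if_neg hjk.ne]; exact_mod_cast h
  · have h2 : wInt 0 0 (op 0 j 0 * op 0 j 0) = heNorm j := opNorm_zero j 0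
    have h3 : ((√(heNorm j) : ℂ)) * (√(heNorm j) : ℂ) = heNorm j := by
      exact_mod_cast Real.mul_self_sqrt (heNorm_pos j).le
    have h4 : ((√(heNorm j) : ℂ)) ≠ 0 := by
      exact_mod_cast (Real.sqrt_pos.2 (heNorm_pos j)).ne'
    rw [h2, ← h3] at h
    rw [if_pos rfl]
    have h5 : ((∫ x, hermFun j x * hermFun j x : ℝ) : ℂ) = 1 := by rw [h]; field_simp
    exact_mod_cast h5
  · rw [wInt_op_mul zero_re_abs_lt 0
      (by rw [degree_op]; exact_mod_cast hjk), mul_zero] at h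
    rw [if_neg hjk.ne']; exact_mod_cast h

/-! ### A contour integral for the Hermite polynomials -/

/-- The integral of a polynomial against `e^{(z-x)²}` along a vertical line. -/
def lineInt (c x : ℝ) (p : ℂ[X]) : ℂ :=
  ∫ τ : ℝ, p.eval ((c : ℂ) + τ * Complex.I) * Complex.exp (((c : ℂ) + τ * Complex.I - x) ^ 2)

lemma integrable_line (c x : ℝ) (p : ℂ[X]) : Integrable (fun τ : ℝ =>
    p.eval ((c : ℂ) + τ * Complex.I) * Complex.exp (((c : ℂ) + τ * Complex.I - x) ^ 2)) := by
  have h := (integrable_eval_mul_gauss (p.comp (C (c : ℂ) + X * C Complex.I))).const_mul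
    (Real.exp ((c - x) ^ 2) : ℂ)
  refine h.mono (Continuous.aestronglyMeasurable (by fun_prop)) (Eventually.of_forall fun τ => ?_)
  refine le_of_eq ?_
  simp only [norm_mul, eval_comp, eval_add, eval_C, eval_mul, eval_X, Complex.norm_real,
    Complex.norm_exp, Real.norm_eq_abs, Real.abs_exp]
  rw [mul_left_comm, ← Real.exp_add]
  congr 2
  simp [pow_two]
  ring

lemma lineInt_add (c x : ℝ) (p q : ℂ[X]) :
    lineInt c x (p + q) = lineInt c x p + lineInt c x q := by
  rw [lineInt, lineInt, lineInt, ← integral_add (integrable_line c x p) (integrable_line c x q)]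
  simp [add_mul]

lemma lineInt_C_mul (c x : ℝ) (a : ℂ) (p : ℂ[X]) :
    lineInt c x (C a * p) = a * lineInt c x p := by
  rw [lineInt, lineInt, ← integral_const_mul]
  simp [mul_assoc]

lemma lineInt_derivative (c x : ℝ) (p : ℂ[X]) :
    lineInt c x (derivative p) + 2 * lineInt c x (X * p) + (-2 * x) * lineInt c x p = 0 := by
  rw [← lineInt_C_mul, ← lineInt_C_mul, ← lineInt_add, ← lineInt_add]
  set q := derivative p + C 2 * (X * p) + C (-2 * (x : ℂ)) * p with hq
  have hz : ∀ τ : ℝ, HasDerivAt (fun τ : ℝ => (c : ℂ) + τ * Complex.I) Complex.I τ := fun τ => by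
    simpa using ((hasDerivAt_id (τ : ℂ)).comp_ofReal.mul_const Complex.I).const_add (c : ℂ)
  have hd : ∀ τ : ℝ, HasDerivAt (fun τ : ℝ => p.eval ((c : ℂ) + τ * Complex.I) *
      Complex.exp (((c : ℂ) + τ * Complex.I - x) ^ 2)) (Complex.I * (q.eval ((c : ℂ) +
      τ * Complex.I) * Complex.exp (((c : ℂ) + τ * Complex.I - x) ^ 2))) τ := fun τ => by
    have h1 := (p.hasDerivAt ((c : ℂ) + τ * Complex.I)).comp τ (hz τ)
    have h2 := (((hz τ).sub_const (x : ℂ)).pow 2).cexp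
    refine (h1.mul h2).congr_deriv ?_
    simp [hq]
    ring
  have := integral_eq_zero_of_hasDerivAt_of_integrable hd ((integrable_line c x q).const_mul _)
    (integrable_line c x p)
  rw [integral_const_mul] at this
  exact (mul_eq_zero.1 this).resolve_left Complex.I_ne_zero

lemma lineInt_one (c x : ℝ) : lineInt c x 1 = (√Real.pi : ℂ) := by
  have h := GaussianFourier.integral_cexp_neg_mul_sq_add_real_mul_I (b := 1) (by simp) (x - c)
  have h2 : ((Real.pi : ℂ) / 1) ^ (1 / 2 : ℂ) = (√Real.pi : ℂ) := by
    rw [div_one, Real.sqrt_eq_rpow, Complex.ofReal_cpow Real.pi_pos.le]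
    norm_num
  rw [← h2, ← h, lineInt]
  congr 1
  ext τ
  rw [eval_one, one_mul]
  congr 1
  push_cast
  ring_nf
  simp
  ring

lemma lineInt_X_pow (c x : ℝ) : ∀ n : ℕ,
    lineInt c x (X ^ n) = (√Real.pi : ℂ) * (((he n).eval x : ℝ) : ℂ)
  | 0 => by rw [pow_zero, lineInt_one, he]; simp
  | 1 => by
    have h := lineInt_derivative c x 1
    rw [derivative_one, lineInt_one, mul_one] at h
    have h0 : lineInt c x 0 = 0 := by simp [lineInt]
    rw [pow_one, he, eval_X]
    rw [h0] at h
    linear_combination h / 2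
  | n + 2 => by
    have h := lineInt_derivative c x (X ^ (n + 1))
    rw [derivative_X_pow, Nat.add_sub_cancel, ← pow_succ', lineInt_X_pow c x (n + 1)] at h
    rw [map_natCast, ← C_eq_natCast, lineInt_C_mul, lineInt_X_pow c x n] at h
    rw [he]
    simp only [eval_sub, eval_mul, eval_X, eval_C]
    push_cast at h ⊢
    linear_combination h / 2

lemma lineInt_eq (c x : ℝ) (n : ℕ) : (∫ τ : ℝ, ((c : ℂ) + τ * Complex.I) ^ n *
    Complex.exp (((c : ℂ) + τ * Complex.I - x) ^ 2)) =
      (√Real.pi : ℂ) * (((he n).eval x : ℝ) : ℂ) := by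
  rw [← lineInt_X_pow c x n, lineInt]
  simp

/-! ### Scaling at the edge -/

/-- The scale of the edge variable. -/
def edgeMu (n : ℕ) : ℝ := (n : ℝ) ^ (-(1 : ℝ) / 6) / √2

/-- The large parameter `n^{1/3}`. -/
def edgeNu (n : ℕ) : ℝ := (n : ℝ) ^ ((1 : ℝ) / 3)

/-- The edge variable. -/
def edgePt (n : ℕ) (s : ℝ) : ℝ := √(2 * n) + edgeMu n * s

lemma edgeMu_pos {n : ℕ} (hn : 1 ≤ n) : 0 < edgeMu n := by
  have : (0 : ℝ) < n := by exact_mod_cast hn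
  rw [edgeMu]; positivity

lemma one_le_edgeNu {n : ℕ} (hn : 1 ≤ n) : 1 ≤ edgeNu n :=
  Real.one_le_rpow (by exact_mod_cast hn) (by norm_num)

lemma edgeNu_cube (n : ℕ) : edgeNu n ^ 3 = n := by
  rw [edgeNu, ← Real.rpow_natCast, ← Real.rpow_mul n.cast_nonneg]
  norm_num

lemma edgeMu_sq {n : ℕ} (hn : 1 ≤ n) : 2 * edgeMu n ^ 2 * edgeNu n = 1 := by
  have h : (0 : ℝ) < n := by exact_mod_cast hn
  rw [edgeMu, edgeNu, div_pow, ← Real.rpow_natCast, ← Real.rpow_mul h.le,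
    Real.sq_sqrt (by norm_num), mul_div_cancel₀ _ (by norm_num), ← Real.rpow_add h]
  norm_num

lemma sqrt_two_mul_eq {n : ℕ} (hn : 1 ≤ n) : √(2 * n) = 2 * edgeMu n * edgeNu n ^ 2 := by
  have hm := edgeMu_pos hn
  have hv := one_le_edgeNu hn
  have h2 := edgeMu_sq hn
  rw [Real.sqrt_eq_iff_mul_self_eq (by positivity) (by positivity), ← edgeNu_cube n]
  linear_combination (-2) * edgeNu n ^ 3 * h2

lemma lam0_eq {n : ℕ} (hn : 1 ≤ n) (t : ℝ) : lam0 t n = edgePt n t := by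
  have h : (0 : ℝ) < n := by exact_mod_cast hn
  have hv := one_le_edgeNu hn
  have h2 := edgeMu_sq hn
  have h3 : (n : ℝ) ^ (-(2 : ℝ) / 3) = (edgeNu n ^ 2)⁻¹ := by
    rw [edgeNu, ← Real.rpow_natCast, ← Real.rpow_mul h.le, ← Real.rpow_neg h.le]
    norm_num
  rw [lam0, edgePt, sqrt_two_mul_eq hn, h3]
  have : edgeNu n ≠ 0 := by positivity
  field_simp

/-- The integrand of the scaled contour integral. -/
def edgeExp (ν : ℝ) (m : ℕ) (ζ : ℂ) : ℂ :=
  (1 + ζ / ν) ^ m * Complex.exp (ν * ζ ^ 2 / 2 - ν ^ 2 * ζ)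

/-- The scaled contour integral. -/
def edgeInt (ν : ℝ) (m : ℕ) (σ s : ℝ) : ℂ :=
  ∫ τ : ℝ, edgeExp ν m (σ + τ * Complex.I) * Complex.exp (-((σ + τ * Complex.I) * s))

/-- The prefactor of the scaled contour integral. -/
def edgePre (n : ℕ) : ℝ :=
  (edgeMu n * edgeNu n ^ 2) ^ n * Real.exp (-n / 2) /
    (√Real.pi * √(heNorm n) * (2 * edgeMu n) * √(2 * edgeMu n))

/-- The scaled Hermite functions. -/
def edgeFun (j n : ℕ) (s : ℝ) : ℝ := hermFun (n - j) (edgePt n s) / √(2 * edgeMu n)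

lemma he_edgePt {n : ℕ} (hn : 1 ≤ n) (m : ℕ) (σ s : ℝ) :
    (√Real.pi : ℂ) * (((he m).eval (edgePt n s) * Real.exp (-(edgePt n s) ^ 2 / 2) : ℝ) : ℂ) =
      ((edgeMu n * edgeNu n ^ 2) ^ m / (2 * edgeMu n) * Real.exp (-n / 2) *
        Real.exp (s ^ 2 / (4 * edgeNu n)) : ℝ) * edgeInt (edgeNu n) m σ s := by
  have hm := edgeMu_pos hn
  have hv := one_le_edgeNu hn
  have h2 := edgeMu_sq hn
  have h3 := edgeNu_cube n
  have h4 := sqrt_two_mul_eq hn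
  set μ := edgeMu n
  set ν := edgeNu n
  have hv0 : ν ≠ 0 := by positivity
  have hμc : (μ : ℂ) ≠ 0 := by exact_mod_cast hm.ne'
  have hνc : (ν : ℂ) ≠ 0 := by exact_mod_cast hv0
  have h2c : 2 * (μ : ℂ) ^ 2 * ν = 1 := by exact_mod_cast h2
  have h3c : (ν : ℂ) ^ 3 = n := by exact_mod_cast h3
  have h5 := Measure.integral_comp_mul_left (fun τ : ℝ =>
    ((μ * ν ^ 2 * (1 + σ / ν) : ℝ) + τ * Complex.I : ℂ) ^ m *
    Complex.exp (((μ * ν ^ 2 * (1 + σ / ν) : ℝ) + τ * Complex.I - edgePt n s : ℂ) ^ 2)) (μ * ν)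
  have h6 : |(μ * ν)⁻¹| = (μ * ν)⁻¹ := abs_of_pos (by positivity)
  rw [h6, lineInt_eq, Complex.real_smul] at h5
  have h7 : (√Real.pi : ℂ) * (((he m).eval (edgePt n s) : ℝ) : ℂ) = (μ * ν : ℝ) * ∫ τ : ℝ,
      ((μ * ν ^ 2 * (1 + σ / ν) : ℝ) + (μ * ν * τ : ℝ) * Complex.I : ℂ) ^ m * Complex.exp
        (((μ * ν ^ 2 * (1 + σ / ν) : ℝ) + (μ * ν * τ : ℝ) * Complex.I - edgePt n s : ℂ) ^ 2) := by
    have h : (((μ * ν : ℝ) : ℂ)) * (((μ * ν)⁻¹ : ℝ) : ℂ) = 1 := by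
      rw [← Complex.ofReal_mul, mul_inv_cancel₀ (by positivity), Complex.ofReal_one]
    rw [h5, ← mul_assoc, h, one_mul]
  have h8 : 1 / (2 * μ) = μ * ν := by
    field_simp
    linear_combination -h2
  rw [Complex.ofReal_mul, ← mul_assoc, h7, div_eq_mul_one_div ((μ * ν ^ 2) ^ m), h8, edgeInt, mul_assoc,
    ← integral_mul_const, ← integral_const_mul, ← integral_const_mul]
  congr 1
  ext τ
  have h9 : ∀ ζ : ℂ, Complex.exp ((μ * ν ^ 2 + μ * ν * ζ - (2 * μ * ν ^ 2 + μ * s)) ^ 2) *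
      Complex.exp (-(2 * μ * ν ^ 2 + μ * s) ^ 2 / 2) = Complex.exp (-n / 2) *
      Complex.exp (s ^ 2 / (4 * ν)) * (Complex.exp (ν * ζ ^ 2 / 2 - ν ^ 2 * ζ) *
        Complex.exp (-(ζ * s))) := fun ζ => by
    rw [← Complex.exp_add, ← Complex.exp_add, ← Complex.exp_add, ← Complex.exp_add]
    congr 1
    rw [← h3c]
    have h10 : (μ : ℂ) ^ 2 = 1 / (2 * ν) := by
      field_simp
      linear_combination h2c
    have h11 : (s : ℂ) ^ 2 / (4 * ν) = s ^ 2 / 2 * (μ : ℂ) ^ 2 := by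
      rw [h10]
      field_simp
      norm_num
    rw [h11]
    linear_combination ((-ν ^ 3 + ν * ζ ^ 2 - 2 * ν ^ 2 * ζ - 2 * ζ * s) / 2) * h2c
  have h12 := h9 (σ + τ * Complex.I)
  have h13 : ((μ * ν ^ 2 * (1 + σ / ν) : ℝ) : ℂ) + ((μ * ν * τ : ℝ) : ℂ) * Complex.I =
      μ * ν ^ 2 + μ * ν * (σ + τ * Complex.I) := by
    push_cast
    field_simp
    ring
  have h14 : ((μ : ℂ) * ν ^ 2 + μ * ν * (σ + τ * Complex.I)) ^ m = (μ * ν ^ 2) ^ m *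
      (1 + (σ + τ * Complex.I) / ν) ^ m := by
    rw [← mul_pow]
    congr 1
    field_simp
  rw [h13, edgePt, h4, edgeExp, h14]
  push_cast
  linear_combination ((μ : ℂ) * ν * (μ * ν ^ 2) ^ m * (1 + (σ + τ * Complex.I) / ν) ^ m) * h12

lemma edgeFun_eq {n j : ℕ} (hn : 1 ≤ n) (hj : j ≤ 1) (σ s : ℝ) :
    (edgeFun j n s : ℂ) = (edgePre n * Real.exp (s ^ 2 / (4 * edgeNu n)) : ℝ) *
      edgeInt (edgeNu n) (n - j) σ s := by
  have h := he_edgePt hn (n - j) σ s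
  have hm := edgeMu_pos hn
  have hv := one_le_edgeNu hn
  have h2 := edgeMu_sq hn
  have h3 := edgeNu_cube n
  have hpi : 0 < √Real.pi := Real.sqrt_pos.2 Real.pi_pos
  have hnorm : ∀ k, 0 < √(heNorm k) := fun k => Real.sqrt_pos.2 (heNorm_pos k)
  have hsq : 0 < √(2 * edgeMu n) := by positivity
  have hpre : edgePre n = (edgeMu n * edgeNu n ^ 2) ^ (n - j) * Real.exp (-n / 2) /
      (√Real.pi * √(heNorm (n - j)) * (2 * edgeMu n) * √(2 * edgeMu n)) := by
    rw [edgePre]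
    interval_cases j
    · rfl
    · obtain ⟨k, rfl⟩ : ∃ k, n = k + 1 := ⟨n - 1, by omega⟩
      have hz : √(heNorm (k + 1)) = edgeMu (k + 1) * edgeNu (k + 1) ^ 2 * √(heNorm k) := by
        rw [heNorm_succ, Real.sqrt_mul (by positivity)]
        congr 1
        rw [Real.sqrt_eq_iff_mul_self_eq (by positivity) (by positivity)]
        push_cast at h3
        rw [← h3]
        linear_combination (-1 / 2) * edgeNu (k + 1) ^ 3 * h2
      rw [Nat.add_sub_cancel, hz, pow_succ]
      have := hnorm k
      have h5 : edgeMu (k + 1) * edgeNu (k + 1) ^ 2 ≠ 0 := by positivity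
      field_simp
  rw [edgeFun, hermFun, hpre]
  have hpic : (√Real.pi : ℂ) ≠ 0 := by exact_mod_cast hpi.ne'
  have hnc : (√(heNorm (n - j)) : ℂ) ≠ 0 := by exact_mod_cast (hnorm (n - j)).ne'
  have hsc : (√(2 * edgeMu n) : ℂ) ≠ 0 := by exact_mod_cast hsq.ne'
  have hmc : (edgeMu n : ℂ) ≠ 0 := by exact_mod_cast hm.ne'
  push_cast at h ⊢
  field_simp at h ⊢
  linear_combination h

/-! ### Estimates for the scaled contour integral -/

lemma norm_exp_sub_exp_le {a b : ℂ} {c : ℝ} (ha : a.re ≤ c) (hb : b.re ≤ c) :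
    ‖Complex.exp a - Complex.exp b‖ ≤ Real.exp c * ‖a - b‖ := by
  refine (convex_halfSpace_re_le c).norm_image_sub_le_of_norm_hasDerivWithin_le
    (f := Complex.exp) (f' := Complex.exp) (fun x _ => (Complex.hasDerivAt_exp x).hasDerivWithinAt)
    (fun x hx => ?_) hb ha
  rw [Complex.norm_exp]
  exact Real.exp_le_exp.2 hx

lemma one_add_le_exp_cubic {u : ℝ} (hu : 0 ≤ u) : 1 + u ≤ Real.exp (u - u ^ 2 / 2 + u ^ 3 / 3) := by
  have hmono : MonotoneOn (fun u : ℝ => u - u ^ 2 / 2 + u ^ 3 / 3 - Real.log (1 + u)) (Ici 0) := by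
    have hd : ∀ x : ℝ, 0 ≤ x → HasDerivAt (fun u : ℝ => u - u ^ 2 / 2 + u ^ 3 / 3 -
        Real.log (1 + u)) (x ^ 3 / (1 + x)) x := fun x hx => by
      have h1 : (1 + x) ≠ 0 := by positivity
      have h := (((hasDerivAt_id x).sub ((hasDerivAt_pow 2 x).div_const 2)).add
        ((hasDerivAt_pow 3 x).div_const 3)).sub (((hasDerivAt_id x).const_add 1).log h1)
      refine h.congr_deriv ?_
      simp
      field_simp
      ring
    refine monotoneOn_of_deriv_nonneg (convex_Ici 0) (fun x hx =>
      (hd x hx).continuousAt.continuousWithinAt) (fun x hx => ?_) (fun x hx => ?_)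
    · rw [interior_Ici] at hx
      exact (hd x (le_of_lt hx)).differentiableAt.differentiableWithinAt
    · rw [interior_Ici] at hx
      have hx' : 0 < x := hx
      rw [(hd x hx'.le).deriv]
      positivity
  have h := hmono (mem_Ici.2 le_rfl) (mem_Ici.2 hu) hu
  simp at h
  rw [← Real.log_le_iff_le_exp (by positivity)]
  linarith

lemma norm_one_add_div_le {ν σ : ℝ} (hν : 1 ≤ ν) (hσ : 0 < σ) (τ : ℝ) :
    ‖1 + ((σ : ℂ) + τ * Complex.I) / ν‖ ≤ (1 + σ / ν) * Real.exp (τ ^ 2 / (2 * (ν + σ) ^ 2)) := by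
  have hν0 : 0 < ν := by linarith
  refine abs_le_of_sq_le_sq' ?_ (by positivity) |>.2
  have h1 : (1 : ℂ) + ((σ : ℂ) + τ * Complex.I) / ν = ((1 + σ / ν : ℝ) : ℂ) +
      ((τ / ν : ℝ) : ℂ) * Complex.I := by push_cast; ring
  rw [h1, Complex.sq_norm, Complex.normSq_add_mul_I, mul_pow, ← Real.exp_nat_mul]
  have h2 := Real.add_one_le_exp (((2 : ℕ) : ℝ) * (τ ^ 2 / (2 * (ν + σ) ^ 2)))
  have h3 : (1 + σ / ν) ^ 2 + (τ / ν) ^ 2 =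
      (1 + σ / ν) ^ 2 * (((2 : ℕ) : ℝ) * (τ ^ 2 / (2 * (ν + σ) ^ 2)) + 1) := by
    push_cast
    field_simp
    ring
  rw [h3]
  exact mul_le_mul_of_nonneg_left h2 (by positivity)

lemma one_le_norm_one_add_div {ν σ : ℝ} (hν : 1 ≤ ν) (hσ : 0 < σ) (τ : ℝ) :
    1 ≤ ‖1 + ((σ : ℂ) + τ * Complex.I) / ν‖ := by
  have hν0 : 0 < ν := by linarith
  refine le_trans ?_ (Complex.re_le_norm _)
  have h1 : (1 : ℂ) + ((σ : ℂ) + τ * Complex.I) / ν = ((1 + σ / ν : ℝ) : ℂ) +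
      ((τ / ν : ℝ) : ℂ) * Complex.I := by push_cast; ring
  rw [h1]
  simp
  positivity

lemma norm_edgeExp_le {ν σ : ℝ} {n m : ℕ} (hν : 1 ≤ ν) (hn : ν ^ 3 = n) (hm : m ≤ n) (hσ : 3 ≤ σ)
    (τ : ℝ) : ‖edgeExp ν m (σ + τ * Complex.I)‖ ≤
      (1 + σ / ν) ^ n * Real.exp (ν * σ ^ 2 / 2 - ν ^ 2 * σ) * Real.exp (-(3 / 8) * τ ^ 2) := by
  have hν0 : 0 < ν := by linarith
  have hσ0 : 0 < σ := by linarith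
  have h1 := norm_one_add_div_le hν hσ0 τ
  have h2 := one_le_norm_one_add_div hν hσ0 τ
  have hre : ((ν : ℂ) * (σ + τ * Complex.I) ^ 2 / 2 - ν ^ 2 * (σ + τ * Complex.I)).re =
      ν * σ ^ 2 / 2 - ν ^ 2 * σ - ν * τ ^ 2 / 2 := by
    have : ((ν : ℂ) * (σ + τ * Complex.I) ^ 2 / 2 - ν ^ 2 * (σ + τ * Complex.I)) =
      ((ν * σ ^ 2 / 2 - ν ^ 2 * σ - ν * τ ^ 2 / 2 : ℝ) : ℂ) +
        ((ν * σ * τ - ν ^ 2 * τ : ℝ) : ℂ) * Complex.I := by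
      push_cast
      linear_combination ((ν : ℂ) * τ ^ 2 / 2) * Complex.I_sq
    rw [this, Complex.add_re, Complex.ofReal_re, Complex.re_ofReal_mul, Complex.I_re, mul_zero,
      add_zero]
  rw [edgeExp, norm_mul, norm_pow, Complex.norm_exp, hre]
  have h3 : ‖1 + ((σ : ℂ) + τ * Complex.I) / ν‖ ^ m ≤
      (1 + σ / ν) ^ n * Real.exp (n * (τ ^ 2 / (2 * (ν + σ) ^ 2))) := by
    rw [Real.exp_nat_mul, ← mul_pow]
    exact (pow_le_pow_right₀ h2 hm).trans (pow_le_pow_left₀ (by positivity) h1 n)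
  refine (mul_le_mul_of_nonneg_right h3 (Real.exp_pos _).le).trans ?_
  rw [mul_assoc, mul_assoc, ← Real.exp_add, ← Real.exp_add]
  refine mul_le_mul_of_nonneg_left (Real.exp_le_exp.2 ?_) (by positivity)
  have h4 : (3 / 4 : ℝ) ≤ ν - ν ^ 3 / (ν + σ) ^ 2 := by
    rw [le_sub_iff_add_le, ← le_sub_iff_add_le', div_le_iff₀ (by positivity)]
    nlinarith [mul_nonneg (sub_nonneg.2 hν) (sub_nonneg.2 hσ), sq_nonneg σ, sq_nonneg ν,
      mul_pos hν0 hσ0, mul_pos (mul_pos hν0 hσ0) hσ0, mul_nonneg (mul_pos hν0 hν0).le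
      (sub_nonneg.2 hσ), mul_nonneg hν0.le (sub_nonneg.2 hν), mul_nonneg (mul_pos hσ0 hσ0).le
      (sub_nonneg.2 hν), mul_nonneg (mul_pos hν0 hσ0).le (sub_nonneg.2 hν)]
  have h5 := mul_nonneg (sub_nonneg.2 h4) (sq_nonneg τ)
  have h6 : (n : ℝ) * (τ ^ 2 / (2 * (ν + σ) ^ 2)) = ν ^ 3 / (ν + σ) ^ 2 * τ ^ 2 / 2 := by
    rw [← hn]; field_simp
  rw [h6]
  linarith

lemma norm_edgeExp_three_le {ν : ℝ} {n m : ℕ} (hν : 1 ≤ ν) (hn : ν ^ 3 = n) (hm : m ≤ n) (τ : ℝ) :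
    ‖edgeExp ν m ((3 : ℝ) + τ * Complex.I)‖ ≤ Real.exp (9 - (3 / 8) * τ ^ 2) := by
  have hν0 : 0 < ν := by linarith
  refine (norm_edgeExp_le hν hn hm le_rfl τ).trans ?_
  have h1 := pow_le_pow_left₀ (by positivity) (one_add_le_exp_cubic (u := 3 / ν) (by positivity)) n
  rw [← Real.exp_nat_mul, ← hn] at h1
  refine (mul_le_mul_of_nonneg_right (mul_le_mul_of_nonneg_right h1 (Real.exp_pos _).le)
    (Real.exp_pos _).le).trans ?_
  rw [← Real.exp_add, ← Real.exp_add]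
  refine Real.exp_le_exp.2 (le_of_eq ?_)
  field_simp
  ring

lemma re_cube_three (τ : ℝ) : (((3 : ℝ) + τ * Complex.I : ℂ) ^ 3 / 3).re = 9 - 3 * τ ^ 2 := by
  have : (((3 : ℝ) + τ * Complex.I : ℂ) ^ 3 / 3) = ((9 - 3 * τ ^ 2 : ℝ) : ℂ) +
      ((9 * τ - τ ^ 3 / 3 : ℝ) : ℂ) * Complex.I := by
    push_cast
    linear_combination (3 * (τ : ℂ) ^ 2 + τ ^ 3 * Complex.I / 3) * Complex.I_sq
  rw [this, Complex.add_re, Complex.ofReal_re, Complex.re_ofReal_mul, Complex.I_re, mul_zero,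
    add_zero]

lemma sq_norm_three (τ : ℝ) : ‖((3 : ℝ) + τ * Complex.I : ℂ)‖ ^ 2 = 9 + τ ^ 2 := by
  rw [Complex.sq_norm, Complex.normSq_add_mul_I]; norm_num

lemma norm_edgeExp_sub_le {ν : ℝ} {n : ℕ} (hν : 1 ≤ ν) (hn : ν ^ 3 = n) (τ : ℝ) :
    ‖edgeExp ν n ((3 : ℝ) + τ * Complex.I) - Complex.exp (((3 : ℝ) + τ * Complex.I : ℂ) ^ 3 / 3)‖ ≤
      ν⁻¹ * (9 + τ ^ 2) ^ 2 * Real.exp (9 - (3 / 8) * τ ^ 2) := by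
  have hν0 : 0 < ν := by linarith
  have hE := norm_edgeExp_three_le hν hn le_rfl τ
  have hA : (((3 : ℝ) + τ * Complex.I : ℂ) ^ 3 / 3).re ≤ 9 - (3 / 8) * τ ^ 2 := by
    rw [re_cube_three]; nlinarith [sq_nonneg τ]
  have h1w := one_le_norm_one_add_div hν (σ := 3) (by norm_num) τ
  have hsq := sq_norm_three τ
  set ζ : ℂ := (3 : ℝ) + τ * Complex.I with hζ
  have hnn := norm_nonneg ζ
  have hνc : (ν : ℂ) ≠ 0 := by exact_mod_cast hν0.ne'
  have hw : ‖ζ / ν‖ = ‖ζ‖ / ν := by rw [norm_div, Complex.norm_real, Real.norm_of_nonneg hν0.le]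
  by_cases hc : ‖ζ‖ / ν ≤ 1 / 2
  · have h0 : (1 + ζ / ν) ≠ 0 := by
      intro h; rw [h, norm_zero] at h1w; linarith
    have hlog : edgeExp ν n ζ = Complex.exp (n * Complex.log (1 + ζ / ν) +
        (ν * ζ ^ 2 / 2 - ν ^ 2 * ζ)) := by
      rw [Complex.exp_add, Complex.exp_nat_mul, Complex.exp_log h0, edgeExp]
    have hre : (n * Complex.log (1 + ζ / ν) + (ν * ζ ^ 2 / 2 - ν ^ 2 * ζ)).re ≤
        9 - (3 / 8) * τ ^ 2 := by
      rwa [hlog, Complex.norm_exp, Real.exp_le_exp] at hE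
    rw [hlog]
    refine (norm_exp_sub_exp_le hre hA).trans ?_
    rw [mul_comm]
    refine mul_le_mul_of_nonneg_right ?_ (Real.exp_pos _).le
    have ht := Complex.norm_log_sub_logTaylor_le 3 (z := ζ / ν) (by rw [hw]; linarith)
    have hnc : (n : ℂ) = ν ^ 3 := by exact_mod_cast hn.symm
    have he : (n * Complex.log (1 + ζ / ν) + (ν * ζ ^ 2 / 2 - ν ^ 2 * ζ)) - ζ ^ 3 / 3 =
        n * (Complex.log (1 + ζ / ν) - Complex.logTaylor (3 + 1) (ζ / ν)) := by
      have : Complex.logTaylor (3 + 1) (ζ / ν) = ζ / ν - (ζ / ν) ^ 2 / 2 + (ζ / ν) ^ 3 / 3 := by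
        simp [Complex.logTaylor_succ, Complex.logTaylor_zero]
        ring
      rw [this, hnc]
      field_simp
      ring
    rw [he, norm_mul, hw] at *
    have hinv : (1 - ‖ζ‖ / ν)⁻¹ ≤ 2 := by
      rw [inv_le_comm₀ (by linarith) (by norm_num)]; linarith
    have h4 : (‖ζ‖ / ν) ^ (3 + 1) * (1 - ‖ζ‖ / ν)⁻¹ / ((3 : ℕ) + 1) ≤ (‖ζ‖ / ν) ^ 4 := by
      have := mul_le_mul_of_nonneg_left hinv (show 0 ≤ (‖ζ‖ / ν) ^ 4 by positivity)
      have h5 : 0 ≤ (‖ζ‖ / ν) ^ 4 := by positivity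
      push_cast
      linarith
    have hnn' : ‖(n : ℂ)‖ = ν ^ 3 := by rw [Complex.norm_natCast, hn]
    rw [hnn']
    refine (mul_le_mul_of_nonneg_left (ht.trans h4) (by positivity)).trans (le_of_eq ?_)
    rw [← hsq]
    field_simp
  · push Not at hc
    refine (norm_sub_le _ _).trans ?_
    have hA' : ‖Complex.exp (ζ ^ 3 / 3)‖ ≤ Real.exp (9 - (3 / 8) * τ ^ 2) := by
      rw [Complex.norm_exp]; exact Real.exp_le_exp.2 hA
    refine (add_le_add hE hA').trans ?_
    rw [← two_mul]
    refine mul_le_mul_of_nonneg_right ?_ (Real.exp_pos _).le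
    rw [← hsq]
    have h3 : 9 ≤ ‖ζ‖ ^ 2 := by rw [hsq]; nlinarith [sq_nonneg τ]
    have h3' : 3 ≤ ‖ζ‖ := by nlinarith
    have h6 : ν ≤ 2 * ‖ζ‖ := by
      rw [lt_div_iff₀ hν0] at hc; linarith
    rw [inv_mul_eq_div, le_div_iff₀ hν0]
    nlinarith

lemma edgeExp_succ_mul (ν : ℝ) (m : ℕ) (ζ : ℂ) :
    edgeExp ν (m + 1) ζ = (1 + ζ / ν) * edgeExp ν m ζ := by
  rw [edgeExp, edgeExp, pow_succ]; ring

lemma norm_edgeExp_sub_le' {ν : ℝ} {n j : ℕ} (hν : 1 ≤ ν) (hn : ν ^ 3 = n) (hj : j ≤ 1) (τ : ℝ) :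
    ‖edgeExp ν (n - j) ((3 : ℝ) + τ * Complex.I) -
      Complex.exp (((3 : ℝ) + τ * Complex.I : ℂ) ^ 3 / 3)‖ ≤
      ν⁻¹ * (2 * (9 + τ ^ 2) ^ 2 * Real.exp (9 - (3 / 8) * τ ^ 2)) := by
  have hν0 : 0 < ν := by linarith
  have h := norm_edgeExp_sub_le hν hn τ
  have hp : 0 ≤ ν⁻¹ * (9 + τ ^ 2) ^ 2 * Real.exp (9 - (3 / 8) * τ ^ 2) := by positivity
  interval_cases j
  · rw [Nat.sub_zero]; linarith
  · obtain ⟨k, rfl⟩ : ∃ k, n = k + 1 := ⟨n - 1, by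
      rcases n with _ | k
      · simp at hn; linarith
      · rfl⟩
    rw [Nat.add_sub_cancel]
    have hE := norm_edgeExp_three_le hν hn (Nat.le_succ k) τ
    have hsq := sq_norm_three τ
    have hs := edgeExp_succ_mul ν k ((3 : ℝ) + τ * Complex.I)
    set ζ : ℂ := (3 : ℝ) + τ * Complex.I
    have h2 : ‖edgeExp ν k ζ - edgeExp ν (k + 1) ζ‖ ≤
        ν⁻¹ * (9 + τ ^ 2) ^ 2 * Real.exp (9 - (3 / 8) * τ ^ 2) := by
      rw [hs, ← neg_sub, norm_neg, show (1 + ζ / ν) * edgeExp ν k ζ - edgeExp ν k ζ =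
        (ζ / ν) * edgeExp ν k ζ by ring, norm_mul, norm_div, Complex.norm_real,
        Real.norm_of_nonneg hν0.le]
      refine mul_le_mul ?_ hE (norm_nonneg _) (by positivity)
      rw [div_eq_inv_mul]
      refine mul_le_mul_of_nonneg_left ?_ (by positivity)
      rw [← hsq]
      have h3 : 9 ≤ ‖ζ‖ ^ 2 := by rw [hsq]; nlinarith [sq_nonneg τ]
      have h3' : 3 ≤ ‖ζ‖ := by nlinarith [norm_nonneg ζ]
      have h4 : ‖ζ‖ ≤ ‖ζ‖ ^ 2 := by nlinarith
      exact h4.trans (by nlinarith)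
    have h3 := norm_add_le (edgeExp ν k ζ - edgeExp ν (k + 1) ζ)
      (edgeExp ν (k + 1) ζ - Complex.exp (ζ ^ 3 / 3))
    rw [sub_add_sub_cancel] at h3
    linarith

/-! ### The prefactor and Stirling's formula -/

lemma log_stirlingSeq_le {n : ℕ} (hn : 1 ≤ n) :
    Real.log (Stirling.stirlingSeq n) ≤ Real.log √Real.pi + 1 / (12 * n) := by
  have hmono : Monotone (fun k : ℕ => Real.log (Stirling.stirlingSeq (k + 1)) -
      1 / (12 * ((k : ℝ) + 1))) := by
    refine monotone_nat_of_le_succ fun k => ?_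
    have h := Stirling.log_stirlingSeq_sdiff_le (k + 1)
    push_cast at h ⊢
    have : (1 : ℝ) / (12 * (k + 1) * (k + 1 + 1)) = 1 / (12 * (k + 1)) - 1 / (12 * (k + 1 + 1)) := by
      have : (k : ℝ) + 1 ≠ 0 := by positivity
      have : (k : ℝ) + 1 + 1 ≠ 0 := by positivity
      field_simp
      ring
    linarith
  have hlim : Tendsto (fun k : ℕ => Real.log (Stirling.stirlingSeq (k + 1)) -
      1 / (12 * ((k : ℝ) + 1))) atTop (𝓝 (Real.log √Real.pi - 0)) := by
    refine Tendsto.sub ?_ ?_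
    · exact ((Real.continuousAt_log (by positivity)).tendsto.comp
        Stirling.tendsto_stirlingSeq_sqrt_pi).comp (tendsto_add_atTop_nat 1)
    · have := (tendsto_one_div_add_atTop_nhds_zero_nat (𝕜 := ℝ)).const_mul (1 / 12 : ℝ)
      rw [mul_zero] at this
      refine this.congr fun k => ?_
      field_simp
  have h := hmono.ge_of_tendsto hlim (n - 1)
  have hn' : ((n - 1 : ℕ) : ℝ) + 1 = n := by exact_mod_cast Nat.sub_add_cancel hn
  rw [hn', Nat.sub_add_cancel hn] at h
  linarith

lemma edgePre_pos {n : ℕ} (hn : 1 ≤ n) : 0 < edgePre n := by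
  have hm := edgeMu_pos hn
  have hv := one_le_edgeNu hn
  have := heNorm_pos n
  rw [edgePre]; positivity

lemma sq_edgePre {n : ℕ} (hn : 1 ≤ n) :
    (2 * Real.pi * edgePre n) ^ 2 = √Real.pi / Stirling.stirlingSeq n := by
  have hm := edgeMu_pos hn
  have hv := one_le_edgeNu hn
  have h2 := edgeMu_sq hn
  have h3 := edgeNu_cube n
  have h4 := sqrt_two_mul_eq hn
  have hn0 : (0 : ℝ) < n := by exact_mod_cast hn
  have hh := heNorm_pos n
  have hpi : 0 < √Real.pi := Real.sqrt_pos.2 Real.pi_pos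
  have hpi2 : √Real.pi ^ 2 = Real.pi := Real.sq_sqrt Real.pi_pos.le
  have he : Real.exp (-n / 2) ^ 2 = (Real.exp 1 ^ n)⁻¹ := by
    rw [← Real.exp_nat_mul, ← Real.exp_nat_mul, ← Real.exp_neg]; congr 1; push_cast; ring
  have hb : ((edgeMu n * edgeNu n ^ 2) ^ n) ^ 2 = (n : ℝ) ^ n / 2 ^ n := by
    rw [← pow_mul, mul_comm n 2, pow_mul, ← div_pow]
    congr 1
    linear_combination (edgeNu n ^ 3 / 2) * h2 + (1 / 2) * h3
  have hs1 := Real.sq_sqrt hh.le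
  have hs2 := Real.sq_sqrt (show 0 ≤ 2 * edgeMu n by positivity)
  have hX : ∀ X E h s : ℝ, (2 * Real.pi * (X * E / (√Real.pi * h * (2 * edgeMu n) * s))) ^ 2 =
      4 * Real.pi ^ 2 * (X ^ 2 * E ^ 2 / (√Real.pi ^ 2 * h ^ 2 * (2 * edgeMu n) ^ 2 * s ^ 2)) := by
    intros; ring
  rw [edgePre, Stirling.stirlingSeq, h4, hX, hb, he, hs1, hs2, heNorm, div_pow (n : ℝ)]
  have hf : (n.factorial : ℝ) ≠ 0 := by positivity
  have hv' : edgeNu n ≠ 0 := by positivity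
  have hπ := hpi.ne'
  rw [hpi2]
  generalize hq : √Real.pi = p at *
  rw [← hpi2]
  field_simp
  linear_combination (-4 * (1 + 2 * edgeMu n ^ 2 * edgeNu n)) * h2

lemma edgePre_le {n : ℕ} (hn : 1 ≤ n) : 2 * Real.pi * edgePre n ≤ 1 := by
  have h := sq_edgePre hn
  have hpi : 0 < √Real.pi := Real.sqrt_pos.2 Real.pi_pos
  have h1 := Stirling.sqrt_pi_le_stirlingSeq (n := n) (by omega)
  have h2 : √Real.pi / Stirling.stirlingSeq n ≤ 1 := (div_le_one (hpi.trans_le h1)).2 h1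
  have hp : 0 < 2 * Real.pi * edgePre n := by have := edgePre_pos hn; positivity
  nlinarith

lemma one_sub_le_edgePre {n : ℕ} (hn : 1 ≤ n) :
    1 - (edgeNu n)⁻¹ ≤ 2 * Real.pi * edgePre n := by
  have h := sq_edgePre hn
  have hle := edgePre_le hn
  have hpi : 0 < √Real.pi := Real.sqrt_pos.2 Real.pi_pos
  have h1 := Stirling.sqrt_pi_le_stirlingSeq (n := n) (by omega)
  have hst := hpi.trans_le h1
  have h2 := log_stirlingSeq_le hn
  have hp : 0 < 2 * Real.pi * edgePre n := by have := edgePre_pos hn; positivity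
  have hv := one_le_edgeNu hn
  have h3 : 1 - (edgeNu n)⁻¹ ≤ √Real.pi / Stirling.stirlingSeq n := by
    rw [← Real.exp_log (div_pos hpi hst), Real.log_div hpi.ne' hst.ne']
    refine le_trans ?_ (Real.add_one_le_exp _)
    have hn0 : (0 : ℝ) < n := by exact_mod_cast hn
    have : 1 / (12 * (n : ℝ)) ≤ (edgeNu n)⁻¹ := by
      rw [← edgeNu_cube n, ← one_div]
      refine one_div_le_one_div_of_le (by positivity) ?_
      nlinarith [pow_le_pow_right₀ hv (show 1 ≤ 3 by norm_num), pow_one (edgeNu n)]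
    linarith
  nlinarith

/-! ### Uniform bounds for the scaled Hermite functions -/

/-- The contour integral representing the Airy function, up to normalization. -/
def airyInt (s : ℝ) : ℂ := ∫ τ : ℝ, Complex.exp (((3 : ℝ) + τ * Complex.I : ℂ) ^ 3 / 3) *
  Complex.exp (-(((3 : ℝ) + τ * Complex.I) * s))

/-- The total mass of the basic dominating function on the contour. -/
def domMass : ℝ := ∫ τ : ℝ, Real.exp (9 - (3 / 8) * τ ^ 2)

/-- The total mass of the dominating function for differences on the contour. -/
def domMassDiff : ℝ := ∫ τ : ℝ, 2 * (9 + τ ^ 2) ^ 2 * Real.exp (9 - (3 / 8) * τ ^ 2)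

lemma integrable_pow_mul_dom (k : ℕ) :
    Integrable (fun τ : ℝ => τ ^ k * Real.exp (9 - (3 / 8) * τ ^ 2)) := by
  have h := (integrable_rpow_mul_exp_neg_mul_sq (b := 3 / 8) (by norm_num) (s := k)
    (by have : (0 : ℝ) ≤ k := k.cast_nonneg
        linarith)).const_mul (Real.exp 9)
  refine h.congr (Eventually.of_forall fun τ => ?_)
  simp only [Real.rpow_natCast]
  rw [mul_left_comm, ← Real.exp_add]
  ring_nf

lemma integrable_dom : Integrable (fun τ : ℝ => Real.exp (9 - (3 / 8) * τ ^ 2)) := by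
  simpa using integrable_pow_mul_dom 0

lemma integrable_dom_diff :
    Integrable (fun τ : ℝ => 2 * (9 + τ ^ 2) ^ 2 * Real.exp (9 - (3 / 8) * τ ^ 2)) := by
  have h := (((integrable_pow_mul_dom 0).const_mul 162).add
    ((integrable_pow_mul_dom 2).const_mul 36)).add ((integrable_pow_mul_dom 4).const_mul 2)
  refine h.congr (Eventually.of_forall fun τ => ?_)
  simp only [Pi.add_apply]
  ring

lemma domMass_nonneg : 0 ≤ domMass := integral_nonneg fun _ => (Real.exp_pos _).le

lemma domMassDiff_nonneg : 0 ≤ domMassDiff := integral_nonneg fun _ => by positivity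

lemma norm_exp_neg_line_mul (σ τ s : ℝ) :
    ‖Complex.exp (-(((σ : ℂ) + τ * Complex.I) * s))‖ = Real.exp (-(σ * s)) := by
  rw [Complex.norm_exp]
  congr 1
  have : (-(((σ : ℂ) + τ * Complex.I) * s)) = ((-(σ * s) : ℝ) : ℂ) +
    ((-(τ * s) : ℝ) : ℂ) * Complex.I := by push_cast; ring
  rw [this, Complex.add_re, Complex.ofReal_re, Complex.re_ofReal_mul, Complex.I_re, mul_zero,
    add_zero]

lemma norm_edgeInt_three_le {ν : ℝ} {n m : ℕ} (hν : 1 ≤ ν) (hn : ν ^ 3 = n) (hm : m ≤ n) (s : ℝ) :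
    ‖edgeInt ν m 3 s‖ ≤ domMass * Real.exp (-(3 * s)) := by
  rw [domMass, ← integral_mul_const, edgeInt]
  refine norm_integral_le_of_norm_le (integrable_dom.mul_const _) (Eventually.of_forall fun τ => ?_)
  rw [norm_mul, norm_exp_neg_line_mul]
  exact mul_le_mul_of_nonneg_right (norm_edgeExp_three_le hν hn hm τ) (Real.exp_pos _).le

lemma norm_edgeInt_large_le {ν s : ℝ} {n m : ℕ} (hν : 1 ≤ ν) (hn : ν ^ 3 = n) (hm : m ≤ n)
    (hs : 3 * ν ≤ s) : ‖edgeInt ν m (s / ν) s‖ ≤ domMass * Real.exp (-(s ^ 2 / (2 * ν))) := by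
  have hν0 : 0 < ν := by linarith
  rw [domMass, ← integral_mul_const, edgeInt]
  refine norm_integral_le_of_norm_le (integrable_dom.mul_const _) (Eventually.of_forall fun τ => ?_)
  have hσ : 3 ≤ s / ν := by rwa [le_div_iff₀ hν0]
  have h1 := norm_edgeExp_le hν hn hm hσ τ
  rw [norm_mul, norm_exp_neg_line_mul]
  refine (mul_le_mul_of_nonneg_right h1 (Real.exp_pos _).le).trans ?_
  have h2 : (1 + s / ν / ν) ^ n ≤ Real.exp (n * (s / ν / ν)) := by
    rw [Real.exp_nat_mul]
    refine pow_le_pow_left₀ (by positivity) ?_ n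
    linarith [Real.add_one_le_exp (s / ν / ν)]
  refine (mul_le_mul_of_nonneg_right (mul_le_mul_of_nonneg_right (mul_le_mul_of_nonneg_right h2
    (Real.exp_pos _).le) (Real.exp_pos _).le) (Real.exp_pos _).le).trans ?_
  rw [← Real.exp_add, ← Real.exp_add, ← Real.exp_add, ← Real.exp_add, ← hn]
  refine Real.exp_le_exp.2 ?_
  have : ν ^ 3 * (s / ν / ν) + (ν * (s / ν) ^ 2 / 2 - ν ^ 2 * (s / ν)) + -(3 / 8) * τ ^ 2 +
      -(s / ν * s) = - (3 / 8) * τ ^ 2 + -(s ^ 2 / (2 * ν)) := by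
    field_simp
    ring
  rw [this]
  linarith

lemma continuous_edgeExp_line (ν σ : ℝ) (m : ℕ) (s : ℝ) : Continuous fun τ : ℝ =>
    edgeExp ν m (σ + τ * Complex.I) * Complex.exp (-((σ + τ * Complex.I) * s)) := by
  unfold edgeExp
  fun_prop

lemma continuous_airy_line (s : ℝ) : Continuous fun τ : ℝ =>
    Complex.exp (((3 : ℝ) + τ * Complex.I : ℂ) ^ 3 / 3) *
      Complex.exp (-(((3 : ℝ) + τ * Complex.I) * s)) := by
  fun_prop

lemma norm_airy_line_le (τ : ℝ) :
    ‖Complex.exp (((3 : ℝ) + τ * Complex.I : ℂ) ^ 3 / 3)‖ ≤ Real.exp (9 - (3 / 8) * τ ^ 2) := by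
  rw [Complex.norm_exp, re_cube_three]
  exact Real.exp_le_exp.2 (by nlinarith [sq_nonneg τ])

lemma norm_airyInt_le (s : ℝ) : ‖airyInt s‖ ≤ domMass * Real.exp (-(3 * s)) := by
  rw [domMass, ← integral_mul_const, airyInt]
  refine norm_integral_le_of_norm_le (integrable_dom.mul_const _) (Eventually.of_forall fun τ => ?_)
  rw [norm_mul, norm_exp_neg_line_mul]
  exact mul_le_mul_of_nonneg_right (norm_airy_line_le τ) (Real.exp_pos _).le

lemma norm_edgeInt_sub_airyInt_le {ν : ℝ} {n j : ℕ} (hν : 1 ≤ ν) (hn : ν ^ 3 = n) (hj : j ≤ 1)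
    (s : ℝ) : ‖edgeInt ν (n - j) 3 s - airyInt s‖ ≤
      ν⁻¹ * domMassDiff * Real.exp (-(3 * s)) := by
  have hi1 : Integrable (fun τ : ℝ => edgeExp ν (n - j) ((3 : ℝ) + τ * Complex.I) *
      Complex.exp (-(((3 : ℝ) + τ * Complex.I) * s))) := by
    refine (integrable_dom.mul_const (Real.exp (-(3 * s)))).mono'
      (continuous_edgeExp_line ν 3 (n - j) s).aestronglyMeasurable (Eventually.of_forall fun τ => ?_)
    rw [norm_mul, norm_exp_neg_line_mul]
    exact mul_le_mul_of_nonneg_right (norm_edgeExp_three_le hν hn (Nat.sub_le _ _) τ)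
      (Real.exp_pos _).le
  have hi2 : Integrable (fun τ : ℝ => Complex.exp (((3 : ℝ) + τ * Complex.I : ℂ) ^ 3 / 3) *
      Complex.exp (-(((3 : ℝ) + τ * Complex.I) * s))) := by
    refine (integrable_dom.mul_const (Real.exp (-(3 * s)))).mono'
      (continuous_airy_line s).aestronglyMeasurable (Eventually.of_forall fun τ => ?_)
    rw [norm_mul, norm_exp_neg_line_mul]
    exact mul_le_mul_of_nonneg_right (norm_airy_line_le τ) (Real.exp_pos _).le
  rw [edgeInt, airyInt, ← integral_sub hi1 hi2, domMassDiff, ← integral_const_mul,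
    ← integral_mul_const]
  refine norm_integral_le_of_norm_le ((integrable_dom_diff.const_mul _).mul_const _)
    (Eventually.of_forall fun τ => ?_)
  rw [← sub_mul, norm_mul, norm_exp_neg_line_mul]
  exact mul_le_mul_of_nonneg_right (norm_edgeExp_sub_le' hν hn hj τ) (Real.exp_pos _).le

lemma norm_edgePre_le {n : ℕ} (hn : 1 ≤ n) : edgePre n ≤ 1 := by
  have h := edgePre_le hn
  have h0 := edgePre_pos hn
  nlinarith [Real.pi_gt_three]

lemma edge_exponent_le {ν T s : ℝ} (hν : 1 ≤ ν) (hT : 0 ≤ T) (hs : -T ≤ s) (hs' : s ≤ 6 * ν) :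
    s ^ 2 / (4 * ν) + -(3 * s) ≤ (T ^ 2 + 3 * T) + -s - |s| / 2 := by
  have hν0 : 0 < ν := by linarith
  rcases le_total 0 s with h | h
  · have h1 : s ^ 2 / (4 * ν) ≤ 3 / 2 * s := by
      rw [div_le_iff₀ (by positivity)]; nlinarith
    rw [abs_of_nonneg h]
    nlinarith
  · have h1 : s ^ 2 / (4 * ν) ≤ T ^ 2 / 4 := by
      rw [div_le_div_iff₀ (by positivity) (by positivity)]
      nlinarith [mul_le_mul_of_nonneg_left hν (sq_nonneg T)]
    rw [abs_of_nonpos h]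
    nlinarith

/-- The constant in the uniform bounds for the scaled Hermite functions. -/
def edgeConst (T : ℝ) : ℝ := (domMass * (4 + T ^ 2) + domMassDiff) * Real.exp (T ^ 2 + 3 * T)

lemma domMass_mul_exp_le_edgeConst {T : ℝ} : domMass * Real.exp (T ^ 2 + 3 * T) ≤ edgeConst T := by
  rw [edgeConst]
  refine mul_le_mul_of_nonneg_right ?_ (Real.exp_pos _).le
  nlinarith [domMass_nonneg, domMassDiff_nonneg, mul_nonneg domMass_nonneg (sq_nonneg T)]

lemma edgeConst_nonneg (T : ℝ) : 0 ≤ edgeConst T := by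
  have := domMass_nonneg
  have := domMassDiff_nonneg
  rw [edgeConst]; positivity

lemma abs_edgeFun_large_le {n j : ℕ} (hn : 1 ≤ n) (hj : j ≤ 1) {s : ℝ} (hs : 6 * edgeNu n ≤ s) :
    |edgeFun j n s| ≤ domMass * Real.exp (-(3 / 2 * s)) := by
  have hν := one_le_edgeNu hn
  have hν0 : 0 < edgeNu n := by linarith
  have hp := edgePre_pos hn
  rw [← Real.norm_eq_abs, ← Complex.norm_real, edgeFun_eq hn hj (s / edgeNu n) s, norm_mul,
    Complex.norm_real, Real.norm_of_nonneg (by positivity)]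
  refine (mul_le_mul_of_nonneg_left (norm_edgeInt_large_le hν (edgeNu_cube n) (Nat.sub_le n j)
    (by linarith)) (by positivity)).trans ?_
  have h1 : edgePre n * Real.exp (s ^ 2 / (4 * edgeNu n)) *
      (domMass * Real.exp (-(s ^ 2 / (2 * edgeNu n)))) =
      edgePre n * (domMass * Real.exp (-(s ^ 2 / (4 * edgeNu n)))) := by
    have : -(s ^ 2 / (4 * edgeNu n)) = s ^ 2 / (4 * edgeNu n) + -(s ^ 2 / (2 * edgeNu n)) := by
      field_simp; ring
    rw [this, Real.exp_add]; ring
  rw [h1]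
  have h2 : Real.exp (-(s ^ 2 / (4 * edgeNu n))) ≤ Real.exp (-(3 / 2 * s)) := by
    refine Real.exp_le_exp.2 (neg_le_neg ?_)
    rw [le_div_iff₀ (by positivity)]
    nlinarith
  have h3 := mul_le_mul_of_nonneg_left h2 domMass_nonneg
  have h4 : 0 ≤ domMass * Real.exp (-(s ^ 2 / (4 * edgeNu n))) :=
    mul_nonneg domMass_nonneg (Real.exp_pos _).le
  nlinarith [norm_edgePre_le hn]

lemma abs_edgeFun_le {T : ℝ} (hT : 0 ≤ T) {n j : ℕ} (hn : 1 ≤ n) (hj : j ≤ 1) {s : ℝ}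
    (hs : -T ≤ s) : |edgeFun j n s| ≤ edgeConst T * Real.exp (-s) := by
  have hν := one_le_edgeNu hn
  have hν0 : 0 < edgeNu n := by linarith
  have hp := edgePre_pos hn
  have hc := domMass_mul_exp_le_edgeConst (T := T)
  rcases le_total s (6 * edgeNu n) with h | h
  · rw [← Real.norm_eq_abs, ← Complex.norm_real, edgeFun_eq hn hj 3 s, norm_mul,
      Complex.norm_real, Real.norm_of_nonneg (by positivity)]
    refine (mul_le_mul_of_nonneg_left (norm_edgeInt_three_le hν (edgeNu_cube n) (Nat.sub_le n j) s)
      (by positivity)).trans ?_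
    have he := edge_exponent_le hν hT hs h
    have h1 : Real.exp (s ^ 2 / (4 * edgeNu n)) * Real.exp (-(3 * s)) ≤
        Real.exp (T ^ 2 + 3 * T) * Real.exp (-s) := by
      rw [← Real.exp_add, ← Real.exp_add]
      exact Real.exp_le_exp.2 (by linarith [abs_nonneg s])
    have h2 := mul_le_mul_of_nonneg_left h1 domMass_nonneg
    have h3 := mul_le_mul_of_nonneg_right hc (Real.exp_pos (-s)).le
    have h4 : 0 ≤ domMass * (Real.exp (s ^ 2 / (4 * edgeNu n)) * Real.exp (-(3 * s))) :=
      mul_nonneg domMass_nonneg (by positivity)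
    nlinarith [norm_edgePre_le hn]
  · refine (abs_edgeFun_large_le hn hj h).trans ?_
    have h1 : domMass ≤ edgeConst T := by
      refine le_trans ?_ hc
      have := Real.one_le_exp (show 0 ≤ T ^ 2 + 3 * T by positivity)
      nlinarith [domMass_nonneg]
    exact mul_le_mul h1 (Real.exp_le_exp.2 (by linarith)) (Real.exp_pos _).le (edgeConst_nonneg T)

lemma sq_le_exp_half_abs (s : ℝ) : s ^ 2 ≤ 8 * Real.exp (|s| / 2) := by
  have h := Real.quadratic_le_exp_of_nonneg (show 0 ≤ |s| / 2 by positivity)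
  have : |s| ^ 2 = s ^ 2 := sq_abs s
  nlinarith [abs_nonneg s]

lemma exp_neg_three_mul_le {T s : ℝ} (hT : 0 ≤ T) (hs : -T ≤ s) :
    Real.exp (-(3 * s)) ≤ Real.exp (T ^ 2 + 3 * T) * Real.exp (-s) := by
  rw [← Real.exp_add]
  exact Real.exp_le_exp.2 (by nlinarith [sq_nonneg T])

lemma norm_edgeFun_sub_le {T : ℝ} (hT : 0 ≤ T) {n j : ℕ} (hn : 1 ≤ n) (hj : j ≤ 1) {s : ℝ}
    (hs : -T ≤ s) : ‖(edgeFun j n s : ℂ) - airyInt s / (2 * Real.pi)‖ ≤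
      (edgeNu n)⁻¹ * edgeConst T * Real.exp (-s) := by
  have hν := one_le_edgeNu hn
  have hν0 : 0 < edgeNu n := by linarith
  have hp := edgePre_pos hn
  have hp1 := norm_edgePre_le hn
  have hpi := Real.pi_gt_three
  have hd := domMass_nonneg
  have hA := norm_airyInt_le s
  have hA3 := exp_neg_three_mul_le hT hs
  have hA' : ‖airyInt s / (2 * Real.pi)‖ ≤ 1 / 2 * (domMass * Real.exp (-(3 * s))) := by
    rw [norm_div, show ‖(2 * Real.pi : ℂ)‖ = 2 * Real.pi by
      rw [norm_mul, Complex.norm_real, Real.norm_of_nonneg Real.pi_pos.le]; simp,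
      div_le_iff₀ (by positivity)]
    nlinarith [mul_nonneg hd (Real.exp_pos (-(3 * s))).le]
  rcases le_total s (6 * edgeNu n) with h | h
  · have hE := norm_edgeInt_three_le hν (edgeNu_cube n) (Nat.sub_le n j) s
    have hEA := norm_edgeInt_sub_airyInt_le hν (edgeNu_cube n) hj s
    set x := s ^ 2 / (4 * edgeNu n) with hx
    have hx0 : 0 ≤ x := by positivity
    have hsplit : (edgeFun j n s : ℂ) - airyInt s / (2 * Real.pi) =
        (edgePre n * (Real.exp x - 1) : ℝ) * edgeInt (edgeNu n) (n - j) 3 s +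
        (edgePre n : ℝ) * (edgeInt (edgeNu n) (n - j) 3 s - airyInt s) +
        ((2 * Real.pi * edgePre n - 1 : ℝ) : ℂ) * (airyInt s / (2 * Real.pi)) := by
      rw [edgeFun_eq hn hj 3 s, ← hx]
      have : (Real.pi : ℂ) ≠ 0 := by exact_mod_cast Real.pi_ne_zero
      push_cast
      field_simp
      ring
    rw [hsplit]
    have hex : Real.exp x - 1 ≤ x * Real.exp x := by
      have := Real.add_one_le_exp (-x)
      have h2 : Real.exp (-x) * Real.exp x = 1 := by rw [← Real.exp_add]; simp
      nlinarith [Real.exp_pos x]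
    have hex0 : 0 ≤ Real.exp x - 1 := by linarith [Real.one_le_exp hx0]
    have he := edge_exponent_le hν hT hs h
    rw [← hx] at he
    have t1 : ‖((edgePre n * (Real.exp x - 1) : ℝ) : ℂ) * edgeInt (edgeNu n) (n - j) 3 s‖ ≤
        (edgeNu n)⁻¹ * (2 * domMass) * (Real.exp (T ^ 2 + 3 * T) * Real.exp (-s)) := by
      rw [norm_mul, Complex.norm_real, Real.norm_of_nonneg (by positivity)]
      have h1 : edgePre n * (Real.exp x - 1) ≤ x * Real.exp x := by nlinarith
      refine (mul_le_mul h1 hE (norm_nonneg _) (by positivity)).trans ?_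
      have h2 : x * (Real.exp x * Real.exp (-(3 * s))) ≤
          (edgeNu n)⁻¹ * 2 * (Real.exp (T ^ 2 + 3 * T) * Real.exp (-s)) := by
        have h3 : Real.exp x * Real.exp (-(3 * s)) ≤
            Real.exp (T ^ 2 + 3 * T) * Real.exp (-s) * Real.exp (-(|s| / 2)) := by
          rw [← Real.exp_add, ← Real.exp_add, ← Real.exp_add]
          exact Real.exp_le_exp.2 (by linarith)
        have h4 : x ≤ (edgeNu n)⁻¹ * 2 * Real.exp (|s| / 2) := by
          rw [hx, inv_mul_eq_div, div_mul_eq_mul_div, div_le_div_iff₀ (by positivity) hν0]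
          nlinarith [mul_le_mul_of_nonneg_right (sq_le_exp_half_abs s) hν0.le]
        refine (mul_le_mul h4 h3 (by positivity) (by positivity)).trans (le_of_eq ?_)
        have h5 : Real.exp (|s| / 2) * Real.exp (-(|s| / 2)) = 1 := by rw [← Real.exp_add]; simp
        linear_combination ((edgeNu n)⁻¹ * 2 * (Real.exp (T ^ 2 + 3 * T) * Real.exp (-s))) * h5
      have := mul_le_mul_of_nonneg_left h2 hd
      linarith
    have t2 : ‖((edgePre n : ℝ) : ℂ) * (edgeInt (edgeNu n) (n - j) 3 s - airyInt s)‖ ≤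
        (edgeNu n)⁻¹ * domMassDiff * (Real.exp (T ^ 2 + 3 * T) * Real.exp (-s)) := by
      rw [norm_mul, Complex.norm_real, Real.norm_of_nonneg hp.le]
      have h1 : 0 ≤ (edgeNu n)⁻¹ * domMassDiff := mul_nonneg (by positivity) domMassDiff_nonneg
      have h2 := mul_le_mul_of_nonneg_left hA3 h1
      have h3 := norm_nonneg (edgeInt (edgeNu n) (n - j) 3 s - airyInt s)
      nlinarith
    have t3 : ‖((2 * Real.pi * edgePre n - 1 : ℝ) : ℂ) * (airyInt s / (2 * Real.pi))‖ ≤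
        (edgeNu n)⁻¹ * domMass * (Real.exp (T ^ 2 + 3 * T) * Real.exp (-s)) := by
      rw [norm_mul, Complex.norm_real]
      have h1 : ‖2 * Real.pi * edgePre n - 1‖ ≤ (edgeNu n)⁻¹ := by
        rw [Real.norm_eq_abs, abs_le]
        constructor
        · linarith [one_sub_le_edgePre hn]
        · linarith [edgePre_le hn, inv_pos.2 hν0]
      have h2 := mul_le_mul_of_nonneg_left hA3 hd
      have h3 : ‖airyInt s / (2 * Real.pi)‖ ≤ domMass * (Real.exp (T ^ 2 + 3 * T) *
        Real.exp (-s)) := by linarith [norm_nonneg (airyInt s / (2 * Real.pi))]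
      refine (mul_le_mul h1 h3 (norm_nonneg _) (by positivity)).trans (le_of_eq (by ring))
    refine (norm_add_le _ _).trans (le_trans (add_le_add ((norm_add_le _ _).trans
      (add_le_add t1 t2)) t3) ?_)
    rw [edgeConst]
    have h5 : 0 ≤ (edgeNu n)⁻¹ * domMass * (1 + T ^ 2) * (Real.exp (T ^ 2 + 3 * T) *
      Real.exp (-s)) := by positivity
    linarith
  · have h1 := abs_edgeFun_large_le hn hj h
    rw [← Real.norm_eq_abs, ← Complex.norm_real] at h1
    refine (norm_sub_le _ _).trans ((add_le_add h1 hA').trans ?_)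
    have hs0 : 0 ≤ s := by linarith
    have h2 : Real.exp (-(3 * s)) ≤ Real.exp (-(3 / 2 * s)) := Real.exp_le_exp.2 (by linarith)
    have h3 : Real.exp (-(3 / 2 * s)) ≤ (edgeNu n)⁻¹ * Real.exp (-s) := by
      have h4 : Real.exp (-(edgeNu n)) ≤ (edgeNu n)⁻¹ := by
        rw [Real.exp_neg]
        exact inv_anti₀ hν0 (by linarith [Real.add_one_le_exp (edgeNu n)])
      have h5 : Real.exp (-(3 / 2 * s)) ≤ Real.exp (-(edgeNu n)) * Real.exp (-s) := by
        rw [← Real.exp_add]; exact Real.exp_le_exp.2 (by linarith)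
      exact h5.trans (mul_le_mul_of_nonneg_right h4 (Real.exp_pos _).le)
    have h4 : 2 * domMass ≤ edgeConst T := by
      rw [edgeConst]
      have := Real.one_le_exp (show 0 ≤ T ^ 2 + 3 * T by positivity)
      have h5 : 2 * domMass ≤ domMass * (4 + T ^ 2) + domMassDiff := by
        nlinarith [domMassDiff_nonneg, mul_nonneg hd (sq_nonneg T)]
      nlinarith
    have h6 := mul_le_mul_of_nonneg_left h3 hd
    have h7 := mul_le_mul_of_nonneg_left h2 hd
    have h8 := mul_le_mul_of_nonneg_right h4 (show 0 ≤ (edgeNu n)⁻¹ * Real.exp (-s) by positivity)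
    have h9 : 0 ≤ domMass * ((edgeNu n)⁻¹ * Real.exp (-s)) := by positivity
    linarith

/-! ### The contour integral solves the Airy equation -/

/-- The derivatives of the Airy contour integral. -/
def airyD (k : ℕ) (s : ℝ) : ℂ := ∫ τ : ℝ, (-((3 : ℝ) + τ * Complex.I : ℂ)) ^ k *
  (Complex.exp (((3 : ℝ) + τ * Complex.I : ℂ) ^ 3 / 3) *
    Complex.exp (-(((3 : ℝ) + τ * Complex.I) * s)))

lemma airyD_zero (s : ℝ) : airyD 0 s = airyInt s := by
  simp [airyD, airyInt]

lemma integrable_norm_pow_mul_gauss (k : ℕ) : Integrable (fun τ : ℝ =>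
    ‖((3 : ℝ) + τ * Complex.I : ℂ)‖ ^ k * Real.exp (9 - τ ^ 2)) := by
  have h := ((integrable_eval_mul_gauss ((C ((3 : ℝ) : ℂ) + X * C Complex.I) ^ k)).norm).const_mul
    (Real.exp 9)
  refine h.congr (Eventually.of_forall fun τ => ?_)
  simp only [eval_pow, eval_add, eval_C, eval_mul, eval_X, norm_mul, norm_pow, Complex.norm_real,
    Real.norm_eq_abs, Real.abs_exp]
  rw [mul_left_comm, ← Real.exp_add]
  ring_nf

lemma norm_airyD_integrand_le (k : ℕ) (τ s : ℝ) : ‖(-((3 : ℝ) + τ * Complex.I : ℂ)) ^ k *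
    (Complex.exp (((3 : ℝ) + τ * Complex.I : ℂ) ^ 3 / 3) *
    Complex.exp (-(((3 : ℝ) + τ * Complex.I) * s)))‖ ≤
      ‖((3 : ℝ) + τ * Complex.I : ℂ)‖ ^ k * Real.exp (9 - τ ^ 2) * Real.exp (-(3 * s)) := by
  rw [norm_mul, norm_mul, norm_exp_neg_line_mul, norm_pow, norm_neg, Complex.norm_exp,
    re_cube_three, mul_assoc]
  refine mul_le_mul_of_nonneg_left (mul_le_mul_of_nonneg_right (Real.exp_le_exp.2 ?_)
    (Real.exp_pos _).le) (by positivity)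
  nlinarith [sq_nonneg τ]

lemma continuous_airyD_integrand (k : ℕ) (s : ℝ) : Continuous fun τ : ℝ =>
    (-((3 : ℝ) + τ * Complex.I : ℂ)) ^ k * (Complex.exp (((3 : ℝ) + τ * Complex.I : ℂ) ^ 3 / 3) *
    Complex.exp (-(((3 : ℝ) + τ * Complex.I) * s))) := by
  fun_prop

lemma integrable_airyD_integrand (k : ℕ) (s : ℝ) : Integrable fun τ : ℝ =>
    (-((3 : ℝ) + τ * Complex.I : ℂ)) ^ k * (Complex.exp (((3 : ℝ) + τ * Complex.I : ℂ) ^ 3 / 3) *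
    Complex.exp (-(((3 : ℝ) + τ * Complex.I) * s))) :=
  ((integrable_norm_pow_mul_gauss k).mul_const _).mono'
    (continuous_airyD_integrand k s).aestronglyMeasurable
    (Eventually.of_forall fun τ => norm_airyD_integrand_le k τ s)

lemma hasDerivAt_airyD (k : ℕ) (s : ℝ) : HasDerivAt (airyD k) (airyD (k + 1) s) s := by
  have h := hasDerivAt_integral_of_dominated_loc_of_deriv_le (μ := (volume : Measure ℝ))
    (F := fun (s : ℝ) (τ : ℝ) => (-((3 : ℝ) + τ * Complex.I : ℂ)) ^ k *
      (Complex.exp (((3 : ℝ) + τ * Complex.I : ℂ) ^ 3 / 3) *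
      Complex.exp (-(((3 : ℝ) + τ * Complex.I) * s))))
    (F' := fun (s : ℝ) (τ : ℝ) => (-((3 : ℝ) + τ * Complex.I : ℂ)) ^ (k + 1) *
      (Complex.exp (((3 : ℝ) + τ * Complex.I : ℂ) ^ 3 / 3) *
      Complex.exp (-(((3 : ℝ) + τ * Complex.I) * s))))
    (x₀ := s) (Ioi_mem_nhds (show s - 1 < s by linarith))
    (bound := fun τ => ‖((3 : ℝ) + τ * Complex.I : ℂ)‖ ^ (k + 1) * Real.exp (9 - τ ^ 2) *
      Real.exp (-(3 * (s - 1))))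
    (Eventually.of_forall fun x => (continuous_airyD_integrand k x).aestronglyMeasurable)
    (integrable_airyD_integrand k s)
    (continuous_airyD_integrand (k + 1) s).aestronglyMeasurable
    (Eventually.of_forall fun τ x hx => (norm_airyD_integrand_le (k + 1) τ x).trans
      (mul_le_mul_of_nonneg_left (Real.exp_le_exp.2 (by
        have : s - 1 < x := hx
        linarith)) (by positivity)))
    ((integrable_norm_pow_mul_gauss (k + 1)).mul_const _)
    (Eventually.of_forall fun τ x _ => by
      have h1 : HasDerivAt (fun x : ℝ => -(((3 : ℝ) + τ * Complex.I : ℂ) * x))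
          (-((3 : ℝ) + τ * Complex.I)) x := by
        refine ((((hasDerivAt_id (x : ℂ)).comp_ofReal).const_mul
          ((3 : ℝ) + τ * Complex.I : ℂ)).neg).congr_deriv ?_
        simp
      refine ((h1.cexp.const_mul _).const_mul _).congr_deriv ?_
      rw [pow_succ]; ring)
  exact h.2

lemma airyD_two (s : ℝ) : airyD 2 s = s * airyD 0 s := by
  have hz : ∀ τ : ℝ, HasDerivAt (fun τ : ℝ => ((3 : ℝ) : ℂ) + τ * Complex.I) Complex.I τ :=
    fun τ => by
      simpa using ((hasDerivAt_id (τ : ℂ)).comp_ofReal.mul_const Complex.I).const_add ((3 : ℝ) : ℂ)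
  have hd : ∀ τ : ℝ, HasDerivAt (fun τ : ℝ => (-((3 : ℝ) + τ * Complex.I : ℂ)) ^ 0 *
      (Complex.exp (((3 : ℝ) + τ * Complex.I : ℂ) ^ 3 / 3) *
      Complex.exp (-(((3 : ℝ) + τ * Complex.I) * s))))
      (Complex.I * ((-((3 : ℝ) + τ * Complex.I : ℂ)) ^ 2 *
      (Complex.exp (((3 : ℝ) + τ * Complex.I : ℂ) ^ 3 / 3) *
      Complex.exp (-(((3 : ℝ) + τ * Complex.I) * s))) - s * ((-((3 : ℝ) + τ * Complex.I : ℂ)) ^ 0 *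
      (Complex.exp (((3 : ℝ) + τ * Complex.I : ℂ) ^ 3 / 3) *
      Complex.exp (-(((3 : ℝ) + τ * Complex.I) * s)))))) τ := fun τ => by
    have h1 := (((hz τ).pow 3).div_const 3).cexp
    have h2 := (((hz τ).mul_const (s : ℂ)).neg).cexp
    simp only [pow_zero, one_mul]
    refine (h1.mul h2).congr_deriv ?_
    simp only [Nat.add_one_sub_one, Nat.cast_ofNat, neg_sq, Pi.neg_apply, Pi.pow_apply]
    ring
  have h := integral_eq_zero_of_hasDerivAt_of_integrable hd
    (((integrable_airyD_integrand 2 s).sub ((integrable_airyD_integrand 0 s).const_mul _)).const_mul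
      Complex.I) (integrable_airyD_integrand 0 s)
  rw [integral_const_mul, integral_sub (integrable_airyD_integrand 2 s)
    ((integrable_airyD_integrand 0 s).const_mul _), integral_const_mul] at h
  have h2 := (mul_eq_zero.1 h).resolve_left Complex.I_ne_zero
  exact sub_eq_zero.1 h2

/-- The constant in the decay of the derivatives of the Airy contour integral. -/
def airyMass (k : ℕ) : ℝ := ∫ τ : ℝ, ‖((3 : ℝ) + τ * Complex.I : ℂ)‖ ^ k * Real.exp (9 - τ ^ 2)

lemma norm_airyD_le (k : ℕ) (s : ℝ) : ‖airyD k s‖ ≤ airyMass k * Real.exp (-(3 * s)) := by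
  rw [airyMass, ← integral_mul_const, airyD]
  exact norm_integral_le_of_norm_le ((integrable_norm_pow_mul_gauss k).mul_const _)
    (Eventually.of_forall fun τ => norm_airyD_integrand_le k τ s)

/-! ### Rotation of the contour -/

/-- The integrands on the contour at the origin. -/
def cubeFun (k : ℕ) (z : ℂ) : ℂ := z ^ k * Complex.exp (z ^ 3 / 3)

/-- The derivative of `cubeFun`. -/
def cubeFun' (k : ℕ) (z : ℂ) : ℂ := (k * z ^ (k - 1) + z ^ (k + 2)) * Complex.exp (z ^ 3 / 3)

lemma hasDerivAt_cubeFun (k : ℕ) (z : ℂ) : HasDerivAt (cubeFun k) (cubeFun' k z) z := by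
  have h := (hasDerivAt_pow k z).mul ((hasDerivAt_pow 3 z).div_const 3).cexp
  refine h.congr_deriv ?_
  rw [cubeFun']
  simp only [Nat.add_one_sub_one, Nat.cast_ofNat]
  ring

/-- The family of contours. -/
def contour (x τ : ℝ) : ℂ := (((1 - x) * 3 + x * τ / √3 : ℝ) : ℂ) + τ * Complex.I

lemma norm_contour_le {x τ : ℝ} (hx : x ∈ Icc (0 : ℝ) 1) (hτ : 0 ≤ τ) :
    ‖contour x τ‖ ≤ 3 + 2 * τ := by
  have h3 : 1 ≤ √3 := Real.one_le_sqrt.2 (by norm_num)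
  have h4 : τ / √3 ≤ τ := div_le_self hτ h3
  have h5 : 0 ≤ τ / √3 := by positivity
  obtain ⟨h0, h1⟩ := hx
  refine (norm_add_le _ _).trans ?_
  rw [Complex.norm_real, norm_mul, Complex.norm_real, Complex.norm_I, mul_div_assoc,
    Real.norm_of_nonneg (by have := mul_nonneg h0 h5; linarith), Real.norm_of_nonneg hτ]
  nlinarith

lemma re_contour_cube_le {x τ : ℝ} (hx : x ∈ Icc (0 : ℝ) 1) (hτ : 0 ≤ τ) :
    (contour x τ ^ 3 / 3).re ≤ 200 - τ ^ 2 := by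
  obtain ⟨h0, h1⟩ := hx
  have hs3 : √3 ^ 2 = 3 := Real.sq_sqrt (by norm_num)
  have h3 : 1 ≤ √3 := Real.one_le_sqrt.2 (by norm_num)
  have h32 : √3 ≤ 2 := by nlinarith
  set q := τ / √3 with hq
  have hq0 : 0 ≤ q := by positivity
  have hq2 : q ^ 2 = τ ^ 2 / 3 := by rw [hq, div_pow, hs3]
  have hqτ : q ≤ τ := div_le_self hτ h3
  set p := (1 - x) * 3 + x * q with hp
  have hcon : contour x τ = (p : ℂ) + τ * Complex.I := by
    rw [contour, hp, hq, mul_div_assoc]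
  have hre : (contour x τ ^ 3 / 3).re = p ^ 3 / 3 - p * τ ^ 2 := by
    have : contour x τ ^ 3 / 3 = ((p ^ 3 / 3 - p * τ ^ 2 : ℝ) : ℂ) +
        ((p ^ 2 * τ - τ ^ 3 / 3 : ℝ) : ℂ) * Complex.I := by
      rw [hcon]
      push_cast
      linear_combination ((p : ℂ) * (τ : ℂ) ^ 2 + τ ^ 3 * Complex.I / 3) * Complex.I_sq
    rw [this, Complex.add_re, Complex.ofReal_re, Complex.re_ofReal_mul, Complex.I_re, mul_zero,
      add_zero]
  have hp0 : 0 ≤ p := by have := mul_nonneg h0 hq0; rw [hp]; nlinarith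
  have hp2 : p ^ 2 ≤ 9 + τ ^ 2 / 3 := by
    have h6 : p ^ 2 ≤ (1 - x) * 9 + x * q ^ 2 := by
      nlinarith [mul_nonneg (mul_nonneg h0 (sub_nonneg.2 h1)) (sq_nonneg (3 - q))]
    nlinarith [sq_nonneg q]
  have hm : p ^ 3 / 3 - p * τ ^ 2 ≤ p * (3 - 8 / 9 * τ ^ 2) := by
    nlinarith [mul_le_mul_of_nonneg_left hp2 hp0]
  rw [hre]
  refine hm.trans ?_
  rcases le_total τ 6 with h | h
  · have h7 : p ≤ 9 := by nlinarith
    nlinarith [mul_nonneg hp0 (sq_nonneg τ)]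
  · have h8 : 3 ≤ q := by rw [hq, le_div_iff₀ (by positivity)]; nlinarith
    have h9 : 3 ≤ p := by nlinarith
    nlinarith [mul_nonneg (sub_nonneg.2 h9) (show 0 ≤ 8 / 9 * τ ^ 2 - 3 by nlinarith)]

lemma norm_cubeFun_contour_le {k : ℕ} (hk : k ≤ 1) {x τ : ℝ} (hx : x ∈ Icc (0 : ℝ) 1)
    (hτ : 0 ≤ τ) : ‖cubeFun k (contour x τ)‖ ≤ (3 + 2 * τ) * Real.exp (200 - τ ^ 2) := by
  rw [cubeFun, norm_mul, norm_pow, Complex.norm_exp]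
  refine mul_le_mul ?_ (Real.exp_le_exp.2 (re_contour_cube_le hx hτ)) (Real.exp_pos _).le
    (by positivity)
  have h := norm_contour_le hx hτ
  interval_cases k
  · simp; linarith
  · simpa using h

lemma norm_cubeFun'_contour_le {k : ℕ} (hk : k ≤ 1) {x τ : ℝ} (hx : x ∈ Icc (0 : ℝ) 1)
    (hτ : 0 ≤ τ) : ‖cubeFun' k (contour x τ)‖ ≤ 2 * (3 + 2 * τ) ^ 3 * Real.exp (200 - τ ^ 2) := by
  rw [cubeFun', norm_mul, Complex.norm_exp]
  refine mul_le_mul ?_ (Real.exp_le_exp.2 (re_contour_cube_le hx hτ)) (Real.exp_pos _).le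
    (by positivity)
  have h := norm_contour_le hx hτ
  have h1 : (1 : ℝ) ≤ 3 + 2 * τ := by linarith
  refine (norm_add_le _ _).trans ?_
  have h2 : ‖contour x τ ^ (k + 2)‖ ≤ (3 + 2 * τ) ^ 3 := by
    rw [norm_pow]
    exact (pow_le_pow_left₀ (norm_nonneg _) h _).trans (pow_le_pow_right₀ h1 (by omega))
  have h3 : ‖(k : ℂ) * contour x τ ^ (k - 1)‖ ≤ 1 := by
    interval_cases k <;> simp
  have h4 := one_le_pow₀ h1 (n := 3)
  linarith

/-- The velocity of the contour in the deformation direction. -/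
def contourX (τ : ℝ) : ℂ := ((τ / √3 - 3 : ℝ) : ℂ)

/-- The velocity of the contour. -/
def contourT (x : ℝ) : ℂ := ((x / √3 : ℝ) : ℂ) + Complex.I

lemma hasDerivAt_contour_left (x τ : ℝ) :
    HasDerivAt (fun x => contour x τ) (contourX τ) x := by
  have h : HasDerivAt (fun x : ℝ => (1 - x) * 3 + x * τ / √3) (τ / √3 - 3) x := by
    refine ((((hasDerivAt_id x).const_sub 1).mul_const 3).add
      (((hasDerivAt_id x).mul_const τ).div_const √3)).congr_deriv ?_
    ring
  exact h.ofReal_comp.add_const _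

lemma hasDerivAt_contour_right (x τ : ℝ) :
    HasDerivAt (fun τ => contour x τ) (contourT x) τ := by
  have h : HasDerivAt (fun τ : ℝ => (1 - x) * 3 + x * τ / √3) (x / √3) τ := by
    refine ((((hasDerivAt_id τ).const_mul x).div_const √3).const_add _).congr_deriv ?_
    ring
  refine (h.ofReal_comp.add ((hasDerivAt_id (τ : ℂ)).comp_ofReal.mul_const Complex.I)).congr_deriv ?_
  simp [contourT]

lemma hasDerivAt_contourX (τ : ℝ) : HasDerivAt contourX ((1 / √3 : ℝ) : ℂ) τ :=
  (((hasDerivAt_id τ).div_const √3).sub_const 3).ofReal_comp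

lemma hasDerivAt_contourT (x : ℝ) : HasDerivAt contourT ((1 / √3 : ℝ) : ℂ) x :=
  ((hasDerivAt_id x).div_const √3).ofReal_comp.add_const _

lemma norm_contourX_le {τ : ℝ} (hτ : 0 ≤ τ) : ‖contourX τ‖ ≤ 3 + 2 * τ := by
  have h3 : 1 ≤ √3 := Real.one_le_sqrt.2 (by norm_num)
  have h4 : τ / √3 ≤ τ := div_le_self hτ h3
  have h5 : 0 ≤ τ / √3 := by positivity
  rw [contourX, Complex.norm_real, Real.norm_eq_abs, abs_le]
  constructor <;> linarith

lemma norm_contourT_le {x : ℝ} (hx : x ∈ Icc (0 : ℝ) 1) : ‖contourT x‖ ≤ 2 := by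
  have h3 : 1 ≤ √3 := Real.one_le_sqrt.2 (by norm_num)
  have h4 : x / √3 ≤ x := div_le_self hx.1 h3
  have h5 : 0 ≤ x / √3 := div_nonneg hx.1 (by positivity)
  refine (norm_add_le _ _).trans ?_
  rw [Complex.norm_real, Complex.norm_I, Real.norm_of_nonneg h5]
  linarith [hx.2]

lemma continuous_contour : Continuous fun q : ℝ × ℝ => contour q.1 q.2 := by
  unfold contour; fun_prop

lemma continuous_cubeFun (k : ℕ) : Continuous (cubeFun k) := by unfold cubeFun; fun_prop

lemma continuous_cubeFun' (k : ℕ) : Continuous (cubeFun' k) := by unfold cubeFun'; fun_prop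

lemma integrable_contour_dom :
    Integrable (fun τ : ℝ => 5 * (3 + 2 * τ) ^ 4 * Real.exp (200 - τ ^ 2)) := by
  have h := (((((integrable_pow_mul_gauss 0).const_mul 405).add
    ((integrable_pow_mul_gauss 1).const_mul 1080)).add
    ((integrable_pow_mul_gauss 2).const_mul 1080)).add
    ((integrable_pow_mul_gauss 3).const_mul 480)).add
    ((integrable_pow_mul_gauss 4).const_mul 80) |>.mul_const (Real.exp 200)
  refine h.congr (Eventually.of_forall fun τ => ?_)
  simp only [Pi.add_apply]
  rw [sub_eq_neg_add, Real.exp_add]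
  ring

/-- The integral over the deformed half contour. -/
def halfInt (k : ℕ) (x : ℝ) : ℂ := ∫ τ in Ioi (0 : ℝ), cubeFun k (contour x τ) * contourT x

lemma norm_halfInt_integrand_le {k : ℕ} (hk : k ≤ 1) {x τ : ℝ} (hx : x ∈ Icc (0 : ℝ) 1)
    (hτ : 0 ≤ τ) : ‖cubeFun k (contour x τ) * contourT x‖ ≤
      5 * (3 + 2 * τ) ^ 4 * Real.exp (200 - τ ^ 2) := by
  rw [norm_mul]
  refine (mul_le_mul (norm_cubeFun_contour_le hk hx hτ) (norm_contourT_le hx) (norm_nonneg _)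
    (by positivity)).trans ?_
  have h1 : (1 : ℝ) ≤ 3 + 2 * τ := by linarith
  have h2 : 3 + 2 * τ ≤ (3 + 2 * τ) ^ 4 := le_self_pow₀ h1 (by norm_num)
  have h3 := mul_le_mul_of_nonneg_right h2 (Real.exp_pos (200 - τ ^ 2)).le
  nlinarith [mul_nonneg (show (0 : ℝ) ≤ 3 + 2 * τ by linarith) (Real.exp_pos (200 - τ ^ 2)).le]

lemma norm_halfInt_deriv_integrand_le {k : ℕ} (hk : k ≤ 1) {x τ : ℝ} (hx : x ∈ Icc (0 : ℝ) 1)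
    (hτ : 0 ≤ τ) : ‖cubeFun' k (contour x τ) * contourX τ * contourT x +
      cubeFun k (contour x τ) * ((1 / √3 : ℝ) : ℂ)‖ ≤
      5 * (3 + 2 * τ) ^ 4 * Real.exp (200 - τ ^ 2) := by
  have h1 : (1 : ℝ) ≤ 3 + 2 * τ := by linarith
  have h2 : 3 + 2 * τ ≤ (3 + 2 * τ) ^ 4 := le_self_pow₀ h1 (by norm_num)
  have he := Real.exp_pos (200 - τ ^ 2)
  have h3 := mul_le_mul_of_nonneg_right h2 he.le
  refine (norm_add_le _ _).trans ?_
  rw [norm_mul, norm_mul, norm_mul]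
  have h4 := mul_le_mul (mul_le_mul (norm_cubeFun'_contour_le hk hx hτ) (norm_contourX_le hτ)
    (norm_nonneg _) (by positivity)) (norm_contourT_le hx) (norm_nonneg _) (by positivity)
  have h5 : ‖((1 / √3 : ℝ) : ℂ)‖ ≤ 1 := by
    rw [Complex.norm_real, Real.norm_of_nonneg (by positivity), div_le_one (by positivity)]
    exact Real.one_le_sqrt.2 (by norm_num)
  have h6 := mul_le_mul (norm_cubeFun_contour_le hk hx hτ) h5 (norm_nonneg _) (by positivity)
  nlinarith

lemma hasDerivAt_halfInt {k : ℕ} (hk : k ≤ 1) {x : ℝ} (hx : x ∈ Ioo (0 : ℝ) 1) :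
    HasDerivAt (halfInt k) (3 * cubeFun k (contour x 0)) x := by
  have hx' : x ∈ Icc (0 : ℝ) 1 := ⟨hx.1.le, hx.2.le⟩
  have hcx : Continuous contourX := continuous_iff_continuousAt.2 fun τ =>
    (hasDerivAt_contourX τ).continuousAt
  have hct : ∀ x, Continuous fun τ => contour x τ := fun x =>
    continuous_contour.comp (show Continuous fun τ : ℝ => (x, τ) by fun_prop)
  have h := hasDerivAt_integral_of_dominated_loc_of_deriv_le
    (μ := (volume : Measure ℝ).restrict (Ioi 0))
    (F := fun (x : ℝ) (τ : ℝ) => cubeFun k (contour x τ) * contourT x)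
    (F' := fun (x : ℝ) (τ : ℝ) => cubeFun' k (contour x τ) * contourX τ * contourT x +
      cubeFun k (contour x τ) * ((1 / √3 : ℝ) : ℂ))
    (x₀ := x) (Ioo_mem_nhds hx.1 hx.2)
    (bound := fun τ => 5 * (3 + 2 * τ) ^ 4 * Real.exp (200 - τ ^ 2))
    (Eventually.of_forall fun x =>
      (((continuous_cubeFun k).comp (hct x)).mul continuous_const).aestronglyMeasurable)
    (integrable_contour_dom.integrableOn.mono'
      (((continuous_cubeFun k).comp (hct x)).mul continuous_const).aestronglyMeasurable
      ((ae_restrict_iff' measurableSet_Ioi).2 (Eventually.of_forall fun τ hτ =>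
        norm_halfInt_integrand_le hk hx' (le_of_lt hτ))))
    (((((continuous_cubeFun' k).comp (hct x)).mul hcx).mul continuous_const).add
      (((continuous_cubeFun k).comp (hct x)).mul continuous_const)).aestronglyMeasurable
    ((ae_restrict_iff' measurableSet_Ioi).2 (Eventually.of_forall fun τ hτ y hy =>
      norm_halfInt_deriv_integrand_le hk ⟨hy.1.le, hy.2.le⟩ (le_of_lt hτ)))
    integrable_contour_dom.integrableOn
    (Eventually.of_forall fun τ y _ =>
      ((hasDerivAt_cubeFun k _).comp y (hasDerivAt_contour_left y τ)).mul (hasDerivAt_contourT y))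
  refine h.2.congr_deriv ?_
  have hlim : Tendsto (fun τ => cubeFun k (contour x τ) * contourX τ) atTop (𝓝 0) := by
    have h9 : Tendsto (fun τ : ℝ => (3 + 2 * τ) ^ 2 * Real.exp (200 - τ ^ 2)) atTop (𝓝 0) := by
      have h1 : Tendsto (fun τ : ℝ => (3 + 2 * τ) ^ 2 * Real.exp (-τ)) atTop (𝓝 0) := by
        have h2 := (((Real.tendsto_pow_mul_exp_neg_atTop_nhds_zero 0).const_mul 9).add
          ((Real.tendsto_pow_mul_exp_neg_atTop_nhds_zero 1).const_mul 12)).add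
          ((Real.tendsto_pow_mul_exp_neg_atTop_nhds_zero 2).const_mul 4)
        simp only [mul_zero, add_zero] at h2
        refine h2.congr fun τ => ?_
        ring
      have h3 := h1.const_mul (Real.exp 200)
      rw [mul_zero] at h3
      refine squeeze_zero' (Eventually.of_forall fun τ => by positivity) ?_ h3
      filter_upwards [eventually_ge_atTop 1] with τ hτ
      rw [mul_left_comm, ← Real.exp_add]
      exact mul_le_mul_of_nonneg_left (Real.exp_le_exp.2 (by nlinarith)) (by positivity)
    refine squeeze_zero_norm' ?_ h9
    filter_upwards [eventually_ge_atTop 0] with τ hτ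
    rw [norm_mul]
    refine (mul_le_mul (norm_cubeFun_contour_le hk hx' hτ) (norm_contourX_le hτ) (norm_nonneg _)
      (by positivity)).trans (le_of_eq (by ring))
  have hd : ∀ τ : ℝ, HasDerivAt (fun τ => cubeFun k (contour x τ) * contourX τ)
      (cubeFun' k (contour x τ) * contourX τ * contourT x +
      cubeFun k (contour x τ) * ((1 / √3 : ℝ) : ℂ)) τ := fun τ => by
    refine (((hasDerivAt_cubeFun k _).comp τ (hasDerivAt_contour_right x τ)).mul
      (hasDerivAt_contourX τ)).congr_deriv ?_
    simp only [Function.comp]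
    ring
  rw [integral_Ioi_of_hasDerivAt_of_tendsto (hd 0).continuousAt.continuousWithinAt
    (fun τ _ => hd τ) h.1 hlim]
  simp [contourX]
  ring

lemma continuousOn_halfInt {k : ℕ} (hk : k ≤ 1) : ContinuousOn (halfInt k) (Icc 0 1) := by
  intro x _
  have hct : ∀ x, Continuous fun τ => contour x τ := fun x =>
    continuous_contour.comp (show Continuous fun τ : ℝ => (x, τ) by fun_prop)
  refine continuousWithinAt_of_dominated
    (bound := fun τ => 5 * (3 + 2 * τ) ^ 4 * Real.exp (200 - τ ^ 2))
    (Eventually.of_forall fun x =>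
      (((continuous_cubeFun k).comp (hct x)).mul continuous_const).aestronglyMeasurable)
    ?_ integrable_contour_dom.integrableOn ?_
  · filter_upwards [self_mem_nhdsWithin] with y hy
    exact (ae_restrict_iff' measurableSet_Ioi).2 (Eventually.of_forall fun τ hτ =>
      norm_halfInt_integrand_le hk hy (le_of_lt hτ))
  · refine Eventually.of_forall fun τ => Continuous.continuousWithinAt ?_
    have h1 : Continuous fun x => contour x τ :=
      continuous_contour.comp (show Continuous fun x : ℝ => (x, τ) by fun_prop)
    have h2 : Continuous contourT := continuous_iff_continuousAt.2 fun x =>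
      (hasDerivAt_contourT x).continuousAt
    exact ((continuous_cubeFun k).comp h1).mul h2

lemma im_halfInt_eq {k : ℕ} (hk : k ≤ 1) : (halfInt k 1).im = (halfInt k 0).im := by
  have hd : ∀ x ∈ Ioo (0 : ℝ) 1, HasDerivAt (fun x => (halfInt k x).im) 0 x := fun x hx => by
    have h := Complex.imCLM.hasFDerivAt.comp_hasDerivAt x (hasDerivAt_halfInt hk hx)
    refine h.congr_deriv ?_
    have h1 : contour x 0 = (((1 - x) * 3 : ℝ) : ℂ) := by simp [contour]
    have h2 : 3 * cubeFun k (contour x 0) =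
        ((3 * (((1 - x) * 3) ^ k * Real.exp (((1 - x) * 3) ^ 3 / 3)) : ℝ) : ℂ) := by
      rw [h1, cubeFun]; push_cast; ring
    rw [h2, Complex.imCLM_apply, Complex.ofReal_im]
  obtain ⟨c, _, hc⟩ := exists_hasDerivAt_eq_slope (fun x => (halfInt k x).im) (fun _ => 0)
    zero_lt_one (Complex.continuous_im.comp_continuousOn (continuousOn_halfInt hk)) hd
  simp only [sub_zero, div_one] at hc
  linarith

lemma airyD_at_zero (k : ℕ) :
    airyD k 0 = (((-1) ^ k * (2 * (halfInt k 0).im) : ℝ) : ℂ) := by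
  set J : ℂ := ∫ τ in Ioi (0 : ℝ), cubeFun k ((3 : ℝ) + τ * Complex.I) with hJ
  have hc : Continuous fun τ : ℝ => cubeFun k ((3 : ℝ) + τ * Complex.I) :=
    (continuous_cubeFun k).comp (by fun_prop)
  have hi : Integrable fun τ : ℝ => cubeFun k ((3 : ℝ) + τ * Complex.I) := by
    refine ((integrable_airyD_integrand k 0).const_mul ((-1) ^ k)).congr
      (Eventually.of_forall fun τ => ?_)
    beta_reduce
    rw [cubeFun, Complex.ofReal_zero, mul_zero, neg_zero, Complex.exp_zero, mul_one, ← mul_assoc,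
      ← mul_pow, neg_one_mul, neg_neg]
  have h1 : airyD k 0 = (-1) ^ k * ∫ τ : ℝ, cubeFun k ((3 : ℝ) + τ * Complex.I) := by
    rw [← integral_const_mul, airyD]
    refine integral_congr_ae (Eventually.of_forall fun τ => ?_)
    beta_reduce
    rw [cubeFun, Complex.ofReal_zero, mul_zero, neg_zero, Complex.exp_zero, mul_one, ← mul_assoc,
      ← mul_pow, neg_one_mul]
  have h2 : (∫ τ : ℝ, cubeFun k ((3 : ℝ) + τ * Complex.I)) = (starRingEnd ℂ) J + J := by
    rw [← intervalIntegral.integral_Iic_add_Ioi (b := 0) hi.integrableOn hi.integrableOn,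
      hJ, ← integral_conj]
    congr 1
    have h3 := integral_comp_neg_Ioi (0 : ℝ) (fun τ : ℝ => cubeFun k ((3 : ℝ) + τ * Complex.I))
    rw [neg_zero] at h3
    rw [← h3]
    refine integral_congr_ae (Eventually.of_forall fun τ => ?_)
    simp only [cubeFun, map_mul, map_pow, map_add, Complex.conj_ofReal, Complex.conj_I,
      ← Complex.exp_conj, map_div₀, map_ofNat]
    push_cast
    ring_nf
  have h3 : halfInt k 0 = J * Complex.I := by
    rw [halfInt, hJ, ← integral_mul_const]
    refine integral_congr_ae (Eventually.of_forall fun τ => ?_)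
    simp [contour, contourT]
  rw [h1, h2, h3, add_comm, Complex.add_conj]
  simp

lemma contourT_one_cube : contourT 1 ^ 3 = ((-(8 / (3 * √3)) : ℝ) : ℂ) := by
  have hs3 : √3 ^ 2 = 3 := Real.sq_sqrt (by norm_num)
  have hs0 : √3 ≠ 0 := by positivity
  have hsc : (√3 : ℂ) ^ 2 = 3 := by exact_mod_cast hs3
  have hsc0 : (√3 : ℂ) ≠ 0 := by exact_mod_cast hs0
  rw [contourT]
  push_cast
  field_simp
  linear_combination (9 * (√3 : ℂ) ^ 2 + 3 * (√3 : ℂ) ^ 3 * Complex.I) * Complex.I_sq +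
    (-1 - 3 * (√3 : ℂ) * Complex.I) * hsc

lemma halfInt_one (k : ℕ) : halfInt k 1 = contourT 1 ^ (k + 1) *
    ((((8 / (9 * √3)) ^ (-((k : ℝ) + 1) / 3) * (1 / 3) * Real.Gamma (((k : ℝ) + 1) / 3) : ℝ)) : ℂ) := by
  have h := integral_rpow_mul_exp_neg_mul_rpow (p := 3) (q := k) (b := 8 / (9 * √3)) (by norm_num)
    (by have : (0 : ℝ) ≤ k := k.cast_nonneg
        linarith) (by positivity)
  rw [← h, ← integral_complex_ofReal, halfInt, ← integral_const_mul]
  refine setIntegral_congr_fun measurableSet_Ioi fun τ _ => ?_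
  have h1 : contour 1 τ = τ * contourT 1 := by
    rw [contour, contourT]; push_cast; ring
  have h2 : (τ * contourT 1) ^ 3 / 3 = ((-(8 / (9 * √3)) * τ ^ 3 : ℝ) : ℂ) := by
    rw [mul_pow, contourT_one_cube]
    push_cast
    have hsc0 : (√3 : ℂ) ≠ 0 := by
      have : √3 ≠ 0 := by positivity
      exact_mod_cast this
    field_simp
    norm_num
  have h3 : τ ^ (3 : ℝ) = τ ^ 3 := by exact_mod_cast Real.rpow_natCast τ 3
  rw [cubeFun, h1, h2, h3, Real.rpow_natCast, ← Complex.ofReal_exp]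
  push_cast
  ring

lemma contourT_base_rpow (x : ℝ) : (8 / (9 * √3)) ^ (-x / 3) = 2 ^ (-x) * (3 : ℝ) ^ (5 / 6 * x) := by
  have h : 8 / (9 * √3) = (2 : ℝ) ^ (3 : ℝ) * (3 : ℝ) ^ (-(5 / 2) : ℝ) := by
    rw [Real.sqrt_eq_rpow, Real.rpow_neg (by norm_num), show (5 / 2 : ℝ) = 2 + 1 / 2 by norm_num,
      Real.rpow_add (by norm_num), div_eq_mul_inv]
    norm_num
  rw [h, Real.mul_rpow (by positivity) (by positivity), ← Real.rpow_mul (by norm_num),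
    ← Real.rpow_mul (by norm_num)]
  congr 2 <;> ring

lemma gamma_third_mul : Real.Gamma (1 / 3) * Real.Gamma (2 / 3) = 2 * Real.pi / √3 := by
  have h := Real.Gamma_mul_Gamma_one_sub (1 / 3)
  rw [show (1 : ℝ) - 1 / 3 = 2 / 3 by norm_num, show Real.pi * (1 / 3) = Real.pi / 3 by ring,
    Real.sin_pi_div_three] at h
  rw [h]
  field_simp

lemma airyD_zero_zero : airyD 0 0 =
    ((2 * Real.pi * ((3 : ℝ) ^ (-(2 : ℝ) / 3) / Real.Gamma (2 / 3)) : ℝ) : ℂ) := by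
  rw [airyD_at_zero, ← im_halfInt_eq (by norm_num), halfInt_one]
  congr 1
  have hG := gamma_third_mul
  have hp : 0 < Real.Gamma (2 / 3) := Real.Gamma_pos_of_pos (by norm_num)
  have h1 : (contourT 1 ^ (0 + 1)).im = 1 := by simp [contourT]
  rw [Complex.im_mul_ofReal, h1, contourT_base_rpow]
  have h2 : (3 : ℝ) ^ (5 / 6 * (((0 : ℕ) : ℝ) + 1)) = 3 * √3 * (3 : ℝ) ^ (-(2 : ℝ) / 3) := by
    rw [Real.sqrt_eq_rpow]
    nth_rw 2 [← Real.rpow_one 3]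
    rw [← Real.rpow_add (by norm_num), ← Real.rpow_add (by norm_num)]
    norm_num
  have h3 : (2 : ℝ) ^ (-(((0 : ℕ) : ℝ) + 1)) = 1 / 2 := by
    rw [Real.rpow_neg (by norm_num)]; norm_num
  rw [h2, h3]
  have h4 : (((0 : ℕ) : ℝ) + 1) / 3 = 1 / 3 := by norm_num
  rw [h4]
  have hs3 : √3 ≠ 0 := by positivity
  field_simp at hG ⊢
  linear_combination hG

lemma airyD_one_zero : airyD 1 0 =
    ((2 * Real.pi * (-((3 : ℝ) ^ (-(1 : ℝ) / 3)) / Real.Gamma (1 / 3)) : ℝ) : ℂ) := by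
  rw [airyD_at_zero, ← im_halfInt_eq (by norm_num), halfInt_one]
  congr 1
  have hG := gamma_third_mul
  have hp : 0 < Real.Gamma (1 / 3) := Real.Gamma_pos_of_pos (by norm_num)
  have hs2 : √3 ^ 2 = 3 := Real.sq_sqrt (by norm_num)
  have hs3 : √3 ≠ 0 := by positivity
  have h1 : (contourT 1 ^ (1 + 1)).im = 2 / √3 := by
    rw [one_add_one_eq_two, sq, Complex.mul_im, contourT]
    simp
    field_simp
    norm_num
  rw [Complex.im_mul_ofReal, h1, contourT_base_rpow]
  have h2 : (3 : ℝ) ^ (5 / 6 * (((1 : ℕ) : ℝ) + 1)) = 3 * 3 * (3 : ℝ) ^ (-(1 : ℝ) / 3) := by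
    nth_rw 2 3 [← Real.rpow_one 3]
    rw [← Real.rpow_add (by norm_num), ← Real.rpow_add (by norm_num)]
    norm_num
  have h3 : (2 : ℝ) ^ (-(((1 : ℕ) : ℝ) + 1)) = 1 / 4 := by
    rw [Real.rpow_neg (by norm_num)]; norm_num
  rw [h2, h3]
  have h4 : (((1 : ℕ) : ℝ) + 1) / 3 = 2 / 3 := by norm_num
  rw [h4]
  field_simp at hG ⊢
  linear_combination (-2 * √3) * hG + (2 * Real.Gamma (1 / 3) * Real.Gamma (2 / 3)) * hs2

/-! ### Identification of the Airy function -/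

lemma airy_ode_unique {f f' g g' : ℝ → ℂ} (hf : ∀ x, HasDerivAt f (f' x) x)
    (hf' : ∀ x, HasDerivAt f' (x * f x) x) (hg : ∀ x, HasDerivAt g (g' x) x)
    (hg' : ∀ x, HasDerivAt g' (x * g x) x) {x₀ : ℝ} (h₀ : f x₀ = g x₀) (h₁ : f' x₀ = g' x₀)
    (s : ℝ) : f s = g s ∧ f' s = g' s := by
  set M : ℝ := |s| + |x₀| + 1 with hM
  have hs0 := abs_nonneg s
  have hx0 := abs_nonneg x₀
  have hx1 := abs_le.1 (le_refl |x₀|)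
  have hlip : ∀ x ∈ Ioo (-M) M, LipschitzOnWith (Real.toNNReal M)
      (fun p : ℂ × ℂ => (p.2, (x : ℂ) * p.1)) univ := fun x hx => by
    refine LipschitzOnWith.of_dist_le_mul fun p _ q _ => ?_
    rw [Real.coe_toNNReal _ (by linarith), Prod.dist_eq, Prod.dist_eq, max_le_iff]
    have h1 := le_max_left (dist p.1 q.1) (dist p.2 q.2)
    have h2 := le_max_right (dist p.1 q.1) (dist p.2 q.2)
    have h0 : 0 ≤ dist p.2 q.2 := dist_nonneg
    have h0' : 0 ≤ dist p.1 q.1 := dist_nonneg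
    constructor
    · simp only; nlinarith
    · simp only
      rw [dist_eq_norm, ← mul_sub, norm_mul, ← dist_eq_norm, Complex.norm_real, Real.norm_eq_abs]
      have : |x| ≤ M := abs_le.2 ⟨hx.1.le, hx.2.le⟩
      exact mul_le_mul this h1 h0' (by linarith)
  have hF : ∀ x : ℝ, HasDerivAt (fun x => (f x, f' x)) (f' x, (x : ℂ) * f x) x :=
    fun x => (hf x).prodMk (hf' x)
  have hG : ∀ x : ℝ, HasDerivAt (fun x => (g x, g' x)) (g' x, (x : ℂ) * g x) x :=
    fun x => (hg x).prodMk (hg' x)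
  have h := ODE_solution_unique_of_mem_Icc (v := fun x p => (p.2, (x : ℂ) * p.1))
    (s := fun _ => univ) (t₀ := x₀) hlip ⟨by linarith, by linarith⟩
    (fun x _ => (hF x).continuousAt.continuousWithinAt) (fun x _ => hF x) (fun _ _ => mem_univ _)
    (fun x _ => (hG x).continuousAt.continuousWithinAt) (fun x _ => hG x) (fun _ _ => mem_univ _)
    (by rw [h₀, h₁])
    (show s ∈ Icc (-M) M from abs_le.1 (by linarith))
  exact ⟨congrArg Prod.fst h, congrArg Prod.snd h⟩

theorem airyD_eq {A A' : ℝ → ℝ} (hA : IsAiry A A') (s : ℝ) :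
    airyD 0 s = 2 * Real.pi * (A s : ℂ) ∧ airyD 1 s = 2 * Real.pi * (A' s : ℂ) := by
  obtain ⟨hd1, hd2, h00, h01⟩ := hA
  refine airy_ode_unique (x₀ := 0) (g := fun x => 2 * Real.pi * (A x : ℂ))
    (g' := fun x => 2 * Real.pi * (A' x : ℂ)) (hasDerivAt_airyD 0) (fun x => ?_)
    (fun x => (hd1 x).ofReal_comp.const_mul (2 * Real.pi : ℂ)) (fun x => ?_) ?_ ?_ s
  · rw [← airyD_two]; exact hasDerivAt_airyD 1 x
  · refine ((hd2 x).ofReal_comp.const_mul (2 * Real.pi : ℂ)).congr_deriv ?_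
    push_cast; ring
  · rw [airyD_zero_zero, h00]; push_cast; rfl
  · rw [airyD_one_zero, h01]; push_cast; rfl

lemma airyMass_nonneg (k : ℕ) : 0 ≤ airyMass k := integral_nonneg fun _ => by positivity

lemma abs_airy_le {A A' : ℝ → ℝ} (hA : IsAiry A A') (s : ℝ) :
    |A s| ≤ airyMass 0 * Real.exp (-(3 * s)) ∧ |A' s| ≤ airyMass 1 * Real.exp (-(3 * s)) := by
  have key : ∀ {x : ℝ} {z : ℂ} {M : ℝ}, z = 2 * Real.pi * (x : ℂ) → ‖z‖ ≤ M → |x| ≤ M := by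
    intro x z M hz hM
    refine le_trans ?_ hM
    rw [hz, norm_mul, Complex.norm_real, Real.norm_eq_abs, norm_mul, Complex.norm_real,
      Real.norm_of_nonneg Real.pi_pos.le, Complex.norm_ofNat]
    nlinarith [abs_nonneg x, Real.pi_gt_three]
  exact ⟨key (airyD_eq hA s).1 (norm_airyD_le 0 s), key (airyD_eq hA s).2 (norm_airyD_le 1 s)⟩

lemma tendsto_airy_mul {A A' : ℝ → ℝ} (hA : IsAiry A A') :
    Tendsto (fun x => A x * A' x) atTop (𝓝 0) := by
  have h1 : Tendsto (fun x : ℝ => airyMass 0 * airyMass 1 * Real.exp (-x)) atTop (𝓝 0) := by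
    have := (Real.tendsto_exp_neg_atTop_nhds_zero).const_mul (airyMass 0 * airyMass 1)
    rwa [mul_zero] at this
  refine squeeze_zero_norm' ?_ h1
  filter_upwards [eventually_ge_atTop 0] with x hx
  obtain ⟨h2, h3⟩ := abs_airy_le hA x
  have h4 : Real.exp (-(3 * x)) * Real.exp (-(3 * x)) ≤ Real.exp (-x) := by
    rw [← Real.exp_add]; exact Real.exp_le_exp.2 (by linarith)
  have h5 := airyMass_nonneg 0
  have h6 := airyMass_nonneg 1
  rw [Real.norm_eq_abs, abs_mul]
  calc |A x| * |A' x| ≤ (airyMass 0 * Real.exp (-(3 * x))) * (airyMass 1 * Real.exp (-(3 * x))) :=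
        mul_le_mul h2 h3 (abs_nonneg _) (by positivity)
    _ = airyMass 0 * airyMass 1 * (Real.exp (-(3 * x)) * Real.exp (-(3 * x))) := by ring
    _ ≤ _ := by gcongr

lemma airy_mul_nonpos {A A' : ℝ → ℝ} (hA : IsAiry A A') {x : ℝ} (hx : 0 ≤ x) :
    A x * A' x ≤ 0 := by
  obtain ⟨hd1, hd2, -, -⟩ := id hA
  have hd : ∀ y, HasDerivAt (fun x => A x * A' x) (A' y * A' y + A y * (y * A y)) y :=
    fun y => (hd1 y).mul (hd2 y)
  have hmono : MonotoneOn (fun x => A x * A' x) (Ici 0) := by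
    refine monotoneOn_of_deriv_nonneg (convex_Ici 0)
      (fun y _ => (hd y).continuousAt.continuousWithinAt)
      (fun y _ => (hd y).differentiableAt.differentiableWithinAt) fun y hy => ?_
    rw [interior_Ici] at hy
    rw [(hd y).deriv]
    nlinarith [mul_self_nonneg (A' y), mul_nonneg (mem_Ioi.1 hy).le (mul_self_nonneg (A y))]
  refine ge_of_tendsto (tendsto_airy_mul hA) ?_
  filter_upwards [eventually_ge_atTop x] with y hy
  exact hmono hx (hx.trans hy) hy

lemma airy_sq_antitone {A A' : ℝ → ℝ} (hA : IsAiry A A') :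
    AntitoneOn (fun x => A x * A x) (Ici 0) := by
  obtain ⟨hd1, hd2, -, -⟩ := id hA
  have hd : ∀ y, HasDerivAt (fun x => A x * A x) (A' y * A y + A y * A' y) y :=
    fun y => (hd1 y).mul (hd1 y)
  refine antitoneOn_of_deriv_nonpos (convex_Ici 0)
      (fun y _ => (hd y).continuousAt.continuousWithinAt)
      (fun y _ => (hd y).differentiableAt.differentiableWithinAt) fun y hy => ?_
  rw [interior_Ici] at hy
  rw [(hd y).deriv]
  linarith [airy_mul_nonpos hA (mem_Ioi.1 hy).le]

lemma abs_airy_antitone {A A' : ℝ → ℝ} (hA : IsAiry A A') {x y : ℝ} (hx : 0 ≤ x) (hxy : x ≤ y) :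
    |A y| ≤ |A x| :=
  abs_le_iff_mul_self_le.2 (airy_sq_antitone hA hx (hx.trans hxy) hxy)

lemma airy_ne_zero {A A' : ℝ → ℝ} (hA : IsAiry A A') {x : ℝ} (hx : 0 ≤ x) : A x ≠ 0 := by
  intro h0
  obtain ⟨hd1, hd2, h00, -⟩ := id hA
  have hz : ∀ y ∈ Ici x, A y = 0 := fun y hy => by
    have := abs_airy_antitone hA hx hy
    rw [h0, abs_zero] at this
    exact abs_nonpos_iff.1 this
  have h1 : A' (x + 1) = 0 := by
    have h2 : A =ᶠ[𝓝 (x + 1)] fun _ => 0 := by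
      filter_upwards [Ioi_mem_nhds (show x < x + 1 by linarith)] with y hy
      exact hz y (mem_Ioi.1 hy).le
    exact (hd1 (x + 1)).unique ((hasDerivAt_const (x + 1) (0 : ℝ)).congr_of_eventuallyEq h2)
  have h2 := (airy_ode_unique (f := fun x => (A x : ℂ)) (f' := fun x => (A' x : ℂ))
    (g := fun _ => 0) (g' := fun _ => 0) (x₀ := x + 1) (fun y => (hd1 y).ofReal_comp)
    (fun y => by simpa using (hd2 y).ofReal_comp) (fun y => hasDerivAt_const y 0)
    (fun y => by simpa using hasDerivAt_const y (0 : ℂ))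
    (by simpa using hz _ (show x ≤ x + 1 by linarith)) (by simpa using h1) 0).1
  have h3 : A 0 = 0 := by exact_mod_cast h2
  have h4 : 0 < Real.Gamma (2 / 3) := Real.Gamma_pos_of_pos (by norm_num)
  have h5 : 0 < A 0 := by rw [h00]; positivity
  exact h5.ne' h3

/-! ### Finite-rank projections on a half-line -/

lemma integrableOn_of_exp_bound {E : Type*} [NormedAddCommGroup E] {f : ℝ → E} {t C a : ℝ}
    (hf : Continuous f) (ha : 0 < a) (h : ∀ x, t ≤ x → ‖f x‖ ≤ C * Real.exp (-(a * x))) :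
    IntegrableOn f (Ioi t) := by
  have h1 : IntegrableOn (fun x => C * Real.exp (-(a * x))) (Ioi t) := by
    have := (integrableOn_exp_mul_Ioi (neg_lt_zero.2 ha) t).const_mul C
    simp only [neg_mul] at this
    exact this
  exact h1.mono' hf.aestronglyMeasurable
    ((ae_restrict_mem measurableSet_Ioi).mono fun x hx => h x (mem_Ioi.1 hx).le)

lemma integral_exp_neg_two_mul (t : ℝ) :
    ∫ x in Ioi t, Real.exp (-(2 * x)) = Real.exp (-(2 * t)) / 2 := by
  have h := integral_exp_mul_Ioi (a := -2) (by norm_num) t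
  simp only [neg_mul] at h
  rw [h]
  ring

lemma norm_setIntegral_le_exp {E : Type*} [NormedAddCommGroup E] [NormedSpace ℝ E] {f : ℝ → E}
    {t C : ℝ} (h : ∀ x, t ≤ x → ‖f x‖ ≤ C * Real.exp (-(2 * x))) :
    ‖∫ x in Ioi t, f x‖ ≤ C * (Real.exp (-(2 * t)) / 2) := by
  rw [← integral_exp_neg_two_mul, ← integral_const_mul]
  refine norm_integral_le_of_norm_le ?_
    ((ae_restrict_mem measurableSet_Ioi).mono fun x hx => h x (mem_Ioi.1 hx).le)
  have := (integrableOn_exp_mul_Ioi (show (-2 : ℝ) < 0 by norm_num) t).const_mul C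
  simpa only [neg_mul] using this

lemma exp_neg_mul_exp_neg (x : ℝ) : Real.exp (-x) * Real.exp (-x) = Real.exp (-(2 * x)) := by
  rw [← Real.exp_add]; congr 1; ring

lemma inner_toLp {f g : ℝ → ℂ} (hf : MemLp f 2) (hg : MemLp g 2) :
    inner ℂ (hf.toLp f) (hg.toLp g) = ∫ x, (starRingEnd ℂ) (f x) * g x := by
  rw [L2.inner_def]
  refine integral_congr_ae ?_
  filter_upwards [hf.coeFn_toLp, hg.coeFn_toLp] with x h1 h2
  rw [h1, h2, RCLike.inner_apply, mul_comm]

lemma bessel {φ : ℕ → ℝ → ℝ} (hc : ∀ k, Continuous (φ k))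
    (hi : ∀ j k, Integrable fun x => φ j x * φ k x)
    (ho : ∀ j k, ∫ x, φ j x * φ k x = if j = k then 1 else 0) {f : ℝ → ℂ} (hf : Continuous f)
    {t : ℝ} (hf2 : IntegrableOn (fun x => ‖f x‖ ^ 2) (Ioi t)) (n : ℕ) :
    ∑ k ∈ Finset.range n, ‖∫ x in Ioi t, (φ k x : ℂ) * f x‖ ^ 2 ≤ ∫ x in Ioi t, ‖f x‖ ^ 2 := by
  have hφ : ∀ k, MemLp (fun x => (φ k x : ℂ)) 2 := fun k => by
    have hm : Continuous fun x => (φ k x : ℂ) := Complex.continuous_ofReal.comp (hc k)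
    rw [memLp_two_iff_integrable_sq_norm hm.aestronglyMeasurable]
    refine (hi k k).congr (Eventually.of_forall fun x => ?_)
    simp [sq]
  have hF : MemLp ((Ioi t).indicator f) 2 := by
    rw [memLp_indicator_iff_restrict measurableSet_Ioi,
      memLp_two_iff_integrable_sq_norm hf.aestronglyMeasurable]
    exact hf2
  have hon : Orthonormal ℂ fun k => (hφ k).toLp _ := by
    rw [orthonormal_iff_ite]
    intro j k
    rw [inner_toLp]
    have : ∀ x, (starRingEnd ℂ) (φ j x : ℂ) * (φ k x : ℂ) = ((φ j x * φ k x : ℝ) : ℂ) :=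
      fun x => by rw [Complex.conj_ofReal]; push_cast; rfl
    simp only [this]
    rw [integral_complex_ofReal, ho]
    split_ifs <;> simp
  have h := hon.sum_inner_products_le (x := hF.toLp _) (s := Finset.range n)
  have h2 : ‖hF.toLp _‖ ^ 2 = ∫ x in Ioi t, ‖f x‖ ^ 2 := by
    have h3 : ((‖hF.toLp _‖ ^ 2 : ℝ) : ℂ) = ((∫ x in Ioi t, ‖f x‖ ^ 2 : ℝ) : ℂ) := by
      have h4 := inner_self_eq_norm_sq_to_K (𝕜 := ℂ) (hF.toLp _)
      rw [inner_toLp] at h4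
      rw [Complex.ofReal_pow]
      refine h4.symm.trans ?_
      rw [← integral_complex_ofReal, ← integral_indicator measurableSet_Ioi]
      congr 1
      ext x
      by_cases hx : x ∈ Ioi t
      · simp only [indicator_of_mem hx]
        rw [Complex.conj_mul']; push_cast; rfl
      · simp [indicator_of_notMem hx]
    exact_mod_cast h3
  rw [h2] at h
  refine le_trans (le_of_eq ?_) h
  refine Finset.sum_congr rfl fun k _ => ?_
  rw [inner_toLp, ← integral_indicator measurableSet_Ioi]
  congr 3
  ext x
  by_cases hx : x ∈ Ioi t
  · simp [indicator_of_mem hx]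
  · simp [indicator_of_notMem hx]

/-- The finite-rank kernel spanned by `φ 0, …, φ (n - 1)`. -/
def rankKer (φ : ℕ → ℝ → ℝ) (n : ℕ) (x y : ℝ) : ℝ := ∑ k ∈ Finset.range n, φ k x * φ k y

lemma stability {φ : ℕ → ℝ → ℝ} (hc : ∀ k, Continuous (φ k))
    (hi : ∀ j k, Integrable fun x => φ j x * φ k x)
    (ho : ∀ j k, ∫ x, φ j x * φ k x = if j = k then 1 else 0) {n : ℕ} {f : ℝ → ℂ}
    (hf : Continuous f) {κ2 : ℂ} {t c M ε : ℝ} (hc0 : 0 < c)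
    (hκ : ∀ r ∈ Icc (0 : ℝ) 1, c ≤ ‖1 - κ2 * r‖)
    (hif : IntegrableOn (fun y => ‖f y‖ ^ 2) (Ioi t))
    (hM : 0 ≤ M)
    (hk : ∀ x, t ≤ x → ∀ y, t ≤ y → |rankKer φ n x y| ≤ M * Real.exp (-x) * Real.exp (-y))
    (hε : 0 < ε)
    (hg : ∀ x, t ≤ x → ‖f x - κ2 * ∫ y in Ioi t, (rankKer φ n x y : ℂ) * f y‖ ≤
      ε * Real.exp (-x)) {x : ℝ} (hx : t ≤ x) :
    ‖f x‖ ≤ (1 + ‖κ2‖ * M * (1 + 1 / c ^ 2) * Real.exp (-(2 * t))) * ε * Real.exp (-x) := by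
  have hE := integral_exp_neg_two_mul t
  set E := Real.exp (-(2 * t)) with hEdef
  have hE0 : 0 < E := Real.exp_pos _
  have hiE : IntegrableOn (fun y => Real.exp (-(2 * y))) (Ioi t) := by
    have := integrableOn_exp_mul_Ioi (show (-2 : ℝ) < 0 by norm_num) t
    simpa only [neg_mul] using this
  set I := ∫ y in Ioi t, ‖f y‖ ^ 2 with hI
  have hI0 : 0 ≤ I := integral_nonneg fun _ => by positivity
  have hφf : ∀ k, IntegrableOn (fun y => (φ k y : ℂ) * f y) (Ioi t) := fun k => by
    have hm : Continuous fun y => (φ k y : ℂ) * f y :=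
      (Complex.continuous_ofReal.comp (hc k)).mul hf
    refine ((hi k k).integrableOn.add hif).mono' hm.aestronglyMeasurable
      (Eventually.of_forall fun y => ?_)
    rw [norm_mul, Complex.norm_real, Real.norm_eq_abs, Pi.add_apply, ← abs_mul_abs_self]
    nlinarith [sq_nonneg (|φ k y| - ‖f y‖), abs_nonneg (φ k y), norm_nonneg (f y),
      sq_nonneg (|φ k y| + ‖f y‖)]
  set c' : ℕ → ℂ := fun k => ∫ y in Ioi t, (φ k y : ℂ) * f y with hc'
  have hK : ∀ x, ∫ y in Ioi t, (rankKer φ n x y : ℂ) * f y =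
      ∑ k ∈ Finset.range n, (φ k x : ℂ) * c' k := fun x => by
    have : ∀ y, (rankKer φ n x y : ℂ) * f y =
        ∑ k ∈ Finset.range n, (φ k x : ℂ) * ((φ k y : ℂ) * f y) := fun y => by
      rw [rankKer]
      push_cast
      rw [Finset.sum_mul]
      exact Finset.sum_congr rfl fun k _ => by ring
    simp only [this]
    rw [integral_finsetSum _ fun k _ => (hφf k).const_mul _]
    exact Finset.sum_congr rfl fun k _ => integral_const_mul _ _
  set B := ∑ k ∈ Finset.range n, ‖c' k‖ ^ 2 with hB
  have hB0 : 0 ≤ B := Finset.sum_nonneg fun _ _ => by positivity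
  have hBI : B ≤ I := bessel hc hi ho hf hif n
  have hφf' : ∀ k, (starRingEnd ℂ) (c' k) = ∫ y in Ioi t, (starRingEnd ℂ) (f y) * (φ k y : ℂ) :=
    fun k => by
      rw [hc', ← integral_conj]
      refine integral_congr_ae (Eventually.of_forall fun y => ?_)
      simp [mul_comm]
  have hφfi : ∀ k, IntegrableOn (fun y => (starRingEnd ℂ) (f y) * (φ k y : ℂ)) (Ioi t) :=
    fun k => by
      refine (hφf k).congr' ((by fun_prop : Continuous _).aestronglyMeasurable.mul
        (Complex.continuous_ofReal.comp (hc k)).aestronglyMeasurable)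
        (Eventually.of_forall fun y => ?_)
      simp [mul_comm]
  have hform : ∫ y in Ioi t, (starRingEnd ℂ) (f y) *
      (f y - κ2 * ∫ z in Ioi t, (rankKer φ n y z : ℂ) * f z) = I - κ2 * B := by
    have : ∀ y, (starRingEnd ℂ) (f y) * (f y - κ2 * ∫ z in Ioi t, (rankKer φ n y z : ℂ) * f z) =
        ((‖f y‖ ^ 2 : ℝ) : ℂ) - ∑ k ∈ Finset.range n,
          (κ2 * c' k) * ((starRingEnd ℂ) (f y) * (φ k y : ℂ)) := fun y => by
      rw [hK, mul_sub, Complex.conj_mul', Finset.mul_sum, Finset.mul_sum]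
      push_cast
      congr 1
      exact Finset.sum_congr rfl fun k _ => by ring
    simp only [this]
    have hi1 : IntegrableOn (fun y => ((‖f y‖ ^ 2 : ℝ) : ℂ)) (Ioi t) := hif.ofReal
    have hi2 : IntegrableOn (fun y => ∑ k ∈ Finset.range n,
        (κ2 * c' k) * ((starRingEnd ℂ) (f y) * (φ k y : ℂ))) (Ioi t) :=
      integrable_finsetSum _ fun k _ => (hφfi k).const_mul _
    rw [integral_sub hi1 hi2,
      integral_complex_ofReal, integral_finsetSum _ fun k _ => (hφfi k).const_mul _, hB]
    push_cast
    rw [Finset.mul_sum]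
    congr 1
    refine Finset.sum_congr rfl fun k _ => ?_
    rw [integral_const_mul, ← hφf', mul_assoc, Complex.mul_conj']
  have hIE : I ≤ ε ^ 2 * (E / 2) / c ^ 2 := by
    have h1 : c * I ≤ ‖(I : ℂ) - κ2 * B‖ := by
      rcases hI0.eq_or_lt with h0 | h0
      · rw [← h0, mul_zero]; exact norm_nonneg _
      · have h2 := hκ (B / I) ⟨by positivity, div_le_one_of_le₀ hBI hI0⟩
        have h3 : (I : ℂ) - κ2 * B = I * (1 - κ2 * ((B / I : ℝ) : ℂ)) := by
          have : (I : ℂ) ≠ 0 := by exact_mod_cast h0.ne'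
          push_cast
          field_simp
        rw [h3, norm_mul, Complex.norm_real, Real.norm_of_nonneg hI0, mul_comm]
        exact mul_le_mul_of_nonneg_left h2 hI0
    have h2 : ‖(I : ℂ) - κ2 * B‖ ≤ c / 2 * I + ε ^ 2 / (2 * c) * (E / 2) := by
      rw [← hform, ← hE, ← integral_const_mul, ← integral_const_mul,
        ← integral_add (hif.const_mul _) (hiE.const_mul _)]
      refine norm_integral_le_of_norm_le ((hif.const_mul _).add (hiE.const_mul _))
        ((ae_restrict_mem measurableSet_Ioi).mono fun y hy => ?_)
      rw [norm_mul, RCLike.norm_conj]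
      have h3 := hg y (mem_Ioi.1 hy).le
      have h4 : ‖f y‖ * (ε * Real.exp (-y)) ≤
          c / 2 * ‖f y‖ ^ 2 + ε ^ 2 / (2 * c) * (Real.exp (-y) * Real.exp (-y)) := by
        have h5 : 0 ≤ (c * ‖f y‖ - ε * Real.exp (-y)) ^ 2 / (2 * c) := by positivity
        have h6 : (c * ‖f y‖ - ε * Real.exp (-y)) ^ 2 / (2 * c) = c / 2 * ‖f y‖ ^ 2 +
            ε ^ 2 / (2 * c) * (Real.exp (-y) * Real.exp (-y)) - ‖f y‖ * (ε * Real.exp (-y)) := by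
          field_simp
          ring
        linarith
      rw [exp_neg_mul_exp_neg] at h4
      exact (mul_le_mul_of_nonneg_left h3 (norm_nonneg _)).trans h4
    have h3 : c / 2 * I ≤ ε ^ 2 / (2 * c) * (E / 2) := by linarith
    rw [le_div_iff₀ (by positivity)]
    have h4 : c / 2 * I * (2 * c) ≤ ε ^ 2 / (2 * c) * (E / 2) * (2 * c) := by gcongr
    have h5 : ε ^ 2 / (2 * c) * (E / 2) * (2 * c) = ε ^ 2 * (E / 2) := by field_simp
    linarith
  have hKf : ‖∫ y in Ioi t, (rankKer φ n x y : ℂ) * f y‖ ≤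
      M * (1 + 1 / c ^ 2) * E * ε * Real.exp (-x) := by
    have h1 : ‖∫ y in Ioi t, (rankKer φ n x y : ℂ) * f y‖ ≤
        M * Real.exp (-x) * (ε / 2) * (E / 2) + M * Real.exp (-x) * (1 / (2 * ε)) * I := by
      rw [← hE, ← integral_const_mul, ← integral_const_mul,
        ← integral_add (hiE.const_mul _) (hif.const_mul _)]
      refine norm_integral_le_of_norm_le ((hiE.const_mul _).add (hif.const_mul _))
        ((ae_restrict_mem measurableSet_Ioi).mono fun y hy => ?_)
      rw [norm_mul, Complex.norm_real, Real.norm_eq_abs]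
      have h2 : Real.exp (-y) * ‖f y‖ ≤
          ε / 2 * (Real.exp (-y) * Real.exp (-y)) + 1 / (2 * ε) * ‖f y‖ ^ 2 := by
        have h5 : 0 ≤ (‖f y‖ - ε * Real.exp (-y)) ^ 2 / (2 * ε) := by positivity
        have h6 : (‖f y‖ - ε * Real.exp (-y)) ^ 2 / (2 * ε) = ε / 2 * (Real.exp (-y) *
            Real.exp (-y)) + 1 / (2 * ε) * ‖f y‖ ^ 2 - Real.exp (-y) * ‖f y‖ := by
          field_simp
          ring
        linarith
      rw [exp_neg_mul_exp_neg] at h2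
      calc |rankKer φ n x y| * ‖f y‖ ≤ M * Real.exp (-x) * Real.exp (-y) * ‖f y‖ := by
            gcongr; exact hk x hx y (mem_Ioi.1 hy).le
        _ = M * Real.exp (-x) * (Real.exp (-y) * ‖f y‖) := by ring
        _ ≤ M * Real.exp (-x) * (ε / 2 * Real.exp (-(2 * y)) + 1 / (2 * ε) * ‖f y‖ ^ 2) := by
            gcongr
        _ = _ := by ring
    refine h1.trans ?_
    calc _ ≤ M * Real.exp (-x) * (ε / 2) * (E / 2) +
          M * Real.exp (-x) * (1 / (2 * ε)) * (ε ^ 2 * (E / 2) / c ^ 2) := by gcongr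
      _ = M * (1 + 1 / c ^ 2) * E * ε * Real.exp (-x) / 4 := by field_simp; ring
      _ ≤ _ := by
        have : 0 ≤ M * (1 + 1 / c ^ 2) * E * ε * Real.exp (-x) := by positivity
        linarith
  calc ‖f x‖ = ‖(f x - κ2 * ∫ y in Ioi t, (rankKer φ n x y : ℂ) * f y) +
        κ2 * ∫ y in Ioi t, (rankKer φ n x y : ℂ) * f y‖ := by rw [sub_add_cancel]
    _ ≤ ε * Real.exp (-x) + ‖κ2‖ * (M * (1 + 1 / c ^ 2) * E * ε * Real.exp (-x)) := by
        refine (norm_add_le _ _).trans (add_le_add (hg x hx) ?_)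
        rw [norm_mul]
        gcongr
    _ = _ := by ring

/-! ### The scaled Christoffel–Darboux kernel -/

/-- The Hermite functions in the edge variable, normalized in `L²`. -/
def edgeBasis (n k : ℕ) (s : ℝ) : ℝ := √(edgeMu n) * hermFun k (edgePt n s)

lemma continuous_edgePt (n : ℕ) : Continuous (edgePt n) := by unfold edgePt; fun_prop

lemma continuous_edgeBasis (n k : ℕ) : Continuous (edgeBasis n k) :=
  continuous_const.mul ((continuous_hermFun k).comp (continuous_edgePt n))

lemma edgeBasis_mul {n : ℕ} (hn : 1 ≤ n) (j k : ℕ) (x y : ℝ) : edgeBasis n j x * edgeBasis n k y =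
    edgeMu n * (hermFun j (edgePt n x) * hermFun k (edgePt n y)) := by
  have h := Real.mul_self_sqrt (edgeMu_pos hn).le
  rw [edgeBasis, edgeBasis]
  linear_combination (hermFun j (edgePt n x) * hermFun k (edgePt n y)) * h

lemma integrable_edgeBasis_mul {n : ℕ} (hn : 1 ≤ n) (j k : ℕ) :
    Integrable fun x => edgeBasis n j x * edgeBasis n k x := by
  simp only [edgeBasis_mul hn]
  have h := ((integrable_hermFun_mul j k).comp_add_left (√(2 * n))).comp_mul_left'
    (edgeMu_pos hn).ne'
  exact h.const_mul _

lemma integral_edgeBasis_mul {n : ℕ} (hn : 1 ≤ n) (j k : ℕ) :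
    ∫ x, edgeBasis n j x * edgeBasis n k x = if j = k then 1 else 0 := by
  have hμ := edgeMu_pos hn
  simp only [edgeBasis_mul hn]
  rw [integral_const_mul]
  have h := Measure.integral_comp_mul_left
    (fun x => hermFun j (√(2 * n) + x) * hermFun k (√(2 * n) + x)) (edgeMu n)
  rw [integral_add_left_eq_self (fun x => hermFun j x * hermFun k x), integral_hermFun_mul,
    abs_of_pos (inv_pos.2 hμ), smul_eq_mul] at h
  refine (congrArg (edgeMu n * ·) h).trans ?_
  rw [← mul_assoc, mul_inv_cancel₀ hμ.ne', one_mul]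

/-- The scaled Christoffel–Darboux kernel. -/
def edgeKer (n : ℕ) (x y : ℝ) : ℝ := rankKer (edgeBasis n) n x y

lemma edgeKer_eq {n : ℕ} (hn : 1 ≤ n) (x y : ℝ) :
    edgeKer n x y = edgeMu n * hermKer n (edgePt n x) (edgePt n y) := by
  rw [edgeKer, rankKer, hermKer, Finset.mul_sum]
  exact Finset.sum_congr rfl fun k _ => edgeBasis_mul hn k k x y

lemma tendsto_hermFun (k : ℕ) : Tendsto (hermFun k) atTop (𝓝 0) := by
  have h := ((Polynomial.tendsto_div_exp_atTop (he k)).norm.const_mul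
    (Real.exp (1 / 2) / √(heNorm k)))
  rw [norm_zero, mul_zero] at h
  refine squeeze_zero_norm (fun x => ?_) h
  have h1 : Real.exp (-x ^ 2 / 2) ≤ Real.exp (1 / 2) / Real.exp x := by
    rw [← Real.exp_sub]
    exact Real.exp_le_exp.2 (by nlinarith [sq_nonneg (x - 1)])
  rw [hermFun, norm_div, norm_mul, norm_div, Real.norm_of_nonneg (Real.exp_pos _).le,
    Real.norm_of_nonneg (Real.exp_pos _).le, Real.norm_of_nonneg (Real.sqrt_nonneg _)]
  calc _ ≤ ‖(he k).eval x‖ * (Real.exp (1 / 2) / Real.exp x) / √(heNorm k) := by gcongr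
    _ = _ := by ring

lemma tendsto_edgePt_add {n : ℕ} (hn : 1 ≤ n) (x : ℝ) :
    Tendsto (fun z => edgePt n (x + z)) atTop atTop := by
  unfold edgePt
  exact tendsto_atTop_add_const_left _ _ ((tendsto_atTop_add_const_left _ _ tendsto_id).const_mul_atTop
    (edgeMu_pos hn))

lemma tendsto_edgeKer {n : ℕ} (hn : 1 ≤ n) (x y : ℝ) :
    Tendsto (fun z => edgeKer n (x + z) (y + z)) atTop (𝓝 0) := by
  simp only [edgeKer_eq hn, hermKer]
  have h : Tendsto (fun z => ∑ k ∈ Finset.range n,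
      hermFun k (edgePt n (x + z)) * hermFun k (edgePt n (y + z))) atTop
      (𝓝 (∑ k ∈ Finset.range n, (0 : ℝ) * 0)) :=
    tendsto_finsetSum _ fun k _ => ((tendsto_hermFun k).comp (tendsto_edgePt_add hn x)).mul
      ((tendsto_hermFun k).comp (tendsto_edgePt_add hn y))
  simpa using h.const_mul (edgeMu n)

lemma hasDerivAt_edgeKer {n : ℕ} (hn : 1 ≤ n) (x y z : ℝ) :
    HasDerivAt (fun z => edgeKer n (x + z) (y + z))
      (-(1 / 2) * (edgeFun 0 n (x + z) * edgeFun 1 n (y + z) +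
        edgeFun 1 n (x + z) * edgeFun 0 n (y + z))) z := by
  have hμ := edgeMu_pos hn
  have hsq : √(2 * edgeMu n) * √(2 * edgeMu n) = 2 * edgeMu n :=
    Real.mul_self_sqrt (by positivity)
  have hsq0 : √(2 * edgeMu n) ≠ 0 := by positivity
  have h1 : ∀ j s, hermFun (n - j) (edgePt n s) = √(2 * edgeMu n) * edgeFun j n s := fun j s => by
    rw [edgeFun]; field_simp
  have h2 : √((n : ℝ) / 2) = edgeMu n * edgeNu n ^ 2 := by
    have h3 := sqrt_two_mul_eq hn
    have h4 : (n : ℝ) / 2 = (2 * n) / 2 ^ 2 := by ring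
    rw [h4, Real.sqrt_div (by positivity), Real.sqrt_sq (by norm_num), h3]
    ring
  have h3 := hasDerivAt_hermKer n (edgePt n x) (edgePt n y) (edgeMu n * z)
  have h4 := (h3.comp z ((hasDerivAt_id z).const_mul (edgeMu n))).const_mul (edgeMu n)
  have h5 : ∀ x z, edgePt n (x + z) = edgePt n x + edgeMu n * z := fun x z => by
    rw [edgePt, edgePt]; ring
  have h6 : (fun z => edgeKer n (x + z) (y + z)) = fun z => edgeMu n *
      hermKer n (edgePt n x + edgeMu n * z) (edgePt n y + edgeMu n * z) := by
    ext z
    rw [edgeKer_eq hn, h5, h5]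
  rw [h6]
  refine h4.congr_deriv ?_
  have h7 := h1 0
  rw [Nat.sub_zero] at h7
  rw [← h5, ← h5, h7, h7, h1, h1, h2]
  have h8 := edgeMu_sq hn
  linear_combination (-edgeMu n ^ 3 * edgeNu n ^ 2 * (edgeFun 0 n (x + z) * edgeFun 1 n (y + z) +
        edgeFun 1 n (x + z) * edgeFun 0 n (y + z))) * hsq - (1 / 2) * (2 * edgeMu n ^ 2 * edgeNu n + 1) *
        (edgeFun 0 n (x + z) * edgeFun 1 n (y + z) +
        edgeFun 1 n (x + z) * edgeFun 0 n (y + z)) * h8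

lemma continuous_edgeFun (j n : ℕ) : Continuous (edgeFun j n) :=
  ((continuous_hermFun _).comp (continuous_edgePt n)).div_const _

lemma exp_neg_add_mul (x y z : ℝ) : Real.exp (-(x + z)) * Real.exp (-(y + z)) =
    Real.exp (-x) * Real.exp (-y) * Real.exp (-(2 * z)) := by
  rw [← Real.exp_add, ← Real.exp_add, ← Real.exp_add]; congr 1; ring

lemma abs_edgeFun_mul_le {T : ℝ} (hT : 0 ≤ T) {n i j : ℕ} (hn : 1 ≤ n) (hi : i ≤ 1) (hj : j ≤ 1)
    {x y z : ℝ} (hx : -T ≤ x) (hy : -T ≤ y) (hz : 0 ≤ z) :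
    |edgeFun i n (x + z) * edgeFun j n (y + z)| ≤
      edgeConst T ^ 2 * Real.exp (-x) * Real.exp (-y) * Real.exp (-(2 * z)) := by
  rw [abs_mul]
  have hK := edgeConst_nonneg T
  calc _ ≤ (edgeConst T * Real.exp (-(x + z))) * (edgeConst T * Real.exp (-(y + z))) :=
        mul_le_mul (abs_edgeFun_le hT hn hi (by linarith)) (abs_edgeFun_le hT hn hj (by linarith))
          (abs_nonneg _) (by positivity)
    _ = edgeConst T ^ 2 * (Real.exp (-(x + z)) * Real.exp (-(y + z))) := by ring
    _ = _ := by rw [exp_neg_add_mul]; ring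

lemma integrableOn_edgeFun_mul {T : ℝ} (hT : 0 ≤ T) {n i j : ℕ} (hn : 1 ≤ n) (hi : i ≤ 1)
    (hj : j ≤ 1) {x y : ℝ} (hx : -T ≤ x) (hy : -T ≤ y) :
    IntegrableOn (fun z => edgeFun i n (x + z) * edgeFun j n (y + z)) (Ioi 0) := by
  refine integrableOn_of_exp_bound (a := 2) ?_ two_pos
    fun z hz => abs_edgeFun_mul_le hT hn hi hj hx hy hz
  exact ((continuous_edgeFun i n).comp (by fun_prop)).mul
    ((continuous_edgeFun j n).comp (by fun_prop))

lemma edgeKer_eq_integral {n : ℕ} (hn : 1 ≤ n) (x y : ℝ) :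
    edgeKer n x y = (1 / 2) * ∫ z in Ioi (0 : ℝ), (edgeFun 0 n (x + z) * edgeFun 1 n (y + z) +
        edgeFun 1 n (x + z) * edgeFun 0 n (y + z)) := by
  have hT : 0 ≤ max |x| |y| := (abs_nonneg x).trans (le_max_left _ _)
  have hx : -max |x| |y| ≤ x := (neg_le_neg (le_max_left _ _)).trans (neg_abs_le x)
  have hy : -max |x| |y| ≤ y := (neg_le_neg (le_max_right _ _)).trans (neg_abs_le y)
  have h := integral_Ioi_of_hasDerivAt_of_tendsto' (a := 0)
    (fun z _ => hasDerivAt_edgeKer hn x y z)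
    (((integrableOn_edgeFun_mul hT hn zero_le_one le_rfl hx hy).add
      (integrableOn_edgeFun_mul hT hn le_rfl zero_le_one hx hy)).const_mul _)
    (tendsto_edgeKer hn x y)
  rw [integral_const_mul, add_zero, add_zero, zero_sub] at h
  linarith

lemma abs_edgeKer_le {T : ℝ} (hT : 0 ≤ T) {n : ℕ} (hn : 1 ≤ n) {x y : ℝ} (hx : -T ≤ x)
    (hy : -T ≤ y) : |edgeKer n x y| ≤ edgeConst T ^ 2 * Real.exp (-x) * Real.exp (-y) := by
  have h := norm_setIntegral_le_exp (t := 0) (C := 2 * edgeConst T ^ 2 * Real.exp (-x) * Real.exp (-y))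
    (f := fun z => edgeFun 0 n (x + z) * edgeFun 1 n (y + z) +
        edgeFun 1 n (x + z) * edgeFun 0 n (y + z)) fun z hz => by
      refine (norm_add_le _ _).trans ?_
      have h1 := abs_edgeFun_mul_le hT hn zero_le_one le_rfl hx hy hz
      have h2 := abs_edgeFun_mul_le hT hn le_rfl zero_le_one hx hy hz
      rw [Real.norm_eq_abs, Real.norm_eq_abs]
      linarith
  rw [edgeKer_eq_integral hn, abs_mul, abs_of_pos one_half_pos]
  rw [Real.norm_eq_abs, mul_zero, neg_zero, Real.exp_zero] at h
  have : 0 ≤ edgeConst T ^ 2 * Real.exp (-x) * Real.exp (-y) := by positivity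
  linarith

/-- The Airy kernel. -/
def airyKer (A : ℝ → ℝ) (x y : ℝ) : ℝ := ∫ z in Ioi (0 : ℝ), A (x + z) * A (y + z)

lemma abs_edgeFun_sub_airy_le {A A' : ℝ → ℝ} (hA : IsAiry A A') {T : ℝ} (hT : 0 ≤ T) {n j : ℕ}
    (hn : 1 ≤ n) (hj : j ≤ 1) {s : ℝ} (hs : -T ≤ s) :
    |edgeFun j n s - A s| ≤ (edgeNu n)⁻¹ * edgeConst T * Real.exp (-s) := by
  have h := norm_edgeFun_sub_le hT hn hj hs
  rw [← airyD_zero, (airyD_eq hA s).1, mul_div_cancel_left₀ _ (by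
    exact_mod_cast (by positivity : (2 * Real.pi : ℝ) ≠ 0)), ← Complex.ofReal_sub,
    Complex.norm_real] at h
  exact h

lemma abs_airy_le_exp {A A' : ℝ → ℝ} (hA : IsAiry A A') {T : ℝ} (hT : 0 ≤ T) {s : ℝ}
    (hs : -T ≤ s) : |A s| ≤ 2 * edgeConst T * Real.exp (-s) := by
  have h1 := abs_edgeFun_sub_airy_le hA hT le_rfl zero_le_one hs
  have h2 := abs_edgeFun_le hT le_rfl zero_le_one hs
  have h3 : edgeNu 1 = 1 := by simp [edgeNu]
  rw [h3, inv_one, one_mul] at h1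
  have h4 := abs_sub_abs_le_abs_sub (A s) (edgeFun 0 1 s)
  rw [abs_sub_comm] at h4
  linarith

lemma continuous_airy {A A' : ℝ → ℝ} (hA : IsAiry A A') : Continuous A :=
  continuous_iff_continuousAt.2 fun x => (hA.1 x).continuousAt

lemma abs_edgeFun_mul_sub_le {A A' : ℝ → ℝ} (hA : IsAiry A A') {T : ℝ} (hT : 0 ≤ T) {n i j : ℕ}
    (hn : 1 ≤ n) (hi : i ≤ 1) (hj : j ≤ 1)
    {x y z : ℝ} (hx : -T ≤ x) (hy : -T ≤ y) (hz : 0 ≤ z) :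
    |edgeFun i n (x + z) * edgeFun j n (y + z) - A (x + z) * A (y + z)| ≤
      3 * (edgeNu n)⁻¹ * edgeConst T ^ 2 * Real.exp (-x) * Real.exp (-y) * Real.exp (-(2 * z)) := by
  have hK := edgeConst_nonneg T
  have hν : 0 ≤ (edgeNu n)⁻¹ := inv_nonneg.2 (zero_le_one.trans (one_le_edgeNu hn))
  have h1 : edgeFun i n (x + z) * edgeFun j n (y + z) - A (x + z) * A (y + z) =
      (edgeFun i n (x + z) - A (x + z)) * edgeFun j n (y + z) +
        A (x + z) * (edgeFun j n (y + z) - A (y + z)) := by ring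
  rw [h1]
  refine (abs_add_le _ _).trans ?_
  rw [abs_mul, abs_mul]
  have hx' : -T ≤ x + z := by linarith
  have hy' : -T ≤ y + z := by linarith
  calc _ ≤ ((edgeNu n)⁻¹ * edgeConst T * Real.exp (-(x + z))) * (edgeConst T * Real.exp (-(y + z))) +
        (2 * edgeConst T * Real.exp (-(x + z))) *
          ((edgeNu n)⁻¹ * edgeConst T * Real.exp (-(y + z))) := by
        gcongr
        · exact abs_edgeFun_sub_airy_le hA hT hn hi hx'
        · exact abs_edgeFun_le hT hn hj hy'
        · exact abs_airy_le_exp hA hT hx'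
        · exact abs_edgeFun_sub_airy_le hA hT hn hj hy'
    _ = 3 * (edgeNu n)⁻¹ * edgeConst T ^ 2 * (Real.exp (-(x + z)) * Real.exp (-(y + z))) := by ring
    _ = _ := by rw [exp_neg_add_mul]; ring

lemma integrableOn_airy_mul {A A' : ℝ → ℝ} (hA : IsAiry A A') (x y : ℝ) :
    IntegrableOn (fun z => A (x + z) * A (y + z)) (Ioi 0) := by
  have hT : 0 ≤ max |x| |y| := (abs_nonneg x).trans (le_max_left _ _)
  have hx : -max |x| |y| ≤ x := (neg_le_neg (le_max_left _ _)).trans (neg_abs_le x)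
  have hy : -max |x| |y| ≤ y := (neg_le_neg (le_max_right _ _)).trans (neg_abs_le y)
  have hK := edgeConst_nonneg (max |x| |y|)
  refine integrableOn_of_exp_bound (a := 2)
    (C := 4 * edgeConst (max |x| |y|) ^ 2 * Real.exp (-x) * Real.exp (-y)) ?_ two_pos
    fun z hz => ?_
  · exact ((continuous_airy hA).comp (by fun_prop)).mul ((continuous_airy hA).comp (by fun_prop))
  · rw [Real.norm_eq_abs, abs_mul]
    have h1 := abs_airy_le_exp hA hT (show -max |x| |y| ≤ x + z by linarith)
    have h2 := abs_airy_le_exp hA hT (show -max |x| |y| ≤ y + z by linarith)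
    calc _ ≤ _ := mul_le_mul h1 h2 (abs_nonneg _) (by positivity)
      _ = 4 * edgeConst (max |x| |y|) ^ 2 * (Real.exp (-(x + z)) * Real.exp (-(y + z))) := by ring
      _ = _ := by rw [exp_neg_add_mul]; ring

lemma abs_edgeKer_sub_le {A A' : ℝ → ℝ} (hA : IsAiry A A') {T : ℝ} (hT : 0 ≤ T) {n : ℕ}
    (hn : 1 ≤ n) {x y : ℝ} (hx : -T ≤ x) (hy : -T ≤ y) :
    |edgeKer n x y - airyKer A x y| ≤
      3 * (edgeNu n)⁻¹ * edgeConst T ^ 2 * Real.exp (-x) * Real.exp (-y) := by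
  have hν : 0 ≤ (edgeNu n)⁻¹ := inv_nonneg.2 (zero_le_one.trans (one_le_edgeNu hn))
  have h1 : edgeKer n x y - airyKer A x y = (1 / 2) * ∫ z in Ioi (0 : ℝ),
      ((edgeFun 0 n (x + z) * edgeFun 1 n (y + z) - A (x + z) * A (y + z)) +
        (edgeFun 1 n (x + z) * edgeFun 0 n (y + z) - A (x + z) * A (y + z))) := by
    have h2 := integrableOn_edgeFun_mul hT hn zero_le_one le_rfl hx hy
    have h3 := integrableOn_edgeFun_mul hT hn le_rfl zero_le_one hx hy
    have h4 := integrableOn_airy_mul hA x y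
    have h5 : IntegrableOn (fun z => edgeFun 0 n (x + z) * edgeFun 1 n (y + z) -
      A (x + z) * A (y + z)) (Ioi 0) := h2.sub h4
    have h6 : IntegrableOn (fun z => edgeFun 1 n (x + z) * edgeFun 0 n (y + z) -
      A (x + z) * A (y + z)) (Ioi 0) := h3.sub h4
    rw [edgeKer_eq_integral hn, airyKer, integral_add h2 h3, integral_add h5 h6,
      integral_sub h2 h4, integral_sub h3 h4]
    ring
  have h := norm_setIntegral_le_exp (t := 0)
    (C := 6 * (edgeNu n)⁻¹ * edgeConst T ^ 2 * Real.exp (-x) * Real.exp (-y))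
    (f := fun z => (edgeFun 0 n (x + z) * edgeFun 1 n (y + z) - A (x + z) * A (y + z)) +
        (edgeFun 1 n (x + z) * edgeFun 0 n (y + z) - A (x + z) * A (y + z))) fun z hz => by
      refine (norm_add_le _ _).trans ?_
      have h1 := abs_edgeFun_mul_sub_le hA hT hn zero_le_one le_rfl hx hy hz
      have h2 := abs_edgeFun_mul_sub_le hA hT hn le_rfl zero_le_one hx hy hz
      rw [Real.norm_eq_abs, Real.norm_eq_abs]
      linarith
  rw [h1, abs_mul, abs_of_pos one_half_pos]
  rw [Real.norm_eq_abs, mul_zero, neg_zero, Real.exp_zero] at h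
  have : 0 ≤ (edgeNu n)⁻¹ * edgeConst T ^ 2 * Real.exp (-x) * Real.exp (-y) := by positivity
  linarith

/-- For a positive base point the Airy kernel is dominated by the Airy function itself. -/
lemma abs_airyKer_le {A A' : ℝ → ℝ} (hA : IsAiry A A') {x y : ℝ} (hx : 0 ≤ x) (hy : 0 ≤ y) :
    |airyKer A x y| ≤ 2 * edgeConst 0 * |A x| * Real.exp (-y) := by
  have hK := edgeConst_nonneg 0
  have h0 : IntegrableOn (fun z => Real.exp (-z)) (Ioi (0 : ℝ)) := integrableOn_exp_neg_Ioi 0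
  have h1 : ∫ z in Ioi (0 : ℝ), 2 * edgeConst 0 * |A x| * Real.exp (-y) * Real.exp (-z) =
      2 * edgeConst 0 * |A x| * Real.exp (-y) := by
    rw [integral_const_mul, integral_exp_neg_Ioi, neg_zero, Real.exp_zero, mul_one]
  rw [← h1, ← Real.norm_eq_abs, airyKer]
  refine norm_integral_le_of_norm_le (h0.const_mul _)
    ((ae_restrict_mem measurableSet_Ioi).mono fun z hz => ?_)
  have hz' : 0 ≤ z := (mem_Ioi.1 hz).le
  have h2 := abs_airy_le_exp hA le_rfl (show -(0 : ℝ) ≤ y + z by linarith)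
  have h3 := abs_airy_antitone hA hx (show x ≤ x + z by linarith)
  rw [Real.norm_eq_abs, abs_mul]
  calc _ ≤ |A x| * (2 * edgeConst 0 * Real.exp (-(y + z))) :=
        mul_le_mul h3 h2 (abs_nonneg _) (abs_nonneg _)
    _ = _ := by rw [neg_add, Real.exp_add]; ring

/-! ### The integral equation for the orthogonal polynomials -/

/-- The squared connection parameter `1 - e^{-2πiβ}`. -/
def kappaSq (β : ℂ) : ℂ := 1 - jumpR β / jumpL β

/-- The integral of a polynomial against the Gaussian over the right half-line. -/
def rightInt (l : ℝ) (p : ℂ[X]) : ℂ :=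
  ∫ x in Ioi l, p.eval (x : ℂ) * (Real.exp (-x ^ 2) : ℂ)

lemma jumpL_mul_kappaSq (β : ℂ) : jumpL β * kappaSq β = jumpL β - jumpR β := by
  have := jumpL_ne_zero β
  rw [kappaSq]; field_simp

lemma wInt_eq_rightInt (β : ℂ) (l : ℝ) (p : ℂ[X]) :
    wInt β l p = jumpL β * (wInt 0 l p - kappaSq β * rightInt l p) := by
  have h := integrable_eval_mul_gauss p
  have h1 : leftInt l p + rightInt l p = gaussInt p :=
    intervalIntegral.integral_Iic_add_Ioi h.integrableOn h.integrableOn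
  rw [wInt_eq, wInt_zero_eq, mul_sub, ← mul_assoc, jumpL_mul_kappaSq, ← h1]
  ring

lemma eq_sum_op_zero (l : ℝ) (n : ℕ) : ∀ p : ℂ[X], p.degree < n → p = ∑ k ∈ Finset.range n,
    C (wInt 0 l (p * op 0 k l) / heNorm k) * op 0 k l := by
  induction n with
  | zero =>
    intro p hp
    rw [Finset.range_zero, Finset.sum_empty]
    exact degree_eq_bot.1 (Nat.WithBot.lt_zero_iff.1 hp)
  | succ n ih =>
    intro p hp
    obtain ⟨c, hc⟩ : ∃ c, c = p.coeff n := ⟨_, rfl⟩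
    obtain ⟨r, hr⟩ : ∃ r, r = p - C c * op 0 n l := ⟨_, rfl⟩
    have hrd : r.degree < n := by
      rw [degree_lt_iff_coeff_zero]
      intro m hm
      rw [hr, coeff_sub, coeff_C_mul]
      rcases hm.eq_or_lt with rfl | hm
      · have := (monic_op 0 n l).coeff_natDegree
        rw [natDegree_op] at this
        rw [this, mul_one, hc, sub_self]
      · rw [(degree_lt_iff_coeff_zero p (n + 1)).1 hp m hm,
          coeff_eq_zero_of_natDegree_lt (p := op 0 n l) (by rw [natDegree_op]; exact hm),
          mul_zero, sub_zero]
    have hpr : p = r + C c * op 0 n l := by rw [hr]; ring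
    have h0 : ((heNorm n : ℝ) : ℂ) ≠ 0 := by exact_mod_cast (heNorm_pos n).ne'
    have h1 : wInt 0 l (p * op 0 n l) = c * heNorm n := by
      have h2 := wInt_op_mul zero_re_abs_lt l hrd
      have h3 := opNorm_zero n l
      rw [opNorm] at h3
      rw [hpr, add_mul, wInt_add, mul_comm r, h2, zero_add, mul_assoc, wInt_C_mul, h3]
    rw [Finset.sum_range_succ, h1, mul_div_cancel_right₀ _ h0]
    refine hpr.trans ?_
    congr 1
    refine (ih r hrd).trans (Finset.sum_congr rfl fun k hk => ?_)
    have h2 := wInt_op_mul zero_re_abs_lt (n := n) l (q := op 0 k l)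
      (by rw [degree_op]; exact_mod_cast Finset.mem_range.1 hk)
    rw [hr, sub_mul, wInt_sub, mul_assoc, wInt_C_mul, h2, mul_zero, sub_zero]

section
variable {β : ℂ}

lemma op_eq_sum (hβ : |β.re| < 1 / 2) (n : ℕ) (l : ℝ) : op β n l = op 0 n l +
    ∑ k ∈ Finset.range n,
      C (kappaSq β * rightInt l (op β n l * op 0 k l) / heNorm k) * op 0 k l := by
  have h := eq_sum_op_zero l n (op β n l - op 0 n l)
    (degree_sub_op_lt (monic_op β n l) (natDegree_op β n l) l)
  rw [sub_eq_iff_eq_add'] at h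
  refine h.trans ?_
  congr 1
  refine Finset.sum_congr rfl fun k hk => ?_
  have hd : ∀ b, (op b k l).degree < n := fun b => by
    rw [degree_op]; exact_mod_cast Finset.mem_range.1 hk
  have h2 := wInt_op_mul zero_re_abs_lt l (hd 0)
  have h3 := wInt_op_mul hβ l (hd 0)
  rw [wInt_eq_rightInt, mul_eq_zero, or_iff_right (jumpL_ne_zero β), sub_eq_zero] at h3
  rw [sub_mul, wInt_sub, h2, sub_zero, h3]

/-- The scaled orthogonal function with jump at `edgePt n t`. -/
def qFun (β : ℂ) (n : ℕ) (t s : ℝ) : ℂ := (op β n (edgePt n t)).eval ((edgePt n s : ℝ) : ℂ) *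
  (Real.exp (-edgePt n s ^ 2 / 2) : ℂ) / (√(2 * edgeMu n * heNorm n) : ℂ)

lemma continuous_qFun (n : ℕ) (t : ℝ) : Continuous (qFun β n t) := by
  unfold qFun
  have := continuous_edgePt n
  fun_prop

lemma setIntegral_edgePt {n : ℕ} (hn : 1 ≤ n) (t : ℝ) (g : ℝ → ℂ) :
    ∫ x in Ioi (edgePt n t), g x = edgeMu n * ∫ y in Ioi t, g (edgePt n y) := by
  have hμ := edgeMu_pos hn
  have h := integral_comp_mul_left_Ioi (fun x => g (√(2 * n) + x)) t hμ
  have h2 : ∫ x in Ioi (edgeMu n * t), g (√(2 * n) + x) = ∫ x in Ioi (edgePt n t), g x := by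
    have := (measurePreserving_add_left volume (√(2 * n))).setIntegral_preimage_emb
      (measurableEmbedding_addLeft _) g (Ioi (edgePt n t))
    rw [← this]
    congr 2
    ext x
    simp [edgePt]
  rw [h2] at h
  have h3 : ∫ y in Ioi t, g (edgePt n y) = ((edgeMu n)⁻¹ : ℝ) • ∫ x in Ioi (edgePt n t), g x := h
  have hμ' : ((edgeMu n : ℝ) : ℂ) ≠ 0 := by exact_mod_cast hμ.ne'
  rw [h3, Complex.real_smul, ← mul_assoc]
  push_cast
  rw [mul_inv_cancel₀ hμ', one_mul]

lemma integrable_comp_edgePt {E : Type*} [NormedAddCommGroup E] {n : ℕ} (hn : 1 ≤ n) {g : ℝ → E}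
    (hg : Integrable g) : Integrable fun y => g (edgePt n y) :=
  (hg.comp_add_left (√(2 * n))).comp_mul_left' (edgeMu_pos hn).ne'

lemma sqrt_mul_heNorm {n : ℕ} (hn : 1 ≤ n) :
    √(2 * edgeMu n * heNorm n) = √(2 * edgeMu n) * √(heNorm n) :=
  Real.sqrt_mul (by have := edgeMu_pos hn; positivity) _

lemma qFun_mul_hermFun {n : ℕ} (hn : 1 ≤ n) (k : ℕ) (t y : ℝ) :
    (op β n (edgePt n t) * op 0 k (edgePt n t)).eval ((edgePt n y : ℝ) : ℂ) *
      (Real.exp (-edgePt n y ^ 2) : ℂ) = (√(2 * edgeMu n * heNorm n) * √(heNorm k) : ℝ) *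
        ((hermFun k (edgePt n y) : ℂ) * qFun β n t y) := by
  have h1 : (√(2 * edgeMu n * heNorm n) : ℂ) ≠ 0 := by
    have h := edgeMu_pos hn
    have h2 := heNorm_pos n
    exact_mod_cast (by positivity : √(2 * edgeMu n * heNorm n) ≠ 0)
  have h2 : (√(heNorm k) : ℂ) ≠ 0 := by
    have h2 := heNorm_pos k
    exact_mod_cast (by positivity : √(heNorm k) ≠ 0)
  rw [eval_mul, eval_op_zero, ← exp_half_sq, hermFun, qFun]
  push_cast
  field_simp

lemma integrable_hermFun_qFun {n : ℕ} (hn : 1 ≤ n) (k : ℕ) (t : ℝ) :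
    Integrable fun y => (hermFun k (edgePt n y) : ℂ) * qFun β n t y := by
  have h := integrable_comp_edgePt hn
    (integrable_eval_mul_gauss (op β n (edgePt n t) * op 0 k (edgePt n t)))
  simp only [qFun_mul_hermFun hn] at h
  have h1 : (((√(2 * edgeMu n * heNorm n) * √(heNorm k) : ℝ)) : ℂ) ≠ 0 := by
    have h := edgeMu_pos hn
    have h2 := heNorm_pos n
    have h3 := heNorm_pos k
    exact_mod_cast (by positivity : √(2 * edgeMu n * heNorm n) * √(heNorm k) ≠ 0)
  have := h.const_mul (((√(2 * edgeMu n * heNorm n) * √(heNorm k) : ℝ)) : ℂ)⁻¹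
  simpa only [inv_mul_cancel_left₀ h1] using this

lemma integrable_norm_qFun_sq {n : ℕ} (hn : 1 ≤ n) (t : ℝ) :
    Integrable fun y => ‖qFun β n t y‖ ^ 2 := by
  have h := (integrable_comp_edgePt hn (integrable_eval_mul_gauss
    (op β n (edgePt n t) * op β n (edgePt n t)))).norm.const_mul ((√(2 * edgeMu n * heNorm n)) ^ 2)⁻¹
  refine h.congr (Eventually.of_forall fun y => ?_)
  simp only [qFun, norm_div, norm_mul, eval_mul, Complex.norm_real, Real.norm_eq_abs, abs_of_nonneg (Real.sqrt_nonneg _), Real.abs_exp]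
  rw [← exp_half_sq]
  ring

lemma rightInt_mul {n : ℕ} (hn : 1 ≤ n) (k : ℕ) (t : ℝ) :
    rightInt (edgePt n t) (op β n (edgePt n t) * op 0 k (edgePt n t)) =
      edgeMu n * ((√(2 * edgeMu n * heNorm n) * √(heNorm k) : ℝ) *
        ∫ y in Ioi t, (hermFun k (edgePt n y) : ℂ) * qFun β n t y) := by
  rw [rightInt, setIntegral_edgePt hn]
  simp only [qFun_mul_hermFun hn]
  rw [integral_const_mul]

lemma qFun_eq (hβ : |β.re| < 1 / 2) {n : ℕ} (hn : 1 ≤ n) (t s : ℝ) : qFun β n t s =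
    edgeFun 0 n s + kappaSq β * ∫ y in Ioi t, (edgeKer n s y : ℂ) * qFun β n t y := by
  have hh : ∀ k, (√(heNorm k) : ℂ) * √(heNorm k) = heNorm k := fun k => by
    exact_mod_cast Real.mul_self_sqrt (heNorm_pos k).le
  have hh0 : ∀ k, (√(heNorm k) : ℂ) ≠ 0 := fun k => by
    have h2 := heNorm_pos k
    exact_mod_cast (by positivity : √(heNorm k) ≠ 0)
  have h1 : (√(2 * edgeMu n * heNorm n) : ℂ) ≠ 0 := by
    have h := edgeMu_pos hn
    have h2 := heNorm_pos n
    exact_mod_cast (by positivity : √(2 * edgeMu n * heNorm n) ≠ 0)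
  have hK : ∫ y in Ioi t, (edgeKer n s y : ℂ) * qFun β n t y = ∑ k ∈ Finset.range n,
      edgeMu n * (hermFun k (edgePt n s) : ℂ) *
        ∫ y in Ioi t, (hermFun k (edgePt n y) : ℂ) * qFun β n t y := by
    have : ∀ y, (edgeKer n s y : ℂ) * qFun β n t y = ∑ k ∈ Finset.range n,
        edgeMu n * (hermFun k (edgePt n s) : ℂ) *
          ((hermFun k (edgePt n y) : ℂ) * qFun β n t y) := fun y => by
      rw [edgeKer_eq hn, hermKer]
      push_cast
      rw [Finset.mul_sum, Finset.sum_mul]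
      exact Finset.sum_congr rfl fun k _ => by ring
    simp only [this]
    rw [integral_finsetSum _ fun k _ => ((integrable_hermFun_qFun hn k t).integrableOn).const_mul _]
    exact Finset.sum_congr rfl fun k _ => integral_const_mul _ _
  rw [hK, qFun]
  conv_lhs => rw [op_eq_sum hβ]
  rw [eval_add, eval_finsetSum, add_mul, add_div]
  congr 1
  · rw [eval_op_zero, edgeFun, hermFun, Nat.sub_zero, sqrt_mul_heNorm hn]
    push_cast
    field_simp
  · rw [Finset.sum_mul, Finset.sum_div, Finset.mul_sum]
    refine Finset.sum_congr rfl fun k _ => ?_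
    rw [eval_mul, eval_C, eval_op_zero, rightInt_mul hn, ← hh, hermFun]
    have := hh0 k
    push_cast
    field_simp

/-- The normalized squared norm of the orthogonal polynomial. -/
def gFun (β : ℂ) (n : ℕ) (t : ℝ) : ℂ := opNorm β n (edgePt n t) / (jumpL β * heNorm n)

lemma gFun_eq (hβ : |β.re| < 1 / 2) {n : ℕ} (hn : 1 ≤ n) (t : ℝ) : gFun β n t =
    1 - kappaSq β * (((edgeNu n)⁻¹ : ℝ) : ℂ) *
      ∫ y in Ioi t, (edgeFun 0 n y : ℂ) * qFun β n t y := by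
  have hμ := edgeMu_pos hn
  have hν := one_le_edgeNu hn
  have hh : ((heNorm n : ℝ) : ℂ) ≠ 0 := by exact_mod_cast (heNorm_pos n).ne'
  have hs : (√(heNorm n) : ℂ) * √(heNorm n) = heNorm n := by
    exact_mod_cast Real.mul_self_sqrt (heNorm_pos n).le
  have hm : (√(2 * edgeMu n) : ℂ) * √(2 * edgeMu n) = 2 * edgeMu n := by
    exact_mod_cast Real.mul_self_sqrt (by positivity : 0 ≤ 2 * edgeMu n)
  have hν' : (((edgeNu n)⁻¹ : ℝ) : ℂ) = 2 * (edgeMu n : ℂ) ^ 2 := by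
    have : (edgeNu n)⁻¹ = 2 * edgeMu n ^ 2 := by
      have := edgeMu_sq hn
      field_simp
      linarith
    rw [this]; push_cast; rfl
  have h1 : ∀ y, (hermFun n (edgePt n y) : ℂ) * qFun β n t y =
      √(2 * edgeMu n) * ((edgeFun 0 n y : ℂ) * qFun β n t y) := fun y => by
    have h0 : (√(2 * edgeMu n) : ℂ) ≠ 0 := by
      exact_mod_cast (by positivity : √(2 * edgeMu n) ≠ 0)
    rw [edgeFun, Nat.sub_zero]
    push_cast
    field_simp
  have h2 := wInt_op_mul_monic hβ (edgePt n t) (monic_op 0 n (edgePt n t)) (natDegree_op 0 n _)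
  have h3 := wInt_op_mul_monic zero_re_abs_lt (edgePt n t) (monic_op β n (edgePt n t))
    (natDegree_op β n _)
  rw [wInt_eq_rightInt, mul_comm (op β n _) (op 0 n _), h3, opNorm_zero,
    mul_comm (op 0 n _) (op β n _), rightInt_mul hn] at h2
  simp only [h1] at h2
  rw [integral_const_mul, sqrt_mul_heNorm hn] at h2
  have hj := jumpL_ne_zero β
  rw [gFun, ← h2, mul_div_mul_left _ _ hj, hν', sub_div, div_self hh]
  congr 1
  rw [div_eq_iff hh]
  push_cast
  set J := ∫ y in Ioi t, (edgeFun 0 n y : ℂ) * qFun β n t y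
  linear_combination (kappaSq β * edgeMu n * J * √(heNorm n) * √(heNorm n)) * hm +
    (kappaSq β * edgeMu n * J * (2 * edgeMu n)) * hs

end

/-! ### Uniform bounds and Cauchy estimates for the scaled orthogonal functions -/

section
variable {β : ℂ}

lemma exists_lower_bound (hβ : |β.re| < 1 / 2) :
    ∃ c : ℝ, 0 < c ∧ ∀ r ∈ Icc (0 : ℝ) 1, c ≤ ‖1 - kappaSq β * r‖ := by
  obtain ⟨ha, hb⟩ := jump_re_pos hβ
  have h0 := jumpL_ne_zero β
  have h0' : 0 < ‖jumpL β‖ := norm_pos_iff.2 h0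
  refine ⟨min (jumpL β).re (jumpR β).re / ‖jumpL β‖, div_pos (lt_min ha hb) h0', ?_⟩
  rintro r ⟨hr0, hr1⟩
  have h : 1 - kappaSq β * r = (((1 - r : ℝ) : ℂ) * jumpL β + (r : ℂ) * jumpR β) / jumpL β := by
    rw [kappaSq]; push_cast; field_simp; ring
  rw [h, norm_div]
  refine (div_le_div_iff_of_pos_right h0').2 (le_trans ?_ (Complex.re_le_norm _))
  rw [Complex.add_re, Complex.re_ofReal_mul, Complex.re_ofReal_mul]
  nlinarith [min_le_left (jumpL β).re (jumpR β).re, min_le_right (jumpL β).re (jumpR β).re]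

lemma continuous_edgeKer (n : ℕ) (x : ℝ) : Continuous (edgeKer n x) := by
  unfold edgeKer rankKer
  exact continuous_finsetSum _ fun k _ => continuous_const.mul (continuous_edgeBasis n k)

lemma edge_stability (hβ : |β.re| < 1 / 2) {T : ℝ} (hT : 0 ≤ T) : ∃ B : ℝ, 0 ≤ B ∧
    ∀ {n : ℕ}, 1 ≤ n → ∀ {t : ℝ}, -T ≤ t → ∀ {f : ℝ → ℂ}, Continuous f →
      IntegrableOn (fun y => ‖f y‖ ^ 2) (Ioi t) → ∀ {ε : ℝ}, 0 < ε →
      (∀ x, t ≤ x → ‖f x - kappaSq β * ∫ y in Ioi t, (edgeKer n x y : ℂ) * f y‖ ≤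
        ε * Real.exp (-x)) → ∀ {x}, t ≤ x → ‖f x‖ ≤ B * ε * Real.exp (-x) := by
  obtain ⟨c, hc, hκ⟩ := exists_lower_bound hβ
  refine ⟨1 + ‖kappaSq β‖ * edgeConst T ^ 2 * (1 + 1 / c ^ 2) * Real.exp (2 * T), by positivity, ?_⟩
  intro n hn t ht f hf hif ε hε hg x hx
  refine (stability (continuous_edgeBasis n) (integrable_edgeBasis_mul hn)
    (integral_edgeBasis_mul hn) hf hc hκ hif (sq_nonneg (edgeConst T))
    (fun x hx y hy => abs_edgeKer_le hT hn (ht.trans hx) (ht.trans hy)) hε hg hx).trans ?_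
  gcongr
  linarith

lemma exists_norm_qFun_le (hβ : |β.re| < 1 / 2) {T : ℝ} (hT : 0 ≤ T) : ∃ D : ℝ, 0 ≤ D ∧
    ∀ {n : ℕ}, 1 ≤ n → ∀ {t : ℝ}, -T ≤ t → ∀ {s : ℝ}, t ≤ s →
      ‖qFun β n t s‖ ≤ D * Real.exp (-s) := by
  obtain ⟨B, hB, h⟩ := edge_stability hβ hT
  have hK := edgeConst_nonneg T
  refine ⟨B * (edgeConst T + 1), by positivity, ?_⟩
  intro n hn t ht s hs
  refine h hn ht (continuous_qFun n t) (integrable_norm_qFun_sq hn t).integrableOn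
    (by positivity) (fun x hx => ?_) hs
  rw [qFun_eq hβ hn t x, add_sub_cancel_right, Complex.norm_real]
  refine (abs_edgeFun_le hT hn zero_le_one (ht.trans hx)).trans ?_
  gcongr
  linarith

lemma edgeNu_le {n m : ℕ} (h : n ≤ m) : edgeNu n ≤ edgeNu m :=
  Real.rpow_le_rpow n.cast_nonneg (by exact_mod_cast h) (by norm_num)

lemma exists_norm_qFun_sub_le {A A' : ℝ → ℝ} (hA : IsAiry A A') (hβ : |β.re| < 1 / 2) {T : ℝ}
    (hT : 0 ≤ T) : ∃ D : ℝ, 0 ≤ D ∧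
    ∀ {n m : ℕ}, 1 ≤ n → n ≤ m → ∀ {t : ℝ}, -T ≤ t → ∀ {s : ℝ}, t ≤ s →
      ‖qFun β n t s - qFun β m t s‖ ≤ D * (edgeNu n)⁻¹ * Real.exp (-s) := by
  obtain ⟨B, hB, h⟩ := edge_stability hβ hT
  obtain ⟨D, hD, hq⟩ := exists_norm_qFun_le hβ hT
  have hK := edgeConst_nonneg T
  set K := edgeConst T
  refine ⟨B * (2 * K + ‖kappaSq β‖ * (6 * K ^ 2 * D * (Real.exp (2 * T) / 2)) + 1),
    by positivity, ?_⟩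
  intro n m hn hnm t ht s hs
  have hm := hn.trans hnm
  have hν := one_le_edgeNu hn
  have hν0 : 0 < edgeNu n := by linarith
  have hνm : (edgeNu m)⁻¹ ≤ (edgeNu n)⁻¹ := inv_anti₀ hν0 (edgeNu_le hnm)
  have hcn := continuous_qFun (β := β) n t
  have hcm := continuous_qFun (β := β) m t
  have hinteg : ∀ {i j : ℕ}, 1 ≤ i → 1 ≤ j → ∀ {x : ℝ}, t ≤ x →
      IntegrableOn (fun y => (edgeKer i x y : ℂ) * qFun β j t y) (Ioi t) := by
    intro i j hi hj x hx
    refine integrableOn_of_exp_bound (C := K ^ 2 * Real.exp (-x) * D) (a := 2)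
      ((Complex.continuous_ofReal.comp (continuous_edgeKer i x)).mul (continuous_qFun j t))
      two_pos fun y hy => ?_
    rw [norm_mul, Complex.norm_real, ← exp_neg_mul_exp_neg]
    refine (mul_le_mul (abs_edgeKer_le hT hi (ht.trans hx) (ht.trans hy)) (hq hj ht hy)
      (norm_nonneg _) (by positivity)).trans_eq ?_
    ring
  have key := h hn ht (f := fun y => qFun β n t y - qFun β m t y) (hcn.sub hcm) ?_
    (ε := (2 * K + ‖kappaSq β‖ * (6 * K ^ 2 * D * (Real.exp (2 * T) / 2)) + 1) * (edgeNu n)⁻¹)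
    (by positivity) ?_ hs
  · refine key.trans_eq (by ring)
  · refine integrableOn_of_exp_bound (C := (2 * D) ^ 2) (a := 2) ((hcn.sub hcm).norm.pow 2)
      two_pos fun y hy => ?_
    rw [Real.norm_of_nonneg (sq_nonneg _), ← exp_neg_mul_exp_neg]
    have : ‖qFun β n t y - qFun β m t y‖ ≤ 2 * D * Real.exp (-y) :=
      (norm_sub_le _ _).trans (by linarith [hq hn ht hy, hq hm ht hy])
    refine (pow_le_pow_left₀ (norm_nonneg _) this 2).trans_eq (by ring)
  · intro x hx
    have e1 : ∫ y in Ioi t, (edgeKer n x y : ℂ) * (qFun β n t y - qFun β m t y) =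
        (∫ y in Ioi t, (edgeKer n x y : ℂ) * qFun β n t y) -
          ∫ y in Ioi t, (edgeKer n x y : ℂ) * qFun β m t y := by
      rw [← integral_sub (hinteg hn hn hx) (hinteg hn hm hx)]
      simp only [mul_sub]
    have e2 : ∫ y in Ioi t, ((edgeKer n x y - edgeKer m x y : ℝ) : ℂ) * qFun β m t y =
        (∫ y in Ioi t, (edgeKer n x y : ℂ) * qFun β m t y) -
          ∫ y in Ioi t, (edgeKer m x y : ℂ) * qFun β m t y := by
      rw [← integral_sub (hinteg hn hm hx) (hinteg hm hm hx)]
      simp only [Complex.ofReal_sub, sub_mul]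
    have e3 : qFun β n t x - qFun β m t x -
        kappaSq β * ∫ y in Ioi t, (edgeKer n x y : ℂ) * (qFun β n t y - qFun β m t y) =
        ((edgeFun 0 n x - edgeFun 0 m x : ℝ) : ℂ) +
          kappaSq β * ∫ y in Ioi t, ((edgeKer n x y - edgeKer m x y : ℝ) : ℂ) * qFun β m t y := by
      rw [e1, e2, Complex.ofReal_sub]
      linear_combination qFun_eq hβ hn t x - qFun_eq hβ hm t x
    have e4 : |edgeFun 0 n x - edgeFun 0 m x| ≤ 2 * K * (edgeNu n)⁻¹ * Real.exp (-x) := by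
      have h1 := abs_edgeFun_sub_airy_le hA hT hn zero_le_one (ht.trans hx)
      have h2 := abs_edgeFun_sub_airy_le hA hT hm zero_le_one (ht.trans hx)
      have h3 : (edgeNu m)⁻¹ * K * Real.exp (-x) ≤ (edgeNu n)⁻¹ * K * Real.exp (-x) := by gcongr
      rw [abs_sub_comm] at h2
      refine (abs_sub_le _ (A x) _).trans ?_
      linarith
    have e5 : ∀ y, t ≤ y → |edgeKer n x y - edgeKer m x y| ≤
        6 * K ^ 2 * (edgeNu n)⁻¹ * Real.exp (-x) * Real.exp (-y) := fun y hy => by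
      have h1 := abs_edgeKer_sub_le hA hT hn (ht.trans hx) (ht.trans hy)
      have h2 := abs_edgeKer_sub_le hA hT hm (ht.trans hx) (ht.trans hy)
      have h3 : 3 * (edgeNu m)⁻¹ * K ^ 2 * Real.exp (-x) * Real.exp (-y) ≤
        3 * (edgeNu n)⁻¹ * K ^ 2 * Real.exp (-x) * Real.exp (-y) := by gcongr
      rw [abs_sub_comm] at h2
      refine (abs_sub_le _ (airyKer A x y) _).trans ?_
      linarith
    have e6 : ‖∫ y in Ioi t, ((edgeKer n x y - edgeKer m x y : ℝ) : ℂ) * qFun β m t y‖ ≤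
        6 * K ^ 2 * (edgeNu n)⁻¹ * Real.exp (-x) * D * (Real.exp (-(2 * t)) / 2) := by
      refine norm_setIntegral_le_exp fun y hy => ?_
      rw [norm_mul, Complex.norm_real, ← exp_neg_mul_exp_neg]
      refine (mul_le_mul (e5 y hy) (hq hm ht hy) (norm_nonneg _) (by positivity)).trans_eq ?_
      ring
    have e7 : Real.exp (-(2 * t)) ≤ Real.exp (2 * T) := Real.exp_le_exp.2 (by linarith)
    rw [e3]
    refine (norm_add_le _ _).trans ?_
    rw [norm_mul, Complex.norm_real]
    calc _ ≤ 2 * K * (edgeNu n)⁻¹ * Real.exp (-x) + ‖kappaSq β‖ *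
          (6 * K ^ 2 * (edgeNu n)⁻¹ * Real.exp (-x) * D * (Real.exp (2 * T) / 2)) := by
          refine add_le_add e4 (mul_le_mul_of_nonneg_left (e6.trans ?_) (norm_nonneg _))
          gcongr
      _ ≤ 2 * K * (edgeNu n)⁻¹ * Real.exp (-x) + ‖kappaSq β‖ *
          (6 * K ^ 2 * (edgeNu n)⁻¹ * Real.exp (-x) * D * (Real.exp (2 * T) / 2)) +
          (edgeNu n)⁻¹ * Real.exp (-x) := le_add_of_nonneg_right (by positivity)
      _ = _ := by ring

lemma exists_norm_gFun_sub_one_le (hβ : |β.re| < 1 / 2) {T : ℝ} (hT : 0 ≤ T) : ∃ D : ℝ, 0 ≤ D ∧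
    ∀ {n : ℕ}, 1 ≤ n → ∀ {t : ℝ}, -T ≤ t → ‖gFun β n t - 1‖ ≤ D * (edgeNu n)⁻¹ := by
  obtain ⟨D, hD, hq⟩ := exists_norm_qFun_le hβ hT
  have hK := edgeConst_nonneg T
  refine ⟨‖kappaSq β‖ * (edgeConst T * D * (Real.exp (2 * T) / 2)), by positivity, ?_⟩
  intro n hn t ht
  have hν0 : 0 < edgeNu n := by linarith [one_le_edgeNu hn]
  have h1 : ‖∫ y in Ioi t, (edgeFun 0 n y : ℂ) * qFun β n t y‖ ≤
      edgeConst T * D * (Real.exp (-(2 * t)) / 2) := by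
    refine norm_setIntegral_le_exp fun y hy => ?_
    rw [norm_mul, Complex.norm_real, ← exp_neg_mul_exp_neg]
    refine (mul_le_mul (abs_edgeFun_le hT hn zero_le_one (ht.trans hy)) (hq hn ht hy)
      (norm_nonneg _) (by positivity)).trans_eq ?_
    ring
  have h2 : Real.exp (-(2 * t)) ≤ Real.exp (2 * T) := Real.exp_le_exp.2 (by linarith)
  rw [gFun_eq hβ hn, sub_sub_cancel_left, norm_neg, norm_mul, norm_mul, Complex.norm_real,
    Real.norm_of_nonneg (inv_nonneg.2 hν0.le), mul_right_comm]
  gcongr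
  refine h1.trans ?_
  gcongr

end

/-! ### The limit of the boundary values and its behaviour at infinity -/

lemma tendsto_edgeNu : Tendsto edgeNu atTop atTop :=
  (tendsto_rpow_atTop (by norm_num : (0 : ℝ) < 1 / 3)).comp tendsto_natCast_atTop_atTop

lemma tendsto_edgeNu_inv : Tendsto (fun n => (edgeNu n)⁻¹) atTop (𝓝 0) :=
  tendsto_inv_atTop_zero.comp tendsto_edgeNu

section
variable {β : ℂ} {A A' : ℝ → ℝ}

lemma exists_limit (hA : IsAiry A A') (hβ : |β.re| < 1 / 2) : ∃ f : ℝ → ℂ, ∀ T : ℝ, 0 ≤ T →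
    ∃ D : ℝ, 0 ≤ D ∧ ∀ n, 1 ≤ n → ∀ t, -T ≤ t → ‖qFun β n t t - f t‖ ≤ D * (edgeNu n)⁻¹ := by
  have hex : ∀ t : ℝ, ∃ z : ℂ, Tendsto (fun n => qFun β n t t) atTop (𝓝 z) := fun t => by
    obtain ⟨D, hD, h⟩ := exists_norm_qFun_sub_le hA hβ (abs_nonneg t)
    have h1 : CauchySeq fun n => qFun β (n + 1) t t := by
      refine cauchySeq_of_le_tendsto_0' (fun n => D * (edgeNu (n + 1))⁻¹ * Real.exp (-t))
        (fun n m hnm => ?_) ?_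
      · rw [dist_eq_norm]
        exact h (Nat.le_add_left 1 n) (by omega) (neg_abs_le t) le_rfl
      · have := ((tendsto_add_atTop_iff_nat 1).2 tendsto_edgeNu_inv).const_mul D
        simpa using this.mul_const (Real.exp (-t))
    obtain ⟨z, hz⟩ := cauchySeq_tendsto_of_complete h1
    exact ⟨z, (tendsto_add_atTop_iff_nat (f := fun n => qFun β n t t) 1).1 hz⟩
  choose f hf using hex
  refine ⟨f, fun T hT => ?_⟩
  obtain ⟨D, hD, h⟩ := exists_norm_qFun_sub_le hA hβ hT
  refine ⟨D * Real.exp T, by positivity, fun n hn t ht => ?_⟩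
  have hν0 : 0 < edgeNu n := by linarith [one_le_edgeNu hn]
  have h1 : ‖qFun β n t t - f t‖ ≤ D * (edgeNu n)⁻¹ * Real.exp (-t) :=
    le_of_tendsto (tendsto_const_nhds.sub (hf t)).norm
      (eventually_atTop.2 ⟨n, fun m hm => h hn hm ht le_rfl⟩)
  refine h1.trans ?_
  rw [mul_right_comm]
  gcongr
  linarith

lemma norm_limit_sub_airy_le (hA : IsAiry A A') (hβ : |β.re| < 1 / 2) : ∃ D : ℝ, 0 ≤ D ∧
    ∀ {t : ℝ}, 0 ≤ t → ∀ {z : ℂ}, Tendsto (fun n => qFun β n t t) atTop (𝓝 z) →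
      ‖z - A t‖ ≤ D * |A t| * Real.exp (-(2 * t)) := by
  obtain ⟨D, hD, hq⟩ := exists_norm_qFun_le hβ le_rfl
  have hK := edgeConst_nonneg 0
  set K := edgeConst 0
  refine ⟨‖kappaSq β‖ * K * D, by positivity, ?_⟩
  intro t ht z hz
  have hn0 : ∀ {x : ℝ}, t ≤ x → -0 ≤ x := fun hx => by rw [neg_zero]; exact ht.trans hx
  have h1 : ∀ n, 1 ≤ n → ‖qFun β n t t - A t‖ ≤ (edgeNu n)⁻¹ * K * Real.exp (-t) + ‖kappaSq β‖ *
      ((2 * K * |A t| + 3 * (edgeNu n)⁻¹ * K ^ 2 * Real.exp (-t)) * D *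
        (Real.exp (-(2 * t)) / 2)) := fun n hn => by
    have hν0 : 0 < edgeNu n := by linarith [one_le_edgeNu hn]
    have hS := abs_edgeFun_sub_airy_le hA le_rfl hn zero_le_one (hn0 le_rfl)
    have hI : ‖∫ y in Ioi t, (edgeKer n t y : ℂ) * qFun β n t y‖ ≤
        (2 * K * |A t| + 3 * (edgeNu n)⁻¹ * K ^ 2 * Real.exp (-t)) * D *
          (Real.exp (-(2 * t)) / 2) := by
      refine norm_setIntegral_le_exp fun y hy => ?_
      have h2 := abs_edgeKer_sub_le hA le_rfl hn (hn0 le_rfl) (hn0 hy)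
      have h3 := abs_airyKer_le hA ht (ht.trans hy)
      have h4 : |edgeKer n t y| ≤
          (2 * K * |A t| + 3 * (edgeNu n)⁻¹ * K ^ 2 * Real.exp (-t)) * Real.exp (-y) := by
        have := abs_sub_abs_le_abs_sub (edgeKer n t y) (airyKer A t y)
        rw [add_mul]
        linarith
      rw [norm_mul, Complex.norm_real, ← exp_neg_mul_exp_neg]
      refine (mul_le_mul h4 (hq hn (hn0 le_rfl) hy) (norm_nonneg _) (by positivity)).trans_eq ?_
      ring
    have e : qFun β n t t - A t = ((edgeFun 0 n t - A t : ℝ) : ℂ) +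
        kappaSq β * ∫ y in Ioi t, (edgeKer n t y : ℂ) * qFun β n t y := by
      push_cast
      linear_combination qFun_eq hβ hn t t
    rw [e]
    refine (norm_add_le _ _).trans ?_
    rw [norm_mul, Complex.norm_real]
    exact add_le_add hS (mul_le_mul_of_nonneg_left hI (norm_nonneg _))
  have h2 : Tendsto (fun n => (edgeNu n)⁻¹ * K * Real.exp (-t) + ‖kappaSq β‖ *
      ((2 * K * |A t| + 3 * (edgeNu n)⁻¹ * K ^ 2 * Real.exp (-t)) * D *
        (Real.exp (-(2 * t)) / 2))) atTop (𝓝 (0 * K * Real.exp (-t) + ‖kappaSq β‖ *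
      ((2 * K * |A t| + 3 * 0 * K ^ 2 * Real.exp (-t)) * D * (Real.exp (-(2 * t)) / 2)))) := by
    have := tendsto_edgeNu_inv
    refine ((this.mul_const _).mul_const _).add (Tendsto.const_mul _ ?_)
    exact (((((this.const_mul _).mul_const _).mul_const _).const_add _).mul_const _).mul_const _
  refine (le_of_tendsto_of_tendsto (hz.sub_const _).norm h2
    (eventually_atTop.2 ⟨1, h1⟩)).trans_eq ?_
  ring

lemma tendsto_div_airy (hA : IsAiry A A') (hβ : |β.re| < 1 / 2) {f : ℝ → ℂ}
    (hf : ∀ t, Tendsto (fun n => qFun β n t t) atTop (𝓝 (f t))) :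
    Tendsto (fun t => f t / (A t : ℂ)) atTop (𝓝 1) := by
  obtain ⟨D, hD, h⟩ := norm_limit_sub_airy_le hA hβ
  rw [tendsto_iff_norm_sub_tendsto_zero]
  have h2 : Tendsto (fun t : ℝ => D * Real.exp (-(2 * t))) atTop (𝓝 0) := by
    have := (Real.tendsto_exp_neg_atTop_nhds_zero.comp
      (tendsto_id.const_mul_atTop (two_pos : (0 : ℝ) < 2))).const_mul D
    simpa using this
  refine squeeze_zero' (Eventually.of_forall fun _ => norm_nonneg _)
    (eventually_atTop.2 ⟨0, fun t ht => ?_⟩) h2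
  have h0 := airy_ne_zero hA ht
  have h0' : (A t : ℂ) ≠ 0 := by exact_mod_cast h0
  rw [div_sub_one h0', norm_div, Complex.norm_real, Real.norm_eq_abs,
    div_le_iff₀ (abs_pos.2 h0), mul_right_comm]
  exact h ht (hf t)

end

/-! ### Limits of second order equations -/

/-- Continuous convergence of a sequence of functions. -/
def ContConv (h : ℕ → ℝ → ℂ) (h0 : ℝ → ℂ) : Prop :=
  ∀ x, Tendsto (fun p : ℕ × ℝ => h p.1 p.2) (atTop ×ˢ 𝓝 x) (𝓝 (h0 x))

namespace ContConv

variable {h : ℕ → ℝ → ℂ} {h0 : ℝ → ℂ}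

lemma tendsto (hh : ContConv h h0) (x : ℝ) : Tendsto (fun n => h n x) atTop (𝓝 (h0 x)) :=
  (hh x).comp (tendsto_id.prodMk tendsto_const_nhds)

lemma eventually_norm_le (hh : ContConv h h0) (hc : Continuous h0) (a b : ℝ) :
    ∃ C : ℝ, ∀ᶠ n in atTop, ∀ x ∈ uIcc a b, ‖h n x‖ ≤ C := by
  obtain ⟨C, hC⟩ := (isCompact_uIcc (a := a) (b := b)).exists_bound_of_continuousOn hc.continuousOn
  refine ⟨C + 1, ?_⟩
  have h1 : ∀ x ∈ uIcc a b, ∀ᶠ p : ℕ × ℝ in atTop ×ˢ 𝓝 x, ‖h p.1 p.2‖ ≤ C + 1 := fun x hx =>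
    ((hh x).norm.eventually_lt_const (lt_add_of_le_of_pos (hC x hx) one_pos)).mono
      fun _ hp => hp.le
  have h2 : ∀ᶠ p : ℕ × ℝ in atTop ×ˢ 𝓝ˢ (uIcc a b), ‖h p.1 p.2‖ ≤ C + 1 := by
    rw [isCompact_uIcc.prod_nhdsSet_eq_biSup]
    simpa only [eventually_iSup] using h1
  exact h2.curry.mono fun _ hn => hn.self_of_nhdsSet

lemma tendsto_integral (hh : ContConv h h0) (hc : Continuous h0) (hn : ∀ n, Continuous (h n))
    (a b : ℝ) : Tendsto (fun n => ∫ x in a..b, h n x) atTop (𝓝 (∫ x in a..b, h0 x)) := by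
  obtain ⟨C, hC⟩ := hh.eventually_norm_le hc a b
  refine intervalIntegral.tendsto_integral_filter_of_dominated_convergence (fun _ => C)
    (Eventually.of_forall fun n => (hn n).aestronglyMeasurable) ?_ intervalIntegrable_const
    (Eventually.of_forall fun x _ => hh.tendsto x)
  filter_upwards [hC] with n hn
  exact Eventually.of_forall fun x hx => hn x (uIoc_subset_uIcc hx)

lemma integral (hh : ContConv h h0) (hc : Continuous h0) (hn : ∀ n, Continuous (h n)) (a : ℝ) :
    ContConv (fun n x => ∫ y in a..x, h n y) fun x => ∫ y in a..x, h0 y := by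
  intro x
  obtain ⟨C, hC⟩ := hh.eventually_norm_le hc (x - 1) (x + 1)
  have h1 : Tendsto (fun p : ℕ × ℝ => ∫ y in a..x, h p.1 y) (atTop ×ˢ 𝓝 x)
      (𝓝 (∫ y in a..x, h0 y)) := (hh.tendsto_integral hc hn a x).comp tendsto_fst
  have h2 : Tendsto (fun p : ℕ × ℝ => ∫ y in x..p.2, h p.1 y) (atTop ×ˢ 𝓝 x) (𝓝 0) := by
    have h3 : Tendsto (fun p : ℕ × ℝ => C * |p.2 - x|) (atTop ×ˢ 𝓝 x) (𝓝 0) := by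
      have : Tendsto (fun y : ℝ => C * |y - x|) (𝓝 x) (𝓝 (C * |x - x|)) :=
        Continuous.tendsto (by fun_prop) x
      rw [sub_self, abs_zero, mul_zero] at this
      exact this.comp tendsto_snd
    refine squeeze_zero_norm' ?_ h3
    have h4 : ∀ᶠ y in 𝓝 x, y ∈ Icc (x - 1) (x + 1) :=
      Icc_mem_nhds (by linarith) (by linarith)
    filter_upwards [hC.prod_mk h4] with p hp
    refine intervalIntegral.norm_integral_le_of_norm_le_const fun y hy => hp.1 y ?_
    have hx : x ∈ uIcc (x - 1) (x + 1) := by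
      rw [uIcc_of_le (by linarith)]; exact ⟨by linarith, by linarith⟩
    have hy2 : p.2 ∈ uIcc (x - 1) (x + 1) := by rw [uIcc_of_le (by linarith)]; exact hp.2
    exact uIcc_subset_uIcc hx hy2 (uIoc_subset_uIcc hy)
  refine ((h1.add h2).congr fun p => ?_).trans_eq (by rw [add_zero])
  exact intervalIntegral.integral_add_adjacent_intervals ((hn _).intervalIntegrable _ _)
    ((hn _).intervalIntegrable _ _)

end ContConv

lemma ode_limit {f F w r : ℕ → ℝ → ℂ} {f0 r0 : ℝ → ℂ}
    (hf' : ∀ n x, HasDerivAt (f n) (w n x * F n x) x) (hF' : ∀ n x, HasDerivAt (F n) (r n x) x)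
    (hwc : ∀ n, Continuous (w n)) (hrc : ∀ n, Continuous (r n)) (hrc0 : Continuous r0)
    (hf : ∀ x, Tendsto (fun n => f n x) atTop (𝓝 (f0 x))) (hw : ContConv w fun _ => 1)
    (hr : ContConv r r0) :
    ∃ F0 : ℝ → ℂ, (∀ x, HasDerivAt f0 (F0 x) x) ∧ ∀ x, HasDerivAt F0 (r0 x) x := by
  have hFc : ∀ n, Continuous (F n) := fun n =>
    continuous_iff_continuousAt.2 fun x => (hF' n x).continuousAt
  have hG : ∀ n x, ∫ y in (0 : ℝ)..x, r n y = F n x - F n 0 := fun n x =>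
    intervalIntegral.integral_eq_sub_of_hasDerivAt (fun y _ => hF' n y)
      ((hrc n).intervalIntegrable _ _)
  have hGc : ∀ n, Continuous fun x => ∫ y in (0 : ℝ)..x, r n y := fun n => by
    simp only [hG]; exact (hFc n).sub continuous_const
  have hG0 : ∀ x, HasDerivAt (fun x => ∫ y in (0 : ℝ)..x, r0 y) (r0 x) x := fun x =>
    (hrc0.integral_hasStrictDerivAt 0 x).hasDerivAt
  have hG0c : Continuous fun x => ∫ y in (0 : ℝ)..x, r0 y :=
    continuous_iff_continuousAt.2 fun x => (hG0 x).continuousAt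
  have hi1 : ∀ n x, IntervalIntegrable (fun y => F n 0 * w n y) volume 0 x := fun n x =>
    (continuous_const.mul (hwc n)).intervalIntegrable _ _
  have hi2 : ∀ n x, IntervalIntegrable (fun y => w n y * ∫ z in (0 : ℝ)..y, r n z) volume 0 x :=
    fun n x => ((hwc n).mul (hGc n)).intervalIntegrable _ _
  have hfi : ∀ n x, f n x - f n 0 = F n 0 * (∫ y in (0 : ℝ)..x, w n y) +
      ∫ y in (0 : ℝ)..x, w n y * ∫ z in (0 : ℝ)..y, r n z := fun n x => by
    rw [← intervalIntegral.integral_eq_sub_of_hasDerivAt (fun y _ => hf' n y)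
      (((hwc n).mul (hFc n)).intervalIntegrable _ _), ← intervalIntegral.integral_const_mul,
      ← intervalIntegral.integral_add (hi1 n x) (hi2 n x)]
    refine intervalIntegral.integral_congr fun y _ => ?_
    simp only [hG]
    ring
  have hw1 : ∀ x : ℝ, Tendsto (fun n => ∫ y in (0 : ℝ)..x, w n y) atTop (𝓝 (x : ℂ)) := fun x => by
    have := hw.tendsto_integral continuous_const hwc 0 x
    simpa using this
  have hw2 : ∀ x, Tendsto (fun n => ∫ y in (0 : ℝ)..x, w n y * ∫ z in (0 : ℝ)..y, r n z) atTop
      (𝓝 (∫ y in (0 : ℝ)..x, ∫ z in (0 : ℝ)..y, r0 z)) := fun x => by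
    have h1 : ContConv (fun n y => w n y * ∫ z in (0 : ℝ)..y, r n z)
        fun y => ∫ z in (0 : ℝ)..y, r0 z := fun y => by
      have := (hw y).mul (hr.integral hrc0 hrc 0 y)
      rwa [one_mul] at this
    exact h1.tendsto_integral hG0c (fun n => (hwc n).mul (hGc n)) 0 x
  obtain ⟨c, hc⟩ : ∃ c : ℂ, Tendsto (fun n => F n 0) atTop (𝓝 c) := by
    refine ⟨_, Tendsto.congr' ?_ ((((hf 1).sub (hf 0)).sub (hw2 1)).div (hw1 1) (by simp))⟩
    have : ∀ᶠ n in atTop, (∫ y in (0 : ℝ)..1, w n y) ≠ 0 :=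
      (hw1 1).eventually_ne (by simp)
    filter_upwards [this] with n hn
    simp only [Pi.div_apply]
    rw [div_eq_iff hn]
    linear_combination hfi n 1
  have hlim : ∀ x : ℝ, f0 x = f0 0 + (c * x + ∫ y in (0 : ℝ)..x, ∫ z in (0 : ℝ)..y, r0 z) :=
    fun x => by
      have h1 := (hc.mul (hw1 x)).add (hw2 x)
      have h2 := ((hf x).sub (hf 0)).congr fun n => hfi n x
      rw [← tendsto_nhds_unique h2 h1]; ring
  refine ⟨fun x => c + ∫ y in (0 : ℝ)..x, r0 y, fun x => ?_, fun x => (hG0 x).const_add c⟩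
  rw [funext hlim]
  refine HasDerivAt.const_add _ (HasDerivAt.add ?_ (hG0c.integral_hasStrictDerivAt 0 x).hasDerivAt)
  simpa using ((hasDerivAt_id x).ofReal_comp).const_mul c

/-! ### The Painlevé II equation for the limit -/

lemma edgePt_sq {n : ℕ} (hn : 1 ≤ n) (t : ℝ) :
    edgeMu n ^ 2 * (edgePt n t ^ 2 - 2 * n) = t + edgeMu n ^ 4 * t ^ 2 := by
  have h1 := sqrt_two_mul_eq hn
  have h2 := edgeMu_sq hn
  have h3 : √(2 * n) ^ 2 = 2 * n := Real.sq_sqrt (by positivity)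
  have h4 : 2 * edgeMu n ^ 3 * √(2 * n) = 1 := by
    rw [h1]; linear_combination (2 * edgeMu n ^ 2 * edgeNu n + 1) * h2
  rw [edgePt]
  linear_combination edgeMu n ^ 2 * h3 + t * h4

lemma edgeMu_cube_mul_edgePt {n : ℕ} (hn : 1 ≤ n) (t : ℝ) :
    4 * edgeMu n ^ 3 * edgePt n t = 2 + 4 * edgeMu n ^ 4 * t := by
  have h1 := sqrt_two_mul_eq hn
  have h2 := edgeMu_sq hn
  rw [edgePt, h1]
  linear_combination 2 * (2 * edgeMu n ^ 2 * edgeNu n + 1) * h2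

lemma tendsto_edgeMu : Tendsto edgeMu atTop (𝓝 0) := by
  have := ((tendsto_rpow_neg_atTop (by norm_num : (0 : ℝ) < 1 / 6)).comp
    tendsto_natCast_atTop_atTop).div_const (√2)
  rw [zero_div] at this
  refine this.congr fun n => ?_
  rw [edgeMu]
  norm_num

lemma contConv_of_rate {h : ℕ → ℝ → ℂ} {h0 : ℝ → ℂ} (hc : Continuous h0)
    (H : ∀ T : ℝ, 0 ≤ T → ∃ D : ℝ, 0 ≤ D ∧ ∀ n, 1 ≤ n → ∀ t, -T ≤ t →
      ‖h n t - h0 t‖ ≤ D * (edgeNu n)⁻¹) : ContConv h h0 := by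
  intro x
  obtain ⟨D, hD, hb⟩ := H (|x| + 1) (by positivity)
  have h1 : Tendsto (fun p : ℕ × ℝ => h0 p.2) (atTop ×ˢ 𝓝 x) (𝓝 (h0 x)) :=
    hc.continuousAt.tendsto.comp tendsto_snd
  have h2 : Tendsto (fun p : ℕ × ℝ => h p.1 p.2 - h0 p.2) (atTop ×ˢ 𝓝 x) (𝓝 0) := by
    have h3 : Tendsto (fun p : ℕ × ℝ => D * (edgeNu p.1)⁻¹) (atTop ×ˢ 𝓝 x) (𝓝 0) := by
      have := (tendsto_edgeNu_inv.const_mul D).comp (tendsto_fst (f := atTop) (g := 𝓝 x))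
      rwa [mul_zero] at this
    refine squeeze_zero_norm' ?_ h3
    have h4 : ∀ᶠ y in 𝓝 x, -(|x| + 1) ≤ y :=
      (lt_mem_nhds (by linarith [neg_abs_le x])).mono fun _ => le_of_lt
    filter_upwards [(eventually_ge_atTop 1).prod_mk h4] with p hp
    exact hb p.1 hp.1 p.2 hp.2
  simpa using h1.add h2

lemma continuous_of_rate {h : ℕ → ℝ → ℂ} {h0 : ℝ → ℂ} (hc : ∀ n, Continuous (h (n + 1)))
    (H : ∀ T : ℝ, 0 ≤ T → ∃ D : ℝ, 0 ≤ D ∧ ∀ n, 1 ≤ n → ∀ t, -T ≤ t →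
      ‖h n t - h0 t‖ ≤ D * (edgeNu n)⁻¹) : Continuous h0 := by
  refine TendstoLocallyUniformly.continuous (F := fun n => h (n + 1)) (p := atTop) ?_
    (Eventually.of_forall hc).frequently
  rw [Metric.tendstoLocallyUniformly_iff]
  intro ε hε x
  obtain ⟨D, hD, hb⟩ := H (|x| + 1) (by positivity)
  refine ⟨Ioi (-(|x| + 1)), Ioi_mem_nhds (by linarith [neg_abs_le x]), ?_⟩
  have h1 := ((tendsto_add_atTop_iff_nat 1).2 tendsto_edgeNu_inv).const_mul D
  rw [mul_zero] at h1
  filter_upwards [h1.eventually_lt_const hε] with n hn y hy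
  rw [dist_comm, dist_eq_norm]
  exact (hb _ (Nat.le_add_left 1 n) y (mem_Ioi.1 hy).le).trans_lt hn

section
variable {β : ℂ}

lemma qFun_self (n : ℕ) (t : ℝ) :
    qFun β n t t = zFun β n (edgePt n t) / (√(2 * edgeMu n * heNorm n) : ℂ) := rfl

lemma sqrt_ne_zero {n : ℕ} (hn : 1 ≤ n) : (√(2 * edgeMu n * heNorm n) : ℂ) ≠ 0 := by
  have h := edgeMu_pos hn
  have h2 := heNorm_pos n
  exact_mod_cast (by positivity : √(2 * edgeMu n * heNorm n) ≠ 0)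

lemma gFun_ne_zero (hβ : |β.re| < 1 / 2) (n : ℕ) (t : ℝ) : gFun β n t ≠ 0 :=
  div_ne_zero (opNorm_ne_zero hβ n _)
    (mul_ne_zero (jumpL_ne_zero β) (by exact_mod_cast (heNorm_pos n).ne'))

lemma hasDerivAt_edgePt (n : ℕ) (t : ℝ) : HasDerivAt (edgePt n) (edgeMu n) t := by
  unfold edgePt
  simpa using ((hasDerivAt_id t).const_mul (edgeMu n)).const_add (√(2 * n))

lemma continuous_gFun (hβ : |β.re| < 1 / 2) (n : ℕ) : Continuous (gFun β n) := by
  have : Continuous (opNorm β n) :=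
    continuous_iff_continuousAt.2 fun l => (hasDerivAt_opNorm hβ n l).continuousAt
  exact (this.comp (continuous_edgePt n)).div_const _

lemma continuous_qFun_self (hβ : |β.re| < 1 / 2) (n : ℕ) :
    Continuous fun t => qFun β (n + 1) t t := by
  simp only [qFun_self]
  have : Continuous (zFun β (n + 1)) :=
    continuous_iff_continuousAt.2 fun l => (hasDerivAt_zFun hβ n l).continuousAt
  exact (this.comp (continuous_edgePt _)).div_const _

lemma recX_edgePt (hβ : |β.re| < 1 / 2) {n : ℕ} (hn : 1 ≤ n) (t : ℝ) :
    recX β n (edgePt n t) = kappaSq β * edgeMu n * qFun β n t t ^ 2 / gFun β n t := by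
  have h0 := sqrt_ne_zero hn
  have h1 := opNorm_ne_zero hβ n (edgePt n t)
  have h2 := jumpL_ne_zero β
  have h3 : ((heNorm n : ℝ) : ℂ) ≠ 0 := by exact_mod_cast (heNorm_pos n).ne'
  have h4 : (√(2 * edgeMu n * heNorm n) : ℂ) ^ 2 = 2 * edgeMu n * heNorm n := by
    have h := edgeMu_pos hn
    have h2 := heNorm_pos n
    exact_mod_cast Real.sq_sqrt (by positivity : 0 ≤ 2 * edgeMu n * heNorm n)
  have h5 : (edgeMu n : ℂ) ≠ 0 := by exact_mod_cast (edgeMu_pos hn).ne'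
  rw [recX, jumpGauss, ← jumpL_mul_kappaSq, gFun, qFun_self, div_pow, h4, zFun, opDiag,
    ← exp_half_sq]
  push_cast
  field_simp

/-- The derivative of the rescaled boundary values, divided by `gFun ^ 2`. -/
def scaledDeriv (β : ℂ) (m : ℕ) (t : ℝ) : ℂ :=
  edgeMu (m + 2) * zDeriv β (m + 1) (edgePt (m + 2) t) /
    (√(2 * edgeMu (m + 2) * heNorm (m + 2)) : ℂ) / gFun β (m + 2) t ^ 2

/-- The derivative of `scaledDeriv`. -/
def scaledRhs (β : ℂ) (n : ℕ) (t : ℝ) : ℂ :=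
  (t + edgeMu n ^ 4 * t ^ 2 - edgeMu n ^ 2 + kappaSq β * (2 + 4 * edgeMu n ^ 4 * t) *
    qFun β n t t ^ 2 / gFun β n t) * qFun β n t t / gFun β n t ^ 2

lemma hasDerivAt_qFun_self (hβ : |β.re| < 1 / 2) (m : ℕ) (t : ℝ) :
    HasDerivAt (fun t => qFun β (m + 2) t t) (gFun β (m + 2) t ^ 2 * scaledDeriv β m t) t := by
  simp only [qFun_self]
  have h := (((hasDerivAt_zFun hβ (m + 1) (edgePt (m + 2) t)).scomp t
    (hasDerivAt_edgePt (m + 2) t))).div_const (√(2 * edgeMu (m + 2) * heNorm (m + 2)) : ℂ)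
  refine h.congr_deriv ?_
  have h1 := gFun_ne_zero hβ (m + 2) t
  rw [scaledDeriv, Complex.real_smul, mul_div_cancel₀ _ (pow_ne_zero 2 h1)]

lemma hasDerivAt_scaledDeriv (hβ : |β.re| < 1 / 2) (m : ℕ) (t : ℝ) :
    HasDerivAt (scaledDeriv β m) (scaledRhs β (m + 2) t) t := by
  have hn : 1 ≤ m + 2 := by omega
  have h0 := sqrt_ne_zero hn
  have h2 := jumpL_ne_zero β
  have h3 : ((heNorm (m + 2) : ℝ) : ℂ) ≠ 0 := by exact_mod_cast (heNorm_pos (m + 2)).ne'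
  have h4 := opNorm_ne_zero hβ (m + 2)
  have h := ((hasDerivAt_zDeriv_div hβ m (edgePt (m + 2) t)).scomp t
    (hasDerivAt_edgePt (m + 2) t)).const_mul
      (edgeMu (m + 2) * (jumpL β * heNorm (m + 2)) ^ 2 /
        (√(2 * edgeMu (m + 2) * heNorm (m + 2)) : ℂ))
  have e : scaledDeriv β m = fun s => edgeMu (m + 2) * (jumpL β * heNorm (m + 2)) ^ 2 /
        (√(2 * edgeMu (m + 2) * heNorm (m + 2)) : ℂ) *
        (zDeriv β (m + 1) (edgePt (m + 2) s) / opNorm β (m + 2) (edgePt (m + 2) s) ^ 2) := by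
    funext s
    have := h4 (edgePt (m + 2) s)
    rw [scaledDeriv, gFun]
    field_simp
  rw [e]
  refine h.congr_deriv ?_
  have h5 : (edgeMu (m + 2) : ℂ) ^ 2 * ((edgePt (m + 2) t : ℂ) ^ 2 - 2 * (m + 2)) =
      t + edgeMu (m + 2) ^ 4 * t ^ 2 := by
    exact_mod_cast edgePt_sq hn t
  have h6 : 4 * (edgeMu (m + 2) : ℂ) ^ 3 * edgePt (m + 2) t = 2 + 4 * edgeMu (m + 2) ^ 4 * t := by
    exact_mod_cast edgeMu_cube_mul_edgePt hn t
  have h7 := h4 (edgePt (m + 2) t)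
  have h8 : zFun β (m + 2) (edgePt (m + 2) t) =
      qFun β (m + 2) t t * (√(2 * edgeMu (m + 2) * heNorm (m + 2)) : ℂ) := by
    rw [qFun_self, div_mul_cancel₀ _ h0]
  rw [Complex.real_smul, recX_edgePt hβ hn, h8, scaledRhs, ← h5, ← h6, gFun]
  field_simp

variable {A A' : ℝ → ℝ}

/-- The limit of the boundary values solves the rescaled Painlevé II equation. -/
lemma exists_painleve_limit (hA : IsAiry A A') (hβ : |β.re| < 1 / 2) : ∃ f F : ℝ → ℂ,
    (∀ T : ℝ, 0 ≤ T → ∃ D : ℝ, 0 ≤ D ∧ ∀ n, 1 ≤ n → ∀ t, -T ≤ t →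
      ‖qFun β n t t - f t‖ ≤ D * (edgeNu n)⁻¹) ∧
    (∀ x, HasDerivAt f (F x) x) ∧
    (∀ x : ℝ, HasDerivAt F (x * f x + 2 * kappaSq β * f x ^ 3) x) ∧
    Tendsto (fun t => f t / (A t : ℂ)) atTop (𝓝 1) := by
  obtain ⟨f, hf⟩ := exists_limit hA hβ
  have hfc : Continuous f := continuous_of_rate (continuous_qFun_self hβ) hf
  have hq := contConv_of_rate hfc hf
  have hg : ContConv (gFun β) fun _ => 1 := contConv_of_rate continuous_const fun T hT => by
    obtain ⟨D, hD, h⟩ := exists_norm_gFun_sub_one_le hβ hT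
    exact ⟨D, hD, fun n hn t ht => h hn ht⟩
  have hr : ContConv (scaledRhs β) fun x => x * f x + 2 * kappaSq β * f x ^ 3 := fun x => by
    have ht : Tendsto (fun p : ℕ × ℝ => (p.2 : ℂ)) (atTop ×ˢ 𝓝 x) (𝓝 (x : ℂ)) :=
      (Complex.continuous_ofReal.tendsto x).comp tendsto_snd
    have hμ : Tendsto (fun p : ℕ × ℝ => (edgeMu p.1 : ℂ)) (atTop ×ˢ 𝓝 x) (𝓝 ((0 : ℝ) : ℂ)) :=
      (Complex.continuous_ofReal.tendsto 0).comp (tendsto_edgeMu.comp tendsto_fst)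
    have h := ((((ht.add ((hμ.pow 4).mul (ht.pow 2))).sub (hμ.pow 2)).add
      (((((hμ.pow 4).const_mul 4).mul ht).const_add 2 |>.const_mul (kappaSq β)).mul
        ((hq x).pow 2) |>.div (hg x) one_ne_zero)).mul (hq x)).div ((hg x).pow 2)
          (pow_ne_zero 2 one_ne_zero)
    refine h.trans_eq (congrArg 𝓝 ?_)
    push_cast
    ring
  have hshift : ∀ {h : ℕ → ℝ → ℂ} {h0 : ℝ → ℂ}, ContConv h h0 →
      ContConv (fun n => h (n + 2)) h0 := fun hh x =>
    (hh x).comp (((tendsto_add_atTop_nat 2).comp tendsto_fst).prodMk tendsto_snd)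
  have hrc : ∀ n, Continuous (scaledRhs β (n + 2)) := fun n => by
    have h1 := continuous_qFun_self hβ (n + 1)
    have h2 := continuous_gFun hβ (n + 2)
    have h3 := gFun_ne_zero hβ (n + 2)
    have h4 : ∀ x, gFun β (n + 2) x ^ 2 ≠ 0 := fun x => pow_ne_zero 2 (h3 x)
    unfold scaledRhs
    fun_prop (disch := assumption)
  have hg2 : ContConv (fun n t => gFun β n t ^ 2) fun _ => 1 := fun x => by
    simpa using (hg x).pow 2
  obtain ⟨F, h1, h2⟩ := ode_limit (f := fun n t => qFun β (n + 2) t t)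
    (w := fun n t => gFun β (n + 2) t ^ 2) (hasDerivAt_qFun_self hβ)
    (hasDerivAt_scaledDeriv hβ) (fun n => (continuous_gFun hβ (n + 2)).pow 2) hrc (by fun_prop)
    (hshift hq).tendsto (hshift hg2) (hshift hr)
  exact ⟨f, F, hf, h1, h2, tendsto_div_airy hA hβ hq.tendsto⟩

end

/-! ### The recurrence coefficient -/

section
variable {β : ℂ}

lemma monicOrthPoly_op (hβ : |β.re| < 1 / 2) (n : ℕ) (l : ℝ) :
    MonicOrthPoly n l β (op β n l) := by
  refine ⟨monic_op β n l, natDegree_op β n l, fun m hm => ?_⟩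
  have h := wInt_op_mul_X_pow hβ hm l
  rw [wInt] at h
  simpa only [eval_mul, eval_pow, eval_X] using h

lemma H_ne_zero (hβ : |β.re| < 1 / 2) (n : ℕ) (l : ℝ) : H n l β ≠ 0 := by
  rw [H_eq_det]; exact det_hankel_ne_zero hβ n l

lemma eq_of_C_mul_op_add (m : ℕ) (l : ℝ) {a b a' b' : ℂ}
    (h : C a * op β (m + 1) l + C b * op β m l = C a' * op β (m + 1) l + C b' * op β m l) :
    a = a' ∧ b = b' := by
  have h1 : (op β (m + 1) l).coeff (m + 1) = 1 := by
    have := (monic_op β (m + 1) l).coeff_natDegree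
    rwa [natDegree_op] at this
  have h2 : (op β m l).coeff (m + 1) = 0 :=
    coeff_eq_zero_of_natDegree_lt (by rw [natDegree_op]; exact m.lt_succ_self)
  have ha : a = a' := by
    have := congrArg (fun p : ℂ[X] => p.coeff (m + 1)) h
    simpa only [coeff_add, coeff_C_mul, h1, h2, mul_one, mul_zero, add_zero] using this
  subst ha
  exact ⟨rfl, C_injective (mul_right_cancel₀ (monic_op β m l).ne_zero (add_left_cancel h))⟩

lemma kappaSq_eq (β : ℂ) : kappaSq β = 1 - Complex.exp (-(2 * Real.pi * Complex.I * β)) := by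
  rw [kappaSq, jumpR, jumpL, ← Complex.exp_sub]
  ring_nf

lemma edgeMu_mul_edgeNu_inv_le {n : ℕ} (hn : 1 ≤ n) :
    edgeMu n * (edgeNu n)⁻¹ ≤ (n : ℝ) ^ (-(1 : ℝ) / 2) := by
  have h : (0 : ℝ) < n := by exact_mod_cast hn
  rw [edgeMu, edgeNu, ← Real.rpow_neg h.le, div_mul_eq_mul_div, ← Real.rpow_add h]
  norm_num
  exact div_le_self (by positivity) (Real.one_le_sqrt.2 one_le_two)

lemma edgeMu_eq (n : ℕ) :
    edgeMu n = (2 : ℝ) ^ (-(1 : ℝ) / 2) * (n : ℝ) ^ (-(1 : ℝ) / 6) := by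
  rw [edgeMu, neg_div 2, Real.rpow_neg two_pos.le, ← Real.sqrt_eq_rpow]
  ring

lemma norm_sq_sub_sq_div_le {f q g : ℂ} {ε D₁ D₂ : ℝ} (hε : ε ≤ 1) (h1 : ‖q - f‖ ≤ D₁ * ε)
    (hD₁ : 0 ≤ D₁) (h2 : ‖g - 1‖ ≤ D₂ * ε) (h3 : D₂ * ε ≤ 1 / 2) :
    ‖f ^ 2 - q ^ 2 / g‖ ≤ 2 * (‖f‖ ^ 2 * D₂ + D₁ * (2 * ‖f‖ + D₁)) * ε := by
  have hg : 1 / 2 ≤ ‖g‖ := by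
    have := norm_sub_norm_le (1 : ℂ) (1 - g)
    rw [sub_sub_cancel, norm_one, norm_sub_rev] at this
    linarith
  have hg0 : g ≠ 0 := norm_pos_iff.1 (by linarith)
  have hq : ‖f + q‖ ≤ 2 * ‖f‖ + D₁ := by
    have e : f + q = 2 * f + (q - f) := by ring
    rw [e]
    refine (norm_add_le _ _).trans ?_
    rw [norm_mul, Complex.norm_ofNat]
    nlinarith
  have e : f ^ 2 - q ^ 2 / g = (f ^ 2 * (g - 1) - (q - f) * (f + q)) / g := by
    field_simp; ring
  rw [e, norm_div, div_le_iff₀ (by linarith)]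
  have h4 : ‖f ^ 2 * (g - 1) - (q - f) * (f + q)‖ ≤
      (‖f‖ ^ 2 * D₂ + D₁ * (2 * ‖f‖ + D₁)) * ε := by
    refine (norm_sub_le _ _).trans ?_
    rw [norm_mul, norm_mul, norm_pow]
    have h5 := mul_le_mul h1 hq (norm_nonneg _) ((norm_nonneg _).trans h1)
    have h6 := mul_le_mul_of_nonneg_left h2 (sq_nonneg ‖f‖)
    linarith
  nlinarith [(norm_nonneg _).trans h4]

end

end DiscontinuousGaussian

open DiscontinuousGaussian

/-- Asymptotics of the recurrence coefficient `Q_n`: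
`Q_n = -2^(-1/2)·u(t)²·n^(-1/6) + O(n^(-1/2))` in the critical edge scaling. -/
theorem recurrence_coefficient_Q_asymptotics
    (β κ : ℂ) (hβ : |β.re| < 1 / 2)
    (hκ : κ ^ 2 = 1 - Complex.exp (-(2 * Real.pi * Complex.I * β)))
    (t : ℝ) (A A' : ℝ → ℝ) (hA : IsAiry A A') :
    ∃ (u : ℝ → ℂ) (C : ℝ) (N : ℕ), IsAblowitzSegur A κ u ∧ 0 < C ∧
      ∀ n : ℕ, N ≤ n →
        H (n - 1) (lam0 t n) β ≠ 0 ∧ H n (lam0 t n) β ≠ 0 ∧ H (n + 1) (lam0 t n) β ≠ 0 ∧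
        ∃ pm pn pp : Polynomial ℂ,
          MonicOrthPoly (n - 1) (lam0 t n) β pm ∧
          MonicOrthPoly n (lam0 t n) β pn ∧
          MonicOrthPoly (n + 1) (lam0 t n) β pp ∧
          ∃ Q R : ℂ,
            (Polynomial.X * pn = pp + Polynomial.C Q * pn + Polynomial.C R * pm) ∧
            (∀ Q' R' : ℂ,
              Polynomial.X * pn = pp + Polynomial.C Q' * pn + Polynomial.C R' * pm →
              Q' = Q ∧ R' = R) ∧
            ‖Q + (((2 : ℝ) ^ (-(1 : ℝ) / 2) : ℝ) : ℂ) * u t ^ 2 *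
                (((n : ℝ) ^ (-(1 : ℝ) / 6) : ℝ) : ℂ)‖ ≤ C * (n : ℝ) ^ (-(1 : ℝ) / 2) := by
  rw [← kappaSq_eq] at hκ
  obtain ⟨f, F, hf, hf', hF', hlim⟩ := exists_painleve_limit hA hβ
  obtain ⟨D₁, hD₁, h1⟩ := hf |t| (abs_nonneg t)
  obtain ⟨D₂, hD₂, h2⟩ := exists_norm_gFun_sub_one_le hβ (abs_nonneg t)
  have ht := neg_abs_le t
  have h3 : ∀ᶠ n in atTop, D₂ * (edgeNu n)⁻¹ < 1 / 2 := by
    have := tendsto_edgeNu_inv.const_mul D₂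
    rw [mul_zero] at this
    exact this.eventually_lt_const one_half_pos
  obtain ⟨N, hN⟩ := eventually_atTop.1 h3
  have hu : ∀ x, HasDerivAt (fun x => κ * f x) (κ * F x) x := fun x => (hf' x).const_mul κ
  have hu' : ∀ x : ℝ, HasDerivAt (fun x => κ * F x)
      (κ * (x * f x + 2 * kappaSq β * f x ^ 3)) x := fun x => (hF' x).const_mul κ
  have hdu : deriv (fun x => κ * f x) = fun x => κ * F x := funext fun x => (hu x).deriv
  set K := ‖kappaSq β‖ * (2 * (‖f t‖ ^ 2 * D₂ + D₁ * (2 * ‖f t‖ + D₁))) with hK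
  have hK0 : 0 ≤ K := by positivity
  refine ⟨fun x => κ * f x, K + 1, max N 1,
    ⟨fun x => (hu x).differentiableAt, ?_, fun x => ?_, ?_⟩, by linarith, fun n hn => ?_⟩
  · rw [hdu]; exact fun x => (hu' x).differentiableAt
  · rw [hdu, (hu' x).deriv, ← hκ]; ring
  · have := hlim.const_mul κ
    rw [mul_one] at this
    exact this.congr fun x => (mul_div_assoc _ _ _).symm
  · have hn1 : 1 ≤ n := (le_max_right _ _).trans hn
    refine ⟨H_ne_zero hβ _ _, H_ne_zero hβ _ _, H_ne_zero hβ _ _, _, _, _,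
      monicOrthPoly_op hβ _ _, monicOrthPoly_op hβ _ _, monicOrthPoly_op hβ _ _, ?_⟩
    obtain ⟨m, rfl⟩ : ∃ m, n = m + 1 := ⟨n - 1, by omega⟩
    have h4 := three_term hβ m (lam0 t (m + 1))
    refine ⟨_, _, h4, fun Q' R' h => ?_, ?_⟩
    · rw [h4, add_assoc, add_assoc] at h
      obtain ⟨ha, hb⟩ := eq_of_C_mul_op_add m _ (add_left_cancel h)
      exact ⟨ha.symm, hb.symm⟩
    · have hν := one_le_edgeNu hn1
      have h5 := norm_sq_sub_sq_div_le (inv_le_one_of_one_le₀ hν) (h1 _ hn1 t ht) hD₁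
        (h2 hn1 ht) (hN _ ((le_max_left _ _).trans hn)).le
      have h6 := edgeMu_mul_edgeNu_inv_le hn1
      have hμ := edgeMu_pos hn1
      have e : -(recX β (m + 1) (lam0 t (m + 1))) + (((2 : ℝ) ^ (-(1 : ℝ) / 2) : ℝ) : ℂ) *
          (κ * f t) ^ 2 * ((((m + 1 : ℕ) : ℝ) ^ (-(1 : ℝ) / 6) : ℝ) : ℂ) = kappaSq β *
          edgeMu (m + 1) * (f t ^ 2 - qFun β (m + 1) t t ^ 2 / gFun β (m + 1) t) := by
        rw [lam0_eq hn1, recX_edgePt hβ hn1, mul_pow, hκ, edgeMu_eq]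
        push_cast
        ring
      rw [e, norm_mul, norm_mul, Complex.norm_real, Real.norm_of_nonneg hμ.le]
      calc _ ≤ ‖kappaSq β‖ * edgeMu (m + 1) * (2 * (‖f t‖ ^ 2 * D₂ + D₁ * (2 * ‖f t‖ + D₁)) *
            (edgeNu (m + 1))⁻¹) := by gcongr
        _ = K * (edgeMu (m + 1) * (edgeNu (m + 1))⁻¹) := by rw [hK]; ring
        _ ≤ (K + 1) * ((m + 1 : ℕ) : ℝ) ^ (-(1 : ℝ) / 2) :=
            mul_le_mul (by linarith) h6 (by have := hμ; positivity) (by linarith)
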